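/- Let f₀ be a FISI polynomial of degree d ≥ 2 and P a one-parameter general-at-infinity deformation of f₀. Then for every sufficiently large R > 0 there exists ε > 0 such that for all s with 0 < |s| < ε the total Milnor number of the critical points of f_s lying outside the ball of radius R satisfies Σ_{a ∈ ℂⁿ : ∇f_s(a)=0, |a|>R} μ_a(f_s) = λ(0) + Σ_{p ∈ W₀} β_p(0), where β_p(0) := μ_{p,gen}(0) + μ_p^∞(0). (Equivalently, in the paper's notation, μ_{II}(s) + μ_{III}(s) = λ(0) + Σ_{p∈W₀} β_p(0).) -/

import Mathlib

open MvPolynomial Filter CategoryTheory Limits Topology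

noncomputable section

abbrev XS (n : ℕ) := Fin n ⊕ Unit
abbrev HV (n : ℕ) := Fin n ⊕ Unit
abbrev TV (n : ℕ) := Fin n ⊕ Fin 3

/-- ℙ^{n-1}, the hyperplane at infinity of ℙⁿ. -/
abbrev PrjInf (n : ℕ) := Projectivization ℂ (Fin n → ℂ)
/-- ℙⁿ. -/
abbrev Prj (n : ℕ) := Projectivization ℂ (HV n → ℂ)

/-- weights for the degree in the `x`-variables only: `s` has weight `0`. -/
def wtx (n : ℕ) : XS n → ℕ := Sum.elim (fun _ => 1) (fun _ => 0)

/-- `P_q`, the degree-`q` homogeneous part of `P` in the variables `x`. -/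
def xpart {n : ℕ} (P : MvPolynomial (XS n) ℂ) (q : ℕ) : MvPolynomial (XS n) ℂ :=
  weightedHomogeneousComponent (wtx n) q P

/-- the evaluation point `(x, s)`. -/
def evA {n : ℕ} (x : Fin n → ℂ) (s : ℂ) : XS n → ℂ := Sum.elim x (fun _ => s)

/-- `deg_x P(·,s) = d` at the parameter value `s`. -/
def DegXAt {n : ℕ} (d : ℕ) (P : MvPolynomial (XS n) ℂ) (s : ℂ) : Prop :=
  (∀ q, d < q → ∀ x : Fin n → ℂ, eval (evA x s) (xpart P q) = 0) ∧
  (∃ x : Fin n → ℂ, eval (evA x s) (xpart P d) ≠ 0)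

/-- the substitution embedding the variables `(x,s)` into the variables `(x,x₀,s,t)`. -/
def embT {n : ℕ} : XS n → MvPolynomial (TV n) ℂ :=
  Sum.elim (fun i => X (Sum.inl i)) (fun _ => X (Sum.inr 1))

/-- The defining polynomial `F = P̃(x,x₀,s) - t·x₀^d` of the total space
`Y ⊂ ℙⁿ × ℂ_s × ℂ_t`, where `P̃ = Σ_{q ≤ d} x₀^{d-q} P_q(x,s)` is the homogenization
of `P` in `x` by the variable `x₀`. -/
def FY {n : ℕ} (d : ℕ) (P : MvPolynomial (XS n) ℂ) : MvPolynomial (TV n) ℂ :=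
  (∑ q ∈ Finset.range (d+1), (X (Sum.inr 0))^(d-q) * aeval embT (xpart P q))
    - X (Sum.inr 2) * (X (Sum.inr 0))^d

/-- the evaluation point `((x,x₀), s, t)` of the variables of `FY`. -/
def evT {n : ℕ} (u : HV n → ℂ) (s t : ℂ) : TV n → ℂ :=
  Sum.elim (fun i => u (Sum.inl i)) ![u (Sum.inr ()), s, t]

/-- `([u], s, t) ∈ Y`. -/
def OnY {n : ℕ} (d : ℕ) (P : MvPolynomial (XS n) ℂ) (u : HV n → ℂ) (s t : ℂ) : Prop :=
  eval (evT u s t) (FY d P) = 0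

/-- all partial derivatives of the defining equation of `Y` — with respect to the
homogeneous coordinates `(x, x₀)` and the affine coordinates `s, t` — vanish at
`([u], s, t)`; together with `OnY` this says `([u],s,t)` is a singular point of `Y`. -/
def AllDerivsVanish {n : ℕ} (d : ℕ) (P : MvPolynomial (XS n) ℂ) (u : HV n → ℂ)
    (s t : ℂ) : Prop :=
  ∀ v : TV n, eval (evT u s t) (pderiv v (FY d P)) = 0

/-- the partial derivatives with respect to the homogeneous coordinates `(x, x₀)`
vanish at `([u], s, t)`; together with `OnY` this says `[u]` is a singular point of the
projective fiber `Y_{s,t}`. -/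
def FiberDerivsVanish {n : ℕ} (d : ℕ) (P : MvPolynomial (XS n) ℂ) (u : HV n → ℂ)
    (s t : ℂ) : Prop :=
  (∀ i : Fin n, eval (evT u s t) (pderiv (Sum.inl i) (FY d P)) = 0) ∧
    eval (evT u s t) (pderiv (Sum.inr 0) (FY d P)) = 0

/-- the partial derivatives with respect to `(x, x₀)` and `t` (but not `s`) vanish;
together with `OnY` this identifies the singular points of `Y_{s,ℂ}`, resp. the critical
points of the projection `σ : Y → ℂ_s`. -/
def SliceDerivsVanish {n : ℕ} (d : ℕ) (P : MvPolynomial (XS n) ℂ) (u : HV n → ℂ)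
    (s t : ℂ) : Prop :=
  FiberDerivsVanish d P u s t ∧ eval (evT u s t) (pderiv (Sum.inr 2) (FY d P)) = 0

/-- `[x] ∈ W_s`: all `∂P_d/∂x_i` vanish at `(x,s)`. -/
def WCond {n : ℕ} (d : ℕ) (P : MvPolynomial (XS n) ℂ) (x : Fin n → ℂ) (s : ℂ) : Prop :=
  ∀ i : Fin n, eval (evA x s) (pderiv (Sum.inl i) (xpart P d)) = 0

/-- `[x] ∈ Σ_s`: moreover `P_{d-1}(x,s) = 0`. -/
def SCond {n : ℕ} (d : ℕ) (P : MvPolynomial (XS n) ℂ) (x : Fin n → ℂ) (s : ℂ) : Prop :=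
  WCond d P x s ∧ eval (evA x s) (xpart P (d-1)) = 0

/-- `φ_d(x) = ∂P_d/∂s (x, 0) = 0`. -/
def PhiCond {n : ℕ} (d : ℕ) (P : MvPolynomial (XS n) ℂ) (x : Fin n → ℂ) : Prop :=
  eval (evA x 0) (pderiv (Sum.inr ()) (xpart P d)) = 0

/-- `W_s ⊂ ℙ^{n-1}` as a set of projective points. -/
def Wset {n : ℕ} (d : ℕ) (P : MvPolynomial (XS n) ℂ) (s : ℂ) : Set (PrjInf n) :=
  {p | WCond d P p.rep s}

/-- `Σ_s ⊂ ℙ^{n-1}` as a set of projective points. -/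
def Sigset {n : ℕ} (d : ℕ) (P : MvPolynomial (XS n) ℂ) (s : ℂ) : Set (PrjInf n) :=
  {p | SCond d P p.rep s}

/-- `f_s = P(·,s)` as a polynomial in `x`. -/
def fS {n : ℕ} (P : MvPolynomial (XS n) ℂ) (s : ℂ) : MvPolynomial (Fin n) ℂ :=
  aeval (Sum.elim X (fun _ => C s)) P

/-- `x` is an affine critical point of `f_s`, i.e. `∂P/∂x_i(x,s) = 0` for all `i`. -/
def CritPt {n : ℕ} (P : MvPolynomial (XS n) ℂ) (x : Fin n → ℂ) (s : ℂ) : Prop :=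
  ∀ i : Fin n, eval (evA x s) (pderiv (Sum.inl i) P) = 0

/-- the set of singular points of the compactified fiber `Y_{s,t} ⊂ ℙⁿ`. -/
def SingYst {n : ℕ} (d : ℕ) (P : MvPolynomial (XS n) ℂ) (s t : ℂ) : Set (Prj n) :=
  {p | OnY d P p.rep s t ∧ FiberDerivsVanish d P p.rep s t}

/-- `f₀ = P(·,0)` is a FISI polynomial: it has finitely many critical points, the
projective closure of each of its fibers has only isolated (= finitely many) singular
points, and the singular locus `W₀` of the slice at infinity is finite. -/
def FISIat {n : ℕ} (d : ℕ) (P : MvPolynomial (XS n) ℂ) (s : ℂ) : Prop :=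
  {x : Fin n → ℂ | CritPt P x s}.Finite ∧ (∀ t : ℂ, (SingYst d P s t).Finite) ∧
    (Wset d P s).Finite

/-- `P` is a FISI deformation: `f₀` is FISI, `W₀` is finite and every `f_s`, for `s` in a
neighbourhood of `0`, has only finitely many critical points. -/
def FISIdef {n : ℕ} (d : ℕ) (P : MvPolynomial (XS n) ℂ) : Prop :=
  FISIat d P 0 ∧ ∃ ε > (0:ℝ), ∀ s : ℂ, ‖s‖ < ε → {x : Fin n → ℂ | CritPt P x s}.Finite

/-- The "Milnor-type" local dimension: given polynomial germs `gs` at a point `a ∈ ℂᵐ`,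
this is the `ℂ`-dimension of the formal power series ring at `a` (identified with
`ℂ[[X]]` via `X ↦ X - a`) modulo the ideal generated by the germs. -/
def germDim {m : ℕ} (gs : Set (MvPolynomial (Fin m) ℂ)) (a : Fin m → ℂ) : ℕ :=
  Module.finrank ℂ (MvPowerSeries (Fin m) ℂ ⧸ Ideal.span
    ((fun g => (MvPolynomial.coeToMvPowerSeries.ringHom
        (aeval (fun i => X i + C (a i)) g) : MvPowerSeries (Fin m) ℂ)) '' gs))

/-- the (choice of an) index `j` with `p.rep j ≠ 0`, used to normalize `v_j = 1`
and to work in the chart `x_j = 1` of `ℙⁿ`. -/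
def jp {n : ℕ} (p : PrjInf n) : Fin n :=
  (Function.ne_iff.mp p.rep_nonzero).choose

lemma jp_spec {n : ℕ} (p : PrjInf n) : p.rep (jp p) ≠ 0 :=
  (Function.ne_iff.mp p.rep_nonzero).choose_spec

/-- the chart coordinates of the point at infinity `p = [v:0]`, where `v` is normalized
by `v_{j(p)} = 1`, in the chart `x_{j(p)} = 1` of `ℙⁿ`; the slot `j(p)` of the chart
carries the coordinate `x₀`, which is `0` at `p`. -/
def chartPt {n : ℕ} (p : PrjInf n) : Fin n → ℂ :=
  fun i => if i = jp p then 0 else p.rep i / p.rep (jp p)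

/-- the chart equation of the compactified fiber `Y_{s,t}` in the chart `x_j = 1` of
`ℙⁿ`: substitute `x_j = 1` in the homogeneous defining equation `FY`, the chart slot `j`
carrying the coordinate `x₀`. -/
def chartEq {n : ℕ} (d : ℕ) (P : MvPolynomial (XS n) ℂ) (j : Fin n) (s t : ℂ) :
    MvPolynomial (Fin n) ℂ :=
  aeval (Sum.elim (fun i => if i = j then 1 else X i) ![X j, C s, C t]) (FY d P)

/-- the chart equation of the hypersurface `{P_d(·,s) = 0} ⊂ ℙ^{n-1}` in the chart
`x_j = 1` of `ℙ^{n-1}` (the chart variable `X j` is unused). -/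
def chartEqInf {n : ℕ} (d : ℕ) (P : MvPolynomial (XS n) ℂ) (j : Fin n) (s : ℂ) :
    MvPolynomial (Fin n) ℂ :=
  aeval (fun i => if i = j then 1 else X i) (aeval (Sum.elim X (fun _ => C s)) (xpart P d))

/-- `μ_p(t,s)`, the Milnor number of the isolated singularity of the compactified fiber
`Y_{s,t}` at the point `p` of the hyperplane at infinity. -/
def muP {n : ℕ} (d : ℕ) (P : MvPolynomial (XS n) ℂ) (p : PrjInf n) (s t : ℂ) : ℕ :=
  germDim (Set.range fun i => pderiv i (chartEq d P (jp p) s t)) (chartPt p)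

/-- `μ_{p,gen}(s) = min_{t ∈ ℂ} μ_p(t,s)`. -/
def muGen {n : ℕ} (d : ℕ) (P : MvPolynomial (XS n) ℂ) (p : PrjInf n) (s : ℂ) : ℕ :=
  sInf (Set.range (muP d P p s))

/-- the local Milnor–Lê number `λ_{p,t}(s) = μ_p(t,s) − μ_{p,gen}(s)`. -/
def lamP {n : ℕ} (d : ℕ) (P : MvPolynomial (XS n) ℂ) (p : PrjInf n) (t s : ℂ) : ℕ :=
  muP d P p s t - muGen d P p s

/-- `μ_p^∞(s)`, the Milnor number at `p` of the hypersurface `{P_d(·,s)=0} ⊂ ℙ^{n-1}`: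
computed in the chart `x_{j(p)} = 1`, adding the generator `X (j p)` to kill the unused
chart variable. -/
def muInf {n : ℕ} (d : ℕ) (P : MvPolynomial (XS n) ℂ) (p : PrjInf n) (s : ℂ) : ℕ :=
  germDim ({g | ∃ i, i ≠ jp p ∧ g = pderiv i (chartEqInf d P (jp p) s)} ∪ {X (jp p)})
    (chartPt p)

/-- the total Milnor number `μ(s)` of the affine singularities of `f_s`. -/
def muTot {n : ℕ} (P : MvPolynomial (XS n) ℂ) (s : ℂ) : ℕ :=
  Module.finrank ℂ (MvPolynomial (Fin n) ℂ ⧸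
    Ideal.span (Set.range fun i => pderiv i (fS P s)))

/-- the local Milnor number `μ_a(f_s)` of `f_s` at the point `a ∈ ℂⁿ`. -/
def muAt {n : ℕ} (P : MvPolynomial (XS n) ℂ) (s : ℂ) (a : Fin n → ℂ) : ℕ :=
  germDim (Set.range fun i => pderiv i (fS P s)) a

/-- the total Milnor–Lê number at infinity `λ(s) = Σ_{p ∈ Σ_s} Σ_{t ∈ ℂ} λ_{p,t}(s)`
(all but finitely many summands vanish). -/
def lamTot {n : ℕ} (d : ℕ) (P : MvPolynomial (XS n) ℂ) (s : ℂ) : ℕ :=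
  ∑ᶠ p ∈ Sigset d P s, ∑ᶠ t : ℂ, lamP d P p t s

/-- the chart coordinates of the affine point `[x : 1] ∈ ℙⁿ` in the chart `x_j = 1`,
the slot `j` carrying the coordinate `x₀` (i.e. `1/x_j`). -/
def chartCo {n : ℕ} (j : Fin n) (x : Fin n → ℂ) : Fin n → ℂ :=
  fun i => if i = j then 1 / x j else x i / x j

/-- the affine discriminant `Δ_P ⊂ ℂ_s × ℂ_t`: the closure of the set of pairs
`(s, f_s(x))` over the affine critical points `x` of `f_s`. -/
def DeltaP {n : ℕ} (P : MvPolynomial (XS n) ℂ) : Set (ℂ × ℂ) :=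
  closure {w : ℂ × ℂ | ∃ x : Fin n → ℂ, CritPt P x w.1 ∧ w.2 = eval (evA x w.1) P}

open MvPolynomial Filter CategoryTheory Limits Topology
noncomputable section

section CM
open RingTheory.Sequence IsLocalRing
open scoped Pointwise

lemma cm_cons {R : Type*} [CommRing R] (r : R) (rs : List R) :
    IsWeaklyRegular R (r :: rs) ↔ IsSMulRegular R r ∧
      IsWeaklyRegular (R ⧸ Ideal.span {r}) (rs.map (Ideal.Quotient.mk (Ideal.span {r}))) := by
  rw [isWeaklyRegular_cons_iff]
  refine and_congr_right' ?_
  have h : r • (⊤ : Submodule R R) = Ideal.span {r} := by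
    rw [← Submodule.ideal_span_singleton_smul]; simp
  rw [(Submodule.quotEquivOfEq _ _ h).isWeaklyRegular_congr]
  exact (isWeaklyRegular_map_algebraMap_iff (R ⧸ Ideal.span {r}) (R ⧸ Ideal.span {r}) rs).symm

lemma cm_append {R : Type*} [CommRing R] (rs : List R) (r : R) :
    IsWeaklyRegular R (rs ++ [r]) ↔ IsWeaklyRegular R rs ∧ IsSMulRegular (R ⧸ Ideal.ofList rs) r := by
  rw [isWeaklyRegular_append_iff, isWeaklyRegular_singleton_iff]
  refine and_congr_right' ?_
  have h : Ideal.ofList rs • (⊤ : Submodule R R) = Ideal.ofList rs := by simp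
  exact (Submodule.quotEquivOfEq _ _ h).isSMulRegular_congr r

lemma cm_reg_iff {R M : Type*} [CommRing R] [IsNoetherianRing R] [AddCommGroup M] [Module R M]
    (r : R) : IsSMulRegular M r ↔ ∀ p ∈ associatedPrimes R M, r ∉ p := by
  have h := biUnion_associatedPrimes_eq_zero_divisors R M
  have h2 : (∀ p ∈ associatedPrimes R M, r ∉ p) ↔ r ∉ ⋃ p ∈ associatedPrimes R M, (p : Set R) := by
    simp
  rw [h2, h, isSMulRegular_iff_right_eq_zero_of_smul]
  simp only [Set.mem_ofPred_eq, not_exists, not_and]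
  exact ⟨fun H x hx h => hx (H x h), fun H x h => by_contra fun hx => H x hx h⟩

theorem cm_exchange : ∀ (N : ℕ) {R : Type*} [CommRing R] [IsNoetherianRing R] [IsLocalRing R]
    (as bs : List R) (_ : as.length = N) (_ : bs.length = N)
    (_ : ∀ a ∈ as, a ∈ maximalIdeal R) (_ : ∀ b ∈ bs, b ∈ maximalIdeal R)
    (_ : IsWeaklyRegular R as)
    (_ : ∀ Q : Ideal R, Q.IsPrime → Ideal.ofList bs ≤ Q → Q = maximalIdeal R),
    IsWeaklyRegular R bs := by
  intro N
  induction N with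
  | zero =>
    intro R _ _ _ as bs h1 h2 _ _ _ _
    rw [List.length_eq_zero_iff] at h2; subst h2
    exact .nil _ _
  | succ N ih =>
    intro R _ _ _ as bs h1 h2 hma hmb has hbs
    obtain ⟨a, as, rfl⟩ := List.exists_cons_of_length_eq_add_one h1
    obtain ⟨b, bs, rfl⟩ := List.exists_cons_of_length_eq_add_one h2
    simp only [List.length_cons, add_left_inj] at h1 h2
    have hma' : ∀ x ∈ as, x ∈ maximalIdeal R := fun x hx => hma x (List.mem_cons_of_mem _ hx)
    have hmb' : ∀ x ∈ bs, x ∈ maximalIdeal R := fun x hx => hmb x (List.mem_cons_of_mem _ hx)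
    have haa : a ∈ maximalIdeal R := hma a List.mem_cons_self
    have hbb : b ∈ maximalIdeal R := hmb b List.mem_cons_self
    have has2 : IsWeaklyRegular R (as ++ [a]) :=
      IsLocalRing.isWeaklyRegular_of_perm_of_subset_maximalIdeal has (by simpa using (List.perm_append_comm (l₁ := [a]) (l₂ := as))) hma
    rw [cm_append] at has2
    obtain ⟨has3, hareg⟩ := has2
    -- m not minimal over bs
    have hmin : maximalIdeal R ∉ (Ideal.ofList bs).minimalPrimes := by
      intro hm
      classical
      have e1 := Ideal.height_le_card_of_mem_minimalPrimes_span_finset (s := bs.toFinset)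
        (p := maximalIdeal R) (by simpa [Ideal.ofList] using hm)
      have e2 := ringKrullDim_add_length_eq_ringKrullDim_of_isRegular _
        (IsRegular.of_isWeaklyRegular_of_mem_maximalIdeal R hma has)
      rw [← IsLocalRing.maximalIdeal_height_eq_ringKrullDim (R := R)] at e2
      have e3 : (0 : WithBot ℕ∞) ≤ ringKrullDim (R ⧸ Ideal.ofList (a :: as)) := by
        have : Ideal.ofList (a :: as) ≠ ⊤ := by
          intro h
          have : Ideal.ofList (a :: as) ≤ maximalIdeal R := Ideal.span_le.mpr hma
          exact Ideal.IsPrime.ne_top' (top_le_iff.mp (h ▸ this))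
        have := Ideal.Quotient.nontrivial_iff.mpr this
        exact ringKrullDim_nonneg_of_nontrivial
      have e4 : ((N + 1 : ℕ) : WithBot ℕ∞) ≤ (maximalIdeal R).height := by
        rw [← e2, ← h1]
        simpa using add_le_add_left e3 ((as.length : WithBot ℕ∞) + 1)
      have e5 : (maximalIdeal R).height ≤ (N : ℕ∞) :=
        e1.trans (by exact_mod_cast (List.toFinset_card_le bs).trans h2.le)
      have e6 : ((N + 1 : ℕ) : WithBot ℕ∞) ≤ ((N : ℕ∞) : WithBot ℕ∞) :=
        e4.trans (by exact_mod_cast e5)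
      have e7 : ((N + 1 : ℕ) : ℕ∞) ≤ (N : ℕ∞) := by exact_mod_cast e6
      have : N + 1 ≤ N := by exact_mod_cast e7
      omega
    -- choose c
    obtain ⟨c, hcm, hc1, hc2⟩ : ∃ c ∈ maximalIdeal R,
        (∀ p ∈ associatedPrimes R (R ⧸ Ideal.ofList as), c ∉ p) ∧
        (∀ p ∈ (Ideal.ofList bs).minimalPrimes, c ∉ p) := by
      have hfin : (associatedPrimes R (R ⧸ Ideal.ofList as) ∪ (Ideal.ofList bs).minimalPrimes).Finite :=
        (associatedPrimes.finite _ _).union (Ideal.finite_minimalPrimes_of_isNoetherianRing _ _)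
      have := (Ideal.subset_union_prime_finite hfin (f := id) ⊤ ⊤
        (by rintro p (hp | hp) _ _
            · exact hp.isPrime
            · exact hp.isPrime) (I := maximalIdeal R)).not.mpr (by
        rintro ⟨p, hp | hp, hle⟩
        · exact (cm_reg_iff a).mp hareg p hp (hle haa)
        · have hpp : p.IsPrime := hp.isPrime
          have : p = maximalIdeal R := le_antisymm (le_maximalIdeal hpp.ne_top) hle
          exact hmin (this ▸ hp))
      obtain ⟨c, hc, hc'⟩ := Set.not_subset.mp this
      simp only [id, Set.mem_iUnion, not_exists] at hc'
      exact ⟨c, hc, fun p hp h => hc' p (Or.inl hp) h, fun p hp h => hc' p (Or.inr hp) h⟩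
    -- (bs, c) primary
    have hprim : ∀ Q : Ideal R, Q.IsPrime → Ideal.ofList bs ≤ Q → c ∈ Q → Q = maximalIdeal R := by
      intro Q hQ hle hcQ
      obtain ⟨p, hp, hpQ⟩ := Ideal.exists_minimalPrimes_le hle
      by_contra hne
      have hpp : p.IsPrime := hp.isPrime
      have hlt1 : p < Q := lt_of_le_of_ne hpQ (by rintro rfl; exact hc2 p hp hcQ)
      have hlt2 : Q < maximalIdeal R := lt_of_le_of_ne (le_maximalIdeal hQ.ne_top) hne
      have hmm : maximalIdeal R ∈ (p ⊔ Ideal.span {b}).minimalPrimes := by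
        refine ⟨⟨inferInstance, sup_le (le_maximalIdeal hpp.ne_top) (by simpa [Ideal.span_le] using hbb)⟩, ?_⟩
        rintro Q' ⟨hQ', hle'⟩ _
        refine (hbs Q' hQ' ?_).ge
        rw [Ideal.ofList_cons]
        exact sup_le (le_sup_right.trans hle') (hp.1.2.trans (le_sup_left.trans hle'))
      have hh := Ideal.map_height_le_one_of_mem_minimalPrimes hmm
      have hsurj := Ideal.Quotient.mk_surjective (I := p)
      have hmap : ∀ {J : Ideal R}, p ≤ J → (J.map (Ideal.Quotient.mk p)).comap (Ideal.Quotient.mk p) = J := by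
        intro J hJ
        rw [Ideal.comap_map_of_surjective _ hsurj]
        simpa [← RingHom.ker_eq_comap_bot] using hJ
      have hQp : (Q.map (Ideal.Quotient.mk p)).IsPrime :=
        Ideal.map_isPrime_of_surjective hsurj (by simpa using hpQ)
      have hMp : ((maximalIdeal R).map (Ideal.Quotient.mk p)).IsPrime :=
        Ideal.map_isPrime_of_surjective hsurj (by simpa using le_maximalIdeal hpp.ne_top)
      have hlt3 : (Q.map (Ideal.Quotient.mk p)) < ((maximalIdeal R).map (Ideal.Quotient.mk p)) := by
        refine lt_of_le_of_ne (Ideal.map_mono hlt2.le) fun h => hlt2.ne ?_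
        rw [← hmap hpQ, h, hmap (hpQ.trans hlt2.le)]
      have hlt4 : (⊥ : Ideal (R ⧸ p)) < Q.map (Ideal.Quotient.mk p) := by
        refine bot_lt_iff_ne_bot.mpr fun h => hlt1.ne ?_
        rw [← hmap hpQ, h, ← RingHom.ker_eq_comap_bot]; simp
      have h5 := Ideal.height_add_one_le_of_lt_of_isPrime hlt3
      have h6 := Ideal.height_add_one_le_of_lt_of_isPrime hlt4
      have h7 : (2 : ℕ∞) ≤ 1 := by
        calc (2 : ℕ∞) = 0 + 1 + 1 := by norm_num
          _ ≤ (⊥ : Ideal (R ⧸ p)).height + 1 + 1 := by gcongr; exact zero_le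
          _ ≤ _ := by gcongr
          _ ≤ _ := h5
          _ ≤ 1 := hh
      exact absurd h7 (by decide)
    -- regular sequences
    have r1 : IsWeaklyRegular R (as ++ [c]) := (cm_append _ _).mpr ⟨has3, (cm_reg_iff c).mpr hc1⟩
    have r2 : IsWeaklyRegular R (c :: as) :=
      IsLocalRing.isWeaklyRegular_of_perm_of_subset_maximalIdeal r1 (by simpa using (List.perm_append_comm (l₁ := as) (l₂ := [c])))
        (by intro r hr; rcases List.mem_append.mp hr with h | h
            · exact hma' r h
            · rw [List.mem_singleton.mp h]; exact hcm)
    obtain ⟨r3, r4⟩ := (cm_cons _ _).mp r2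
    have hnt : Nontrivial (R ⧸ Ideal.span {c}) := Ideal.Quotient.nontrivial_iff.mpr (by
      intro h; rw [Ideal.span_singleton_eq_top] at h; exact (mem_maximalIdeal _).mp hcm h)
    have hloc : IsLocalRing (R ⧸ Ideal.span {c}) :=
      IsLocalRing.of_surjective' (Ideal.Quotient.mk _) Ideal.Quotient.mk_surjective
    have hmaxc : maximalIdeal (R ⧸ Ideal.span {c}) = (maximalIdeal R).map (Ideal.Quotient.mk _) :=
      (IsLocalRing.map_maximalIdeal_of_surjective (Ideal.Quotient.mk _) Ideal.Quotient.mk_surjective).symm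
    have r5 : IsWeaklyRegular (R ⧸ Ideal.span {c}) (bs.map (Ideal.Quotient.mk (Ideal.span {c}))) := by
      refine ih (as.map (Ideal.Quotient.mk (Ideal.span {c}))) _ (by simp [h1]) (by simp [h2]) ?_ ?_ r4 ?_
      · intro x hx
        obtain ⟨y, hy, rfl⟩ := List.mem_map.mp hx
        rw [hmaxc]; exact Ideal.mem_map_of_mem _ (hma' y hy)
      · intro x hx
        obtain ⟨y, hy, rfl⟩ := List.mem_map.mp hx
        rw [hmaxc]; exact Ideal.mem_map_of_mem _ (hmb' y hy)
      · intro Q hQ hle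
        rw [← Ideal.map_ofList, Ideal.map_le_iff_le_comap] at hle
        have hc : c ∈ Q.comap (Ideal.Quotient.mk (Ideal.span {c})) := by
          rw [Ideal.mem_comap, Ideal.Quotient.eq_zero_iff_mem.mpr (Ideal.mem_span_singleton_self c)]
          exact Q.zero_mem
        have := hprim _ (hQ.comap _) hle hc
        rw [hmaxc, ← this, Ideal.map_comap_of_surjective _ Ideal.Quotient.mk_surjective]
    have r6 : IsWeaklyRegular R (c :: bs) := (cm_cons _ _).mpr ⟨r3, r5⟩
    have r7 : IsWeaklyRegular R (bs ++ [c]) :=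
      IsLocalRing.isWeaklyRegular_of_perm_of_subset_maximalIdeal r6 (by simpa using (List.perm_append_comm (l₁ := [c]) (l₂ := bs)))
        (by intro r hr; rcases List.mem_cons.mp hr with h | h
            · rw [h]; exact hcm
            · exact hmb' r h)
    obtain ⟨r8, r9⟩ := (cm_append _ _).mp r7
    have r10 : IsWeaklyRegular R (bs ++ [b]) := by
      refine (cm_append _ _).mpr ⟨r8, (cm_reg_iff b).mpr fun p hp hb => ?_⟩
      have hpp : p.IsPrime := hp.isPrime
      have hann : Ideal.ofList bs ≤ p := by
        have := hp.annihilator_le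
        rwa [Submodule.annihilator_top, Ideal.annihilator_quotient] at this
      have : p = maximalIdeal R := hbs p hpp (by
        rw [Ideal.ofList_cons]
        exact sup_le (by simpa [Ideal.span_le] using hb) hann)
      exact (cm_reg_iff c).mp r9 p hp (this ▸ hcm)
    exact IsLocalRing.isWeaklyRegular_of_perm_of_subset_maximalIdeal r10 (by simpa using (List.perm_append_comm (l₁ := bs) (l₂ := [b])))
        (by intro r hr; rcases List.mem_append.mp hr with h | h
            · exact hmb' r h
            · rw [List.mem_singleton.mp h]; exact hbb)
end CM
end

open MvPolynomial Filter CategoryTheory Limits Topology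
noncomputable section

section CMPS
open RingTheory.Sequence IsLocalRing

variable {σ : Type*} {k : Type*} [Field k]

lemma ps_mem_ofList (l : List σ) (f : MvPowerSeries σ k) :
    f ∈ Ideal.ofList (l.map (fun i => (MvPowerSeries.X i : MvPowerSeries σ k))) ↔
      ∀ m : σ →₀ ℕ, (∀ i ∈ l, m i = 0) → MvPowerSeries.coeff m f = 0 := by
  classical
  induction l generalizing f with
  | nil =>
    simp only [List.map_nil, Ideal.ofList_nil, Ideal.mem_bot, List.not_mem_nil, false_implies,
      implies_true, true_implies]
    exact ⟨fun h m => by simp [h], fun h => MvPowerSeries.ext fun m => by simpa using h m⟩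
  | cons i l ih =>
    rw [List.map_cons, Ideal.ofList_cons, Submodule.mem_sup]
    constructor
    · rintro ⟨y, hy, z, hz, rfl⟩ m hm
      rw [ih] at hz
      rw [Ideal.mem_span_singleton, MvPowerSeries.X_dvd_iff] at hy
      rw [map_add, hy m (hm i List.mem_cons_self), hz m (fun j hj => hm j (List.mem_cons_of_mem _ hj)),
        add_zero]
    · intro h
      let r : MvPowerSeries σ k := fun m => if m i = 0 then MvPowerSeries.coeff m f else 0
      have hr : ∀ m, MvPowerSeries.coeff m r = if m i = 0 then MvPowerSeries.coeff m f else 0 :=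
        fun m => rfl
      refine ⟨f - r, ?_, r, ?_, by ring⟩
      · rw [Ideal.mem_span_singleton, MvPowerSeries.X_dvd_iff]
        intro m hm
        rw [map_sub, hr, if_pos hm, sub_self]
      · rw [ih]
        intro m hm
        rw [hr]
        split_ifs with h0
        · exact h m (by simpa [h0] using hm)
        · rfl

lemma ps_maximalIdeal_mem (f : MvPowerSeries σ k) :
    f ∈ maximalIdeal (MvPowerSeries σ k) ↔ MvPowerSeries.constantCoeff f = 0 := by
  rw [mem_maximalIdeal, mem_nonunits_iff, MvPowerSeries.isUnit_iff_constantCoeff, isUnit_iff_ne_zero,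
    not_not]

lemma ps_vars_regular (l : List σ) (hl : l.Nodup) :
    IsWeaklyRegular (MvPowerSeries σ k) (l.map (fun i => (MvPowerSeries.X i : MvPowerSeries σ k))) := by
  classical
  induction l using List.reverseRecOn with
  | nil => exact .nil _ _
  | append_singleton l i ih =>
    rw [List.nodup_append] at hl
    rw [List.map_append, List.map_cons, List.map_nil, cm_append]
    refine ⟨ih hl.1, ?_⟩
    have hi : i ∉ l := fun h => hl.2.2 i h i (by simp) rfl
    rw [isSMulRegular_iff_right_eq_zero_of_smul]
    intro x hx
    obtain ⟨f, rfl⟩ := Ideal.Quotient.mk_surjective x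
    rw [← Ideal.Quotient.mk_eq_mk, ← Submodule.Quotient.mk_smul, Submodule.Quotient.mk_eq_zero,
      ps_mem_ofList] at hx
    rw [Ideal.Quotient.eq_zero_iff_mem, ps_mem_ofList]
    intro m hm
    have := hx (m + Finsupp.single i 1) (by
      intro j hj
      have : i ≠ j := by rintro rfl; exact hi hj
      simp [hm j hj, this])
    rw [smul_eq_mul, add_comm, MvPowerSeries.X, MvPowerSeries.coeff_add_monomial_mul, one_mul] at this
    exact this

lemma ps_maximalIdeal_eq [Fintype σ] :
    maximalIdeal (MvPowerSeries σ k) =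
      Ideal.ofList ((Finset.univ : Finset σ).toList.map (fun i => (MvPowerSeries.X i : MvPowerSeries σ k))) := by
  ext f
  rw [ps_maximalIdeal_mem, ps_mem_ofList, ← MvPowerSeries.coeff_zero_eq_constantCoeff_apply]
  constructor
  · intro h m hm
    have : m = 0 := by ext i; exact hm i (by simp)
    rw [this, h]
  · intro h; exact h 0 (by simp)

lemma ps_le_of_X_mem [Fintype σ] (Q : Ideal (MvPowerSeries σ k))
    (h : ∀ i, (MvPowerSeries.X i : MvPowerSeries σ k) ∈ Q) : maximalIdeal (MvPowerSeries σ k) ≤ Q := by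
  rw [ps_maximalIdeal_eq]
  refine Ideal.span_le.mpr ?_
  intro x hx
  obtain ⟨i, -, rfl⟩ := List.mem_map.mp hx
  exact h i

theorem ps_cm [Fintype σ] (bs : List (MvPowerSeries σ k)) (hlen : bs.length = Fintype.card σ)
    (hb : ∀ b ∈ bs, MvPowerSeries.constantCoeff b = 0)
    (hprim : ∀ Q : Ideal (MvPowerSeries σ k), Q.IsPrime → Ideal.ofList bs ≤ Q → Q = maximalIdeal _) :
    IsWeaklyRegular (MvPowerSeries σ k) bs := by
  refine cm_exchange (Fintype.card σ)
    ((Finset.univ : Finset σ).toList.map (fun i => (MvPowerSeries.X i : MvPowerSeries σ k)))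
    bs (by simp) hlen ?_ (fun b h => (ps_maximalIdeal_mem b).mpr (hb b h)) (ps_vars_regular _ (Finset.nodup_toList _)) hprim
  intro a ha
  obtain ⟨i, -, rfl⟩ := List.mem_map.mp ha
  rw [ps_maximalIdeal_mem]; simp

end CMPS
end

open MvPolynomial Filter CategoryTheory Limits Topology
noncomputable section
set_option linter.unusedSectionVars false

section Germ
open IsLocalRing

variable {σ : Type*} [Fintype σ] {k : Type*} [Field k]

lemma ps_mem_pow_of_coeff (K : ℕ) (f : MvPowerSeries σ k)
    (hf : ∀ m : σ →₀ ℕ, m.degree < K → MvPowerSeries.coeff m f = 0) :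
    f ∈ maximalIdeal (MvPowerSeries σ k) ^ K := by
  classical
  induction K generalizing f with
  | zero => simp
  | succ K ih =>
    have key : ∀ (l : List σ) (f : MvPowerSeries σ k),
        (∀ m : σ →₀ ℕ, m.degree < K + 1 → MvPowerSeries.coeff m f = 0) →
        (∀ m : σ →₀ ℕ, (∀ i ∈ l, m i = 0) → MvPowerSeries.coeff m f = 0) →
        f ∈ maximalIdeal (MvPowerSeries σ k) * maximalIdeal (MvPowerSeries σ k) ^ K := by
      intro l
      induction l with
      | nil =>
        intro f h1 h2
        have : f = 0 := MvPowerSeries.ext fun m => by simpa using h2 m (by simp)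
        rw [this]; exact zero_mem _
      | cons i l ihl =>
        intro f h1 h2
        let r : MvPowerSeries σ k := fun m => if m i = 0 then MvPowerSeries.coeff m f else 0
        have hr : ∀ m, MvPowerSeries.coeff m r = if m i = 0 then MvPowerSeries.coeff m f else 0 :=
          fun m => rfl
        have e1 : r ∈ maximalIdeal (MvPowerSeries σ k) * maximalIdeal (MvPowerSeries σ k) ^ K := by
          refine ihl r ?_ ?_
          · intro m hm; rw [hr, h1 m hm, ite_self]
          · intro m hm
            rw [hr]
            split_ifs with h0
            · exact h2 m (by simpa [h0] using hm)
            · rfl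
        have e2 : (MvPowerSeries.X i : MvPowerSeries σ k) ∣ f - r := by
          rw [MvPowerSeries.X_dvd_iff]
          intro m hm
          rw [map_sub, hr, if_pos hm, sub_self]
        obtain ⟨g, hg⟩ := e2
        have e3 : g ∈ maximalIdeal (MvPowerSeries σ k) ^ K := by
          refine ih g fun m hm => ?_
          have := congrArg (MvPowerSeries.coeff (Finsupp.single i 1 + m)) hg
          rw [MvPowerSeries.X, MvPowerSeries.coeff_add_monomial_mul, one_mul, map_sub, hr, if_neg (by simp),
            sub_zero, h1 _ (by simp; omega)] at this
          exact this.symm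
        have : f = MvPowerSeries.X i * g + r := by rw [← hg]; ring
        rw [this]
        refine add_mem (Ideal.mul_mem_mul ?_ e3) e1
        rw [ps_maximalIdeal_mem]; simp
    rw [pow_succ']
    refine key Finset.univ.toList f hf fun m hm => hf m ?_
    have : m = 0 := by ext i; exact hm i (by simp)
    simp [this]

/-- coercion of polynomials to power series. -/
abbrev cps : MvPolynomial σ k →+* MvPowerSeries σ k := MvPolynomial.coeToMvPowerSeries.ringHom

lemma cps_map_vars : (idealOfVars σ k).map (cps (σ := σ) (k := k)) = maximalIdeal (MvPowerSeries σ k) := by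
  refine le_antisymm ?_ (ps_le_of_X_mem _ fun i => ?_)
  · rw [Ideal.map_le_iff_le_comap, Ideal.span_le]
    rintro _ ⟨i, rfl⟩
    rw [SetLike.mem_coe, Ideal.mem_comap, ps_maximalIdeal_mem]; simp
  · have := Ideal.mem_map_of_mem (cps (σ := σ) (k := k)) (Ideal.subset_span (Set.mem_range_self i) : (X i : MvPolynomial σ k) ∈ idealOfVars σ k)
    simpa using this

/-- truncation map modulo an ideal -/
def tauHom (J : Ideal (MvPolynomial σ k)) (K : ℕ) :
    MvPowerSeries σ k →ₐ[k] MvPolynomial σ k ⧸ (J ⊔ idealOfVars σ k ^ K) :=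
  (Ideal.Quotient.factorₐ k (le_sup_right : idealOfVars σ k ^ K ≤ J ⊔ idealOfVars σ k ^ K)).comp
    ((MvPowerSeries.truncTotalAlgHom σ k K).restrictScalars k)

lemma tauHom_apply (J : Ideal (MvPolynomial σ k)) (K : ℕ) (f : MvPowerSeries σ k) :
    tauHom J K f = Ideal.Quotient.mk _ (f.truncTotal K) := rfl

lemma tauHom_cps (J : Ideal (MvPolynomial σ k)) (K : ℕ) (f : MvPolynomial σ k) :
    tauHom J K (cps f) = Ideal.Quotient.mk _ f := by
  have h := (MvPowerSeries.truncTotalAlgHom σ k K).commutes f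
  have : tauHom J K (cps f) = Ideal.Quotient.factorₐ k (le_sup_right : idealOfVars σ k ^ K ≤ J ⊔ idealOfVars σ k ^ K) 
    (MvPowerSeries.truncTotalAlgHom σ k K (algebraMap _ _ f)) := rfl
  rw [this, h]; rfl

lemma tauHom_ker (J : Ideal (MvPolynomial σ k)) (K : ℕ) :
    RingHom.ker (tauHom J K) = J.map cps ⊔ maximalIdeal (MvPowerSeries σ k) ^ K := by
  refine le_antisymm ?_ (sup_le ?_ ?_)
  · intro F hF
    rw [RingHom.mem_ker, tauHom_apply, Ideal.Quotient.eq_zero_iff_mem] at hF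
    have h1 : cps (F.truncTotal K) ∈ J.map cps ⊔ maximalIdeal (MvPowerSeries σ k) ^ K := by
      have := Ideal.mem_map_of_mem (cps (σ := σ) (k := k)) hF
      rwa [Ideal.map_sup, Ideal.map_pow, cps_map_vars] at this
    have h2 : F - cps (F.truncTotal K) ∈ maximalIdeal (MvPowerSeries σ k) ^ K := by
      refine ps_mem_pow_of_coeff K _ fun m hm => ?_
      simp [MvPowerSeries.coeff_truncTotal _ hm]
    have : F = cps (F.truncTotal K) + (F - cps (F.truncTotal K)) := by ring
    rw [this]; exact add_mem h1 (Ideal.mem_sup_right h2)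
  · rw [Ideal.map_le_iff_le_comap]
    intro f hf
    rw [Ideal.mem_comap, RingHom.mem_ker, tauHom_cps, Ideal.Quotient.eq_zero_iff_mem]
    exact Ideal.mem_sup_left hf
  · rw [← cps_map_vars, ← Ideal.map_pow, Ideal.map_le_iff_le_comap]
    intro f hf
    rw [Ideal.mem_comap, RingHom.mem_ker, tauHom_cps, Ideal.Quotient.eq_zero_iff_mem]
    exact Ideal.mem_sup_right hf

lemma tauHom_surj (J : Ideal (MvPolynomial σ k)) (K : ℕ) : Function.Surjective (tauHom J K) := by
  intro x
  obtain ⟨f, rfl⟩ := Ideal.Quotient.mk_surjective x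
  exact ⟨cps f, tauHom_cps _ _ _⟩

/-- `k[[y]]/(J + m^K) ≅ k[y]/(J + m^K)`. -/
def tauEquiv (J : Ideal (MvPolynomial σ k)) (K : ℕ) :
    (MvPowerSeries σ k ⧸ (J.map cps ⊔ maximalIdeal (MvPowerSeries σ k) ^ K)) ≃ₐ[k]
      MvPolynomial σ k ⧸ (J ⊔ idealOfVars σ k ^ K) :=
  (Ideal.quotientEquivAlgOfEq k (tauHom_ker J K).symm).trans
    (Ideal.quotientKerAlgEquivOfSurjective (tauHom_surj J K))

lemma mem_of_cps_mem (J : Ideal (MvPolynomial σ k)) (f : MvPolynomial σ k) (h : cps f ∈ J.map cps) (K : ℕ) :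
    f ∈ J ⊔ idealOfVars σ k ^ K := by
  have : cps f ∈ RingHom.ker (tauHom J K) := by rw [tauHom_ker]; exact Ideal.mem_sup_left h
  rwa [RingHom.mem_ker, tauHom_cps, Ideal.Quotient.eq_zero_iff_mem] at this

/-- the maximal ideal of the point `a`. -/
def ptI (a : σ → k) : Ideal (MvPolynomial σ k) := RingHom.ker (eval a)

instance (a : σ → k) : (ptI a).IsMaximal :=
  RingHom.ker_isMaximal_of_surjective _ (fun x => ⟨C x, by simp⟩)

lemma finite_quot_of_pow_le (a : σ → k) (J : Ideal (MvPolynomial σ k)) (K : ℕ) (h : ptI a ^ K ≤ J) :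
    Module.Finite k (MvPolynomial σ k ⧸ J) := by
  rw [Module.finite_iff_isArtinianRing, isArtinianRing_iff_isNoetherianRing_krullDimLE_zero,
    Ring.krullDimLE_zero_iff]
  refine ⟨inferInstance, fun Q hQ => ?_⟩
  have hQ' := hQ.comap (Ideal.Quotient.mk J)
  have hle : ptI a ≤ Q.comap (Ideal.Quotient.mk J) := by
    refine hQ'.le_of_pow_le (n := K) (h.trans ?_)
    intro x hx
    rw [Ideal.mem_comap, Ideal.Quotient.eq_zero_iff_mem.mpr hx]; exact zero_mem _
  have heq : ptI a = Q.comap (Ideal.Quotient.mk J) := (inferInstance : (ptI a).IsMaximal).eq_of_le hQ'.ne_top hle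
  have : (Q.comap (Ideal.Quotient.mk J)).IsMaximal := heq ▸ inferInstance
  rw [← Ideal.map_comap_of_surjective _ Ideal.Quotient.mk_surjective Q]
  refine (Ideal.map_eq_top_or_isMaximal_of_surjective _ Ideal.Quotient.mk_surjective this).resolve_left ?_
  rw [Ideal.map_comap_of_surjective _ Ideal.Quotient.mk_surjective Q]
  exact hQ.ne_top

lemma ideal_eq_of_finrank (J J' : Ideal (MvPolynomial σ k)) (h : J ≤ J')
    [Module.Finite k (MvPolynomial σ k ⧸ J)]
    (he : Module.finrank k (MvPolynomial σ k ⧸ J) = Module.finrank k (MvPolynomial σ k ⧸ J')) :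
    J = J' := by
  have : Module.Finite k (MvPolynomial σ k ⧸ J') :=
    Module.Finite.of_surjective (Ideal.Quotient.factorₐ k h).toLinearMap (Ideal.Quotient.factor_surjective h)
  have hinj := (LinearMap.injective_iff_surjective_of_finrank_eq_finrank he (f := (Ideal.Quotient.factorₐ k h).toLinearMap)).mpr
    (Ideal.Quotient.factor_surjective h)
  refine le_antisymm h fun x hx => ?_
  rw [← Ideal.Quotient.eq_zero_iff_mem]
  apply hinj
  rw [map_zero]
  exact Ideal.Quotient.eq_zero_iff_mem.mpr hx

/-- the translation. -/
def tlate (a : σ → k) : MvPolynomial σ k ≃ₐ[k] MvPolynomial σ k :=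
  AlgEquiv.ofAlgHom (aeval fun i => X i + C (a i)) (aeval fun i => X i - C (a i))
    (by ext i; simp) (by ext i; simp)

lemma tlate_apply (a : σ → k) (f : MvPolynomial σ k) : tlate a f = aeval (fun i => X i + C (a i)) f := rfl

lemma eval_tlate (a : σ → k) (f : MvPolynomial σ k) (b : σ → k) : eval b (tlate a f) = eval (fun i => b i + a i) f := by
  rw [tlate_apply]
  induction f using MvPolynomial.induction_on with
  | C c => simp
  | add p q hp hq => simp_all
  | mul_X p i hp => simp_all

lemma ptI_zero : ptI (0 : σ → k) = idealOfVars σ k := by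
  ext f
  have := mem_pow_idealOfVars_iff' (σ := σ) (R := k) 1 f
  rw [pow_one] at this
  rw [this, ptI, RingHom.mem_ker]
  simp only [Nat.lt_one_iff, Finsupp.degree_eq_zero_iff, forall_eq]
  rw [← constantCoeff_eq]
  rw [← MvPolynomial.eval_zero]

lemma map_tlate_ptI (a : σ → k) : (ptI a).map (tlate a : MvPolynomial σ k →+* MvPolynomial σ k) = idealOfVars σ k := by
  rw [← ptI_zero]
  ext f
  have hs : Function.Surjective (tlate a : MvPolynomial σ k →+* MvPolynomial σ k) := (tlate a).surjective
  rw [Ideal.mem_map_iff_of_surjective _ hs]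
  constructor
  · rintro ⟨g, hg, rfl⟩
    rw [ptI, RingHom.mem_ker] at hg ⊢
    have := eval_tlate a g 0
    simp only [Pi.zero_apply, zero_add] at this
    exact this.trans hg
  · intro hf
    obtain ⟨g, rfl⟩ := hs f
    refine ⟨g, ?_, rfl⟩
    rw [ptI, RingHom.mem_ker] at hf ⊢
    have := eval_tlate a g 0
    simp only [Pi.zero_apply, zero_add] at this
    exact this.symm.trans hf

lemma finrank_trans (a : σ → k) (J : Ideal (MvPolynomial σ k)) (K : ℕ) :
    Module.finrank k (MvPolynomial σ k ⧸ (J ⊔ ptI a ^ K)) =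
    Module.finrank k (MvPolynomial σ k ⧸ (J.map (tlate a : MvPolynomial σ k →+* MvPolynomial σ k) ⊔ idealOfVars σ k ^ K)) := by
  refine LinearEquiv.finrank_eq (Ideal.quotientEquivAlg _ _ (tlate a) ?_).toLinearEquiv
  change _ = Ideal.map (tlate a : MvPolynomial σ k →+* MvPolynomial σ k) _
  rw [Ideal.map_sup, Ideal.map_pow, map_tlate_ptI]

/-- the local multiplicity of `J` at `a` is `N`. -/
def IsMult (J : Ideal (MvPolynomial σ k)) (a : σ → k) (N : ℕ) : Prop :=
  ∀ᶠ K in atTop, Module.finrank k (MvPolynomial σ k ⧸ (J ⊔ ptI a ^ K)) = N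

lemma germ_of_mult' (J : Ideal (MvPolynomial σ k)) (N : ℕ) (h : IsMult J 0 N) :
    Module.finrank k (MvPowerSeries σ k ⧸ J.map cps) = N := by
  obtain ⟨K, hK⟩ := eventually_atTop.mp h
  have e1 := hK K le_rfl
  have e2 := hK (K + 1) (by omega)
  have : Module.Finite k (MvPolynomial σ k ⧸ (J ⊔ ptI (0 : σ → k) ^ (K + 1))) :=
    finite_quot_of_pow_le 0 _ (K + 1) le_sup_right
  have e3 := ideal_eq_of_finrank (J ⊔ ptI (0 : σ → k) ^ (K + 1)) (J ⊔ ptI (0 : σ → k) ^ K)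
    (sup_le_sup_left (Ideal.pow_le_pow_right (by omega)) _) (e2.trans e1.symm)
  rw [ptI_zero] at e3 e1
  have e4 : maximalIdeal (MvPowerSeries σ k) ^ K ≤ J.map cps := by
    have h1 : maximalIdeal (MvPowerSeries σ k) ^ K ≤ J.map cps ⊔ maximalIdeal (MvPowerSeries σ k) • maximalIdeal (MvPowerSeries σ k) ^ K := by
      rw [smul_eq_mul, ← pow_succ', ← cps_map_vars, ← Ideal.map_pow, ← Ideal.map_pow, ← Ideal.map_sup, e3]
      exact Ideal.map_mono le_sup_right
    exact Submodule.le_of_le_smul_of_le_jacobson_bot (IsNoetherian.noetherian _) (IsLocalRing.maximalIdeal_le_jacobson _) h1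
  have e5 := (tauEquiv J K).toLinearEquiv.finrank_eq
  rw [e1, sup_eq_left.mpr e4] at e5
  exact e5

theorem germ_of_mult {m : ℕ} (gs : Set (MvPolynomial (Fin m) ℂ)) (a : Fin m → ℂ) (N : ℕ)
    (h : IsMult (Ideal.span gs) a N) : germDim gs a = N := by
  have h2 : IsMult ((Ideal.span gs).map (tlate a : MvPolynomial (Fin m) ℂ →+* MvPolynomial (Fin m) ℂ)) 0 N := by
    refine h.mono fun K hK => ?_
    rw [ptI_zero, ← finrank_trans, hK]
  rw [← germ_of_mult' _ _ h2, germDim]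
  congr 2
  all_goals
    rw [Ideal.map_span, Ideal.map_span, Set.image_image]
    rfl

end Germ
end

open MvPolynomial Filter CategoryTheory Limits Topology
noncomputable section
set_option linter.unusedSectionVars false

section Chars

/-- determinant of the action of `u`. -/
def dact (F : Type*) {A : Type*} (M : Type*) [Field F] [CommRing A] [Algebra F A] [AddCommGroup M]
    [Module F M] [Module A M] [IsScalarTower F A M] (u : A) : F :=
  LinearMap.det (Algebra.lsmul F F M u : M →ₗ[F] M)

variable {F A : Type*} [Field F] [CommRing A] [Algebra F A]

lemma dact_congr {M M' : Type*} [AddCommGroup M]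
    [Module F M] [Module A M] [IsScalarTower F A M] [AddCommGroup M']
    [Module F M'] [Module A M'] [IsScalarTower F A M'] (e : M ≃ₗ[A] M') (u : A) :
    dact F M u = dact F M' u := by
  unfold dact
  rw [← LinearMap.det_conj _ (e.restrictScalars F)]
  congr 1
  ext x
  simp

lemma dact_exact {M : Type*} [AddCommGroup M]
    [Module F M] [Module A M] [IsScalarTower F A M] [Module.Finite F M] (N : Submodule A M) (u : A) :
    dact F M u = dact F N u * dact F (M ⧸ N) u := by
  unfold dact
  have he : N.restrictScalars F ≤ (N.restrictScalars F).comap (Algebra.lsmul F F M u : M →ₗ[F] M) :=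
    fun x hx => N.smul_mem u hx
  rw [LinearMap.det_eq_det_mul_det (N.restrictScalars F) _ he]
  congr 1

lemma exists_char_simple (I : Ideal A) [hI : I.IsMaximal] [Module.Finite F (A ⧸ I)]
    (hsurj : Function.Surjective (algebraMap F (A ⧸ I))) :
    ∃ χ : A →ₐ[F] F, Module.finrank F (A ⧸ I) = 1 ∧ ∀ u, dact F (A ⧸ I) u = χ u := by
  have : IsDomain (A ⧸ I) := Ideal.Quotient.isDomain I
  have : Nontrivial (A ⧸ I) := Ideal.Quotient.nontrivial_iff.mpr hI.ne_top
  have hbij : Function.Bijective (algebraMap F (A ⧸ I)) := ⟨(algebraMap F (A ⧸ I)).injective, hsurj⟩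
  let E : F ≃ₐ[F] (A ⧸ I) := AlgEquiv.ofBijective (Algebra.ofId F (A ⧸ I)) hbij
  have h1 : Module.finrank F (A ⧸ I) = 1 := by
    rw [← E.toLinearEquiv.finrank_eq, Module.finrank_self]
  refine ⟨(E.symm : (A ⧸ I) →ₐ[F] F).comp (Ideal.Quotient.mkₐ F I), h1, fun u => ?_⟩
  set c := E.symm (Ideal.Quotient.mk I u) with hc
  have h3 : algebraMap F (A ⧸ I) c = Ideal.Quotient.mk I u := by
    have : E c = Ideal.Quotient.mk I u := by rw [hc, AlgEquiv.apply_symm_apply]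
    exact this
  have h4 : (Algebra.lsmul F F (A ⧸ I) u : (A ⧸ I) →ₗ[F] (A ⧸ I)) = c • LinearMap.id := by
    refine LinearMap.ext fun x => ?_
    rw [LinearMap.smul_apply, LinearMap.id_apply, Algebra.smul_def, h3]
    obtain ⟨y, rfl⟩ := Ideal.Quotient.mk_surjective x
    rfl
  rw [dact, h4, LinearMap.det_smul, LinearMap.det_id, h1, pow_one, mul_one]
  rfl

theorem exists_chars' (hA : ∀ I : Ideal A, I.IsMaximal → Module.Finite F (A ⧸ I) →
    Function.Surjective (algebraMap F (A ⧸ I))) : ∀ (n : ℕ) (M : Type*) [AddCommGroup M]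
    [Module F M] [Module A M] [IsScalarTower F A M] [Module.Finite F M] (_ : Module.finrank F M = n),
    ∃ S : Multiset (A →ₐ[F] F), S.card = n ∧ ∀ u, dact F M u = (S.map (fun χ => χ u)).prod := by
  intro n
  induction n using Nat.strong_induction_on with
  | _ n ih =>
    intro M _ _ _ _ _ hM
    by_cases hsub : Subsingleton M
    · refine ⟨0, ?_, fun u => ?_⟩
      · rw [← hM, Module.finrank_zero_of_subsingleton]; rfl
      · simp [dact, LinearMap.det_eq_one_of_subsingleton]
    have hnt : Nontrivial M := not_subsingleton_iff_nontrivial.mp hsub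
    by_cases hs : IsSimpleModule A M
    · obtain ⟨I, hI, ⟨e⟩⟩ := isSimpleModule_iff_quot_maximal.mp hs
      let e' : M ≃ₗ[F] (A ⧸ I) := e.restrictScalars F
      have : Module.Finite F (A ⧸ I) := Module.Finite.equiv e'
      obtain ⟨χ, h1, h2⟩ := exists_char_simple (F := F) I (hA I hI this)
      refine ⟨{χ}, by rw [← hM, e'.finrank_eq, h1]; rfl, fun u => ?_⟩
      rw [Multiset.map_singleton, Multiset.prod_singleton, dact_congr e u, h2]
    · have : ∃ N : Submodule A M, N ≠ ⊥ ∧ N ≠ ⊤ := by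
        by_contra hcon
        push Not at hcon
        exact hs (isSimpleModule_iff A M |>.mpr ⟨fun N => or_iff_not_imp_left.mpr (hcon N)⟩)
      obtain ⟨N, hN0, hN1⟩ := this
      have hfN : Module.Finite F N := Module.Finite.of_injective (N.subtype.restrictScalars F) N.subtype_injective
      have hfQ : Module.Finite F (M ⧸ N) := Module.Finite.of_surjective (N.mkQ.restrictScalars F) N.mkQ_surjective
      have hadd : Module.finrank F (M ⧸ N) + Module.finrank F N = n := by
        rw [← hM, ← Submodule.finrank_quotient_add_finrank (N.restrictScalars F),
          (Submodule.Quotient.restrictScalarsEquiv F N).finrank_eq]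
        rfl
      have p1 : 0 < Module.finrank F N := by
        have : Nontrivial N := Submodule.nontrivial_iff_ne_bot.mpr hN0
        exact Module.finrank_pos
      have p2 : 0 < Module.finrank F (M ⧸ N) := by
        have : Nontrivial (M ⧸ N) := Submodule.Quotient.nontrivial_iff.mpr hN1
        exact Module.finrank_pos
      obtain ⟨S1, c1, d1⟩ := ih _ (by omega) N rfl
      obtain ⟨S2, c2, d2⟩ := ih _ (by omega) (M ⧸ N) rfl
      refine ⟨S1 + S2, by rw [Multiset.card_add]; omega, fun u => ?_⟩
      rw [dact_exact N, d1, d2, Multiset.map_add, Multiset.prod_add]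

theorem exists_chars [IsAlgClosed F] (n : ℕ) (M : Type*) [AddCommGroup M]
    [Module F M] [Module A M] [IsScalarTower F A M] [Module.Finite F M] (h : Module.finrank F M = n) :
    ∃ S : Multiset (A →ₐ[F] F), S.card = n ∧ ∀ u, dact F M u = (S.map (fun χ => χ u)).prod := by
  refine exists_chars' (fun I hI hf => ?_) n M h
  have : IsDomain (A ⧸ I) := Ideal.Quotient.isDomain I
  exact (IsAlgClosed.algebraMap_bijective_of_isIntegral (k := F) (K := A ⧸ I)).2

/-- two multisets with the same products of differences agree -/
lemma multiset_eq_of_prod [Infinite F] (S T : Multiset F)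
    (h : ∀ c, (S.map (fun a => c - a)).prod = (T.map (fun a => c - a)).prod) : S = T := by
  have : (S.map (fun a => Polynomial.X - Polynomial.C a)).prod = (T.map (fun a => Polynomial.X - Polynomial.C a)).prod := by
    refine Polynomial.funext fun c => ?_
    simpa [Polynomial.eval_multiset_prod] using h c
  rw [← Polynomial.roots_multiset_prod_X_sub_C S, this, Polynomial.roots_multiset_prod_X_sub_C]

variable {σ : Type*} [Fintype σ]

lemma exists_sep (T : Finset (σ → F)) (v : σ → F) :
    ∃ p : MvPolynomial σ F, eval v p = 1 ∧ ∀ w ∈ T, w ≠ v → eval w p = 0 := by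
  classical
  have h1 : ∀ w : σ → F, ∃ p : MvPolynomial σ F, eval v p = 1 ∧ (w ≠ v → eval w p = 0) := by
    intro w
    by_cases hw : w = v
    · exact ⟨1, by simp, fun h => absurd hw h⟩
    · obtain ⟨i, hi⟩ := Function.ne_iff.mp hw
      have hi' : v i - w i ≠ 0 := sub_ne_zero.mpr (Ne.symm hi)
      refine ⟨C (v i - w i)⁻¹ * (X i - C (w i)), by simp [hi'], fun _ => by simp⟩
  choose p hp1 hp2 using h1
  refine ⟨∏ w ∈ T, p w, by simp [map_prod, hp1], fun w hw hne => ?_⟩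
  rw [map_prod]
  exact Finset.prod_eq_zero hw (hp2 w hne)

/-- product over points determines the multiset. -/
lemma pts_unique [Infinite F] (S T : Multiset (σ → F))
    (h : ∀ u : MvPolynomial σ F, (S.map (fun v => eval v u)).prod = (T.map (fun v => eval v u)).prod) :
    S = T := by
  classical
  ext v
  obtain ⟨p, hp1, hp2⟩ := exists_sep (S.toFinset ∪ T.toFinset) v
  have h2 : S.map (fun v => eval v p) = T.map (fun v => eval v p) := by
    apply multiset_eq_of_prod
    intro c
    have := h (C c - p)
    simpa [Multiset.map_map, Function.comp_def] using this
  have key : ∀ U : Multiset (σ → F), (∀ w ∈ U, w ≠ v → eval w p = 0) →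
      (U.map (fun v => eval v p)).count 1 = U.count v := by
    intro U
    induction U using Multiset.induction_on with
    | empty => simp
    | cons w U ih =>
      intro hU
      rw [Multiset.map_cons, Multiset.count_cons, Multiset.count_cons,
        ih (fun w' hw' => hU w' (Multiset.mem_cons_of_mem hw'))]
      by_cases hw : w = v
      · subst hw; simp [hp1]
      · have : eval w p = 0 := hU w (Multiset.mem_cons_self _ _) hw
        rw [if_neg (by simp [this]), if_neg (Ne.symm hw)]
  rw [← key S (fun w hw => hp2 w (by simp [hw])), h2, key T (fun w hw => hp2 w (by simp [hw]))]

lemma exists_pts [IsAlgClosed F] (M : Type*) [AddCommGroup M]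
    [Module F M] [Module (MvPolynomial σ F) M] [IsScalarTower F (MvPolynomial σ F) M] [Module.Finite F M] :
    ∃ S : Multiset (σ → F), S.card = Module.finrank F M ∧
      (∀ u, dact F M u = (S.map (fun v => eval v u)).prod) := by
  obtain ⟨S, h1, h2⟩ := exists_chars (F := F) (A := MvPolynomial σ F) (Module.finrank F M) M rfl
  refine ⟨S.map (fun χ i => χ (X i)), by simpa using h1, fun u => ?_⟩
  rw [h2, Multiset.map_map]
  congr 2
  ext χ
  have : χ = aeval (fun i => χ (X i)) := by ext; simp
  conv_lhs => rw [this]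
  simp [aeval_eq_eval]

/-- if `u` acts as a scalar plus nilpotent… here: as a scalar `c`, all points have value `c` -/
lemma pts_val [IsAlgClosed F] (M : Type*) [AddCommGroup M]
    [Module F M] [Module (MvPolynomial σ F) M] [IsScalarTower F (MvPolynomial σ F) M] [Module.Finite F M]
    (S : Multiset (σ → F)) (hS : ∀ u, dact F M u = (S.map (fun v => eval v u)).prod)
    (u : MvPolynomial σ F) (c : F) (K : ℕ) (hu : ∀ x : M, (u - C c) ^ K • x = 0) (v : σ → F) (hv : v ∈ S) : eval v u = c := by
  by_contra hne
  have h1 : dact F M (u - C (eval v u)) = 0 := by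
    rw [hS]
    exact Multiset.prod_eq_zero (Multiset.mem_map.mpr ⟨v, hv, by simp⟩)
  have h2 : IsUnit (Algebra.lsmul F F M (u - C (eval v u)) : Module.End F M) := by
    have hnil : IsNilpotent (Algebra.lsmul F F M (u - C c) : Module.End F M) :=
      ⟨K, by rw [← map_pow]; exact LinearMap.ext fun x => hu x⟩
    have hun : IsUnit (Algebra.lsmul F F M (C (c - eval v u) : MvPolynomial σ F) : Module.End F M) := by
      refine IsUnit.map (Algebra.lsmul F F M) (IsUnit.map C ?_)
      exact (sub_ne_zero.mpr (Ne.symm hne)).isUnit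
    have : u - C (eval v u) = (u - C c) + C (c - eval v u) := by simp
    rw [this, map_add]
    refine IsNilpotent.isUnit_add_right_of_commute hnil hun ?_
    rw [Commute, SemiconjBy, ← map_mul, ← map_mul, mul_comm]
  have h3 := (LinearMap.isUnit_iff_isUnit_det _).mp h2
  exact h3.ne_zero h1

theorem exists_mult_pts [IsAlgClosed F] (J : Ideal (MvPolynomial σ F)) [Module.Finite F (MvPolynomial σ F ⧸ J)] :
    ∃ S : Multiset (σ → F), S.card = Module.finrank F (MvPolynomial σ F ⧸ J) ∧
      (∀ u, dact F (MvPolynomial σ F ⧸ J) u = (S.map (fun v => eval v u)).prod) ∧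
      (∀ v ∈ S, ∀ u ∈ J, eval v u = 0) ∧ (∀ v, (∀ u ∈ J, eval v u = 0) → v ∈ S) ∧ 
      (∀ v [DecidableEq (σ → F)], IsMult J v (S.count v)) := by
  classical
  obtain ⟨S, h1, h2⟩ := exists_pts (σ := σ) (F := F) (MvPolynomial σ F ⧸ J)
  have hinf : Infinite F := IsAlgClosed.instInfinite
  have hzero : ∀ v ∈ S, ∀ u ∈ J, eval v u = 0 := by
    intro v hv u hu
    refine pts_val _ S h2 u 0 1 (fun x => ?_) v hv
    obtain ⟨y, rfl⟩ := Ideal.Quotient.mk_surjective x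
    have : (u - C 0) ^ 1 • (Ideal.Quotient.mk J y) = Ideal.Quotient.mk J (u * y) := by
      simp; rfl
    rw [this, Ideal.Quotient.eq_zero_iff_mem]
    exact J.mul_mem_right _ hu
  have hmult : ∀ v, IsMult J v (S.count v) := by
    intro v
    -- stabilisation
    have : IsArtinianRing (MvPolynomial σ F ⧸ J) := IsArtinianRing.of_finite F _
    obtain ⟨K0, hK0⟩ := IsArtinian.monotone_stabilizes (R := MvPolynomial σ F ⧸ J) (M := MvPolynomial σ F ⧸ J)
      ⟨fun k => OrderDual.toDual (((ptI v).map (Ideal.Quotient.mk J)) ^ k), fun a b hab => Ideal.pow_le_pow_right hab⟩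
    refine eventually_atTop.mpr ⟨K0, fun K hK => ?_⟩
    let N : Submodule (MvPolynomial σ F) (MvPolynomial σ F ⧸ J) :=
      (((ptI v).map (Ideal.Quotient.mk J)) ^ K).restrictScalars (MvPolynomial σ F)
    have hfN : Module.Finite F N := Module.Finite.of_injective (N.subtype.restrictScalars F) N.subtype_injective
    have hfQ : Module.Finite F ((MvPolynomial σ F ⧸ J) ⧸ N) := Module.Finite.of_surjective (N.mkQ.restrictScalars F) N.mkQ_surjective
    obtain ⟨S1, c1, d1⟩ := exists_pts (σ := σ) (F := F) N
    obtain ⟨S2, c2, d2⟩ := exists_pts (σ := σ) (F := F) ((MvPolynomial σ F ⧸ J) ⧸ N)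
    have hS : S = S1 + S2 := by
      refine pts_unique _ _ fun u => ?_
      rw [← h2, dact_exact N, d1, d2, Multiset.map_add, Multiset.prod_add]
    -- points of the quotient are all v
    have hS2 : ∀ w ∈ S2, w = v := by
      intro w hw
      ext i
      have := pts_val _ S2 d2 (X i) (v i) K (fun x => ?_) w hw
      · simpa using this
      obtain ⟨y, rfl⟩ := N.mkQ_surjective x
      rw [← map_smul, Submodule.mkQ_apply, Submodule.Quotient.mk_eq_zero]
      obtain ⟨z, rfl⟩ := Ideal.Quotient.mk_surjective y
      change Ideal.Quotient.mk J ((X i - C (v i)) ^ K * z) ∈ (((ptI v).map (Ideal.Quotient.mk J)) ^ K)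
      rw [map_mul, map_pow]
      refine Ideal.mul_mem_right _ _ (Ideal.pow_mem_pow (Ideal.mem_map_of_mem _ ?_) K)
      simp [ptI, RingHom.mem_ker]
    -- v is not a point of N
    have hS1 : v ∉ S1 := by
      intro hv
      have hst : (((ptI v).map (Ideal.Quotient.mk J)) ^ K) = (ptI v).map (Ideal.Quotient.mk J) • (((ptI v).map (Ideal.Quotient.mk J)) ^ K) := by
        refine Eq.trans ?_ (pow_succ' ((ptI v).map (Ideal.Quotient.mk J)) K)
        exact (hK0 K hK).symm.trans (hK0 (K + 1) (by omega))
      obtain ⟨r, hr, hr2⟩ := Submodule.exists_mem_and_smul_eq_self_of_fg_of_le_smul _ _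
        (IsNoetherian.noetherian _) hst.le
      obtain ⟨e, he, rfl⟩ := (Ideal.mem_map_iff_of_surjective _ Ideal.Quotient.mk_surjective).mp hr
      have := pts_val _ S1 d1 e 1 1 (fun x => ?_) v hv
      · rw [ptI, RingHom.mem_ker] at he
        rw [he] at this; exact zero_ne_one this
      · obtain ⟨x, hx⟩ := x
        have h3 := hr2 x hx
        rw [pow_one, sub_smul, map_one, one_smul, sub_eq_zero]
        exact Subtype.ext h3
    have hc : S.count v = Module.finrank F ((MvPolynomial σ F ⧸ J) ⧸ N) := by
      rw [hS, Multiset.count_add, Multiset.count_eq_zero_of_notMem hS1, zero_add, ← c2]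
      exact Multiset.count_eq_card.mpr fun w hw => (hS2 w hw).symm
    rw [hc]
    have hN : (J ⊔ ptI v ^ K).map (Ideal.Quotient.mk J) = ((ptI v).map (Ideal.Quotient.mk J)) ^ K := by
      rw [Ideal.map_sup, Ideal.map_pow, Ideal.map_quotient_self, bot_sup_eq]
    have E1 := (DoubleQuot.quotQuotEquivQuotSupₐ F J (ptI v ^ K)).toLinearEquiv.finrank_eq
    rw [← E1, Ideal.map_pow]
    exact (Submodule.Quotient.restrictScalarsEquiv (MvPolynomial σ F) (((ptI v).map (Ideal.Quotient.mk J)) ^ K)).restrictScalars F |>.finrank_eq.symm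
  refine ⟨S, h1, h2, hzero, ?_, ?_⟩
  · intro v hv
    by_contra hvS
    have hm := hmult v
    rw [Multiset.count_eq_zero_of_notMem hvS] at hm
    obtain ⟨K, hK⟩ := eventually_atTop.mp hm
    have h3 := hK (K + 1) (by omega)
    have : Module.Finite F (MvPolynomial σ F ⧸ (J ⊔ ptI v ^ (K + 1))) := finite_quot_of_pow_le v _ (K + 1) le_sup_right
    rw [Module.finrank_eq_zero_iff_of_free] at h3
    have h4 : J ⊔ ptI v ^ (K + 1) = ⊤ := Ideal.Quotient.subsingleton_iff.mp h3
    have h5 : J ⊔ ptI v ^ (K + 1) ≤ ptI v :=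
      sup_le (fun u hu => hv u hu) (Ideal.pow_le_self (by omega))
    rw [h4] at h5
    exact (inferInstance : (ptI v).IsMaximal).ne_top (top_le_iff.mp h5)
  · intro v hdec
    have := hmult v
    convert this

end Chars
end

open MvPolynomial Filter CategoryTheory Limits Topology
noncomputable section
set_option linter.unusedSectionVars false

section Puiseux

abbrev HQ := HahnSeries ℚ ℂ

/-- the exponent map `k ↦ k/q`. -/
def divHom (q : ℕ) : ℕ →+ ℚ where
  toFun k := (k : ℚ) / q
  map_zero' := by simp
  map_add' a b := by push_cast; ring

/-- the embedding `τ ↦ t^(1/q)`. -/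
def emb (q : ℕ) (hq : 0 < q) : PowerSeries ℂ →+* HQ :=
  (HahnSeries.embDomainRingHom (divHom q)
    (fun a b h => by
      have hq' : (q : ℚ) ≠ 0 := by positivity
      have h' : (a : ℚ) / q = (b : ℚ) / q := h
      rw [div_left_inj' hq'] at h'
      exact_mod_cast h')
    (fun a b => by
      have hq' : (0 : ℚ) < q := by positivity
      change (a : ℚ) / q ≤ (b : ℚ) / q ↔ _
      rw [div_le_div_iff_of_pos_right hq']
      exact_mod_cast Iff.rfl)).comp
    (HahnSeries.toPowerSeries (R := ℂ)).symm.toRingHom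

lemma emb_coeff (q : ℕ) (hq : 0 < q) (a : PowerSeries ℂ) (k : ℕ) :
    (emb q hq a).coeff ((k : ℚ) / q) = PowerSeries.coeff k a := by
  have := HahnSeries.embDomain_coeff (f := ⟨⟨divHom q, (fun a b h => by
      have hq' : (q : ℚ) ≠ 0 := by positivity
      have h' : (a : ℚ) / q = (b : ℚ) / q := h
      rw [div_left_inj' hq'] at h'
      exact_mod_cast h')⟩, (by
      intro a b
      have hq' : (0 : ℚ) < q := by positivity
      change (a : ℚ) / q ≤ (b : ℚ) / q ↔ _
      rw [div_le_div_iff_of_pos_right hq']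
      exact_mod_cast Iff.rfl)⟩) (x := (HahnSeries.toPowerSeries (R := ℂ)).symm a) (a := k)
  rw [HahnSeries.coeff_toPowerSeries_symm] at this
  exact this

lemma emb_coeff_notin (q : ℕ) (hq : 0 < q) (a : PowerSeries ℂ) (r : ℚ) (hr : ∀ k : ℕ, (k : ℚ) / q ≠ r) :
    (emb q hq a).coeff r = 0 := by
  refine HahnSeries.embDomain_of_notMem_range ?_
  rintro ⟨k, hk⟩
  exact hr k hk

lemma emb_expand (q B : ℕ) (hq : 0 < q) (hB : 0 < B) (a : PowerSeries ℂ) :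
    emb (q * B) (Nat.mul_pos hq hB) (PowerSeries.expand B hB.ne' a) = emb q hq a := by
  have hq' : (q : ℚ) ≠ 0 := by positivity
  have hB' : (B : ℚ) ≠ 0 := by positivity
  ext r
  by_cases h : ∃ k : ℕ, (k : ℚ) / (q * B : ℕ) = r
  · obtain ⟨k, rfl⟩ := h
    rw [emb_coeff, PowerSeries.coeff_expand]
    split_ifs with hd
    · obtain ⟨m, rfl⟩ := hd
      rw [Nat.mul_div_cancel_left _ hB]
      have : ((B * m : ℕ) : ℚ) / (q * B : ℕ) = (m : ℚ) / q := by push_cast; field_simp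
      rw [this, emb_coeff]
    · symm
      apply emb_coeff_notin
      intro m hm
      apply hd
      refine ⟨m, ?_⟩
      push_cast at hm
      rw [div_eq_div_iff hq' (by positivity)] at hm
      have h2 : (k : ℚ) = B * m := by
        apply mul_right_cancel₀ hq'
        linarith
      exact_mod_cast h2
  · push Not at h
    rw [emb_coeff_notin _ _ _ _ h, emb_coeff_notin]
    intro k hk
    apply h (B * k)
    rw [← hk]; push_cast; field_simp

lemma psC_maximalIdeal : IsLocalRing.maximalIdeal (PowerSeries ℂ) = Ideal.span {PowerSeries.X} :=
  PowerSeries.maximalIdeal_eq_span_X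

instance psC_complete : IsAdicComplete (IsLocalRing.maximalIdeal (PowerSeries ℂ)) (PowerSeries ℂ) := by
  rw [psC_maximalIdeal]; infer_instance

lemma residue_eq_zero_iff' (a : PowerSeries ℂ) :
    IsLocalRing.residue (PowerSeries ℂ) a = 0 ↔ PowerSeries.constantCoeff a = 0 := by
  rw [IsLocalRing.residue_eq_zero_iff, psC_maximalIdeal, Ideal.mem_span_singleton, PowerSeries.X_dvd_iff]

namespace Polynomial
lemma weier_factor (g : (PowerSeries ℂ)[X]) (hg : g.Monic) (m : ℕ)
    (h0 : ∀ i < m, PowerSeries.constantCoeff (g.coeff i) = 0)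
    (h1 : PowerSeries.constantCoeff (g.coeff m) ≠ 0) :
    ∃ h k : (PowerSeries ℂ)[X], h.Monic ∧ k.Monic ∧ g = h * k ∧ h.natDegree = m := by
  have hord : ((g : PowerSeries (PowerSeries ℂ)).map (IsLocalRing.residue (PowerSeries ℂ))).order = m := by
    rw [PowerSeries.order_eq_nat]
    constructor
    · rw [PowerSeries.coeff_map, Polynomial.coeff_coe, Ne, residue_eq_zero_iff']; exact h1
    · intro i hi
      rw [PowerSeries.coeff_map, Polynomial.coeff_coe, residue_eq_zero_iff']; exact h0 i hi
  have hne : (g : PowerSeries (PowerSeries ℂ)).map (IsLocalRing.residue (PowerSeries ℂ)) ≠ 0 := by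
    intro h
    rw [h, PowerSeries.order_zero] at hord
    exact absurd hord (by simp)
  obtain ⟨h, u, H⟩ := PowerSeries.exists_isWeierstrassFactorization hne
  have hm : h.natDegree = m := by
    rw [H.natDegree_eq_toNat_order_map, hord]; rfl
  have hmon : h.Monic := H.isDistinguishedAt.monic
  have hdiv := Polynomial.modByMonic_add_div g h
  have e1 : (h : PowerSeries (PowerSeries ℂ)) * u + ((0 : (PowerSeries ℂ)[X]) : PowerSeries (PowerSeries ℂ))
      = h * ((g /ₘ h : (PowerSeries ℂ)[X]) : PowerSeries (PowerSeries ℂ)) + ((g %ₘ h : (PowerSeries ℂ)[X]) : PowerSeries (PowerSeries ℂ)) := by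
    rw [← H.eq_mul, Polynomial.coe_zero, add_zero, ← Polynomial.coe_mul, ← Polynomial.coe_add, add_comm, hdiv]
  have ho2 : ((h : PowerSeries (PowerSeries ℂ)).map (Ideal.Quotient.mk (IsLocalRing.maximalIdeal (PowerSeries ℂ)))).order.toNat = m := by
    have : ((h : PowerSeries (PowerSeries ℂ)).map (Ideal.Quotient.mk (IsLocalRing.maximalIdeal (PowerSeries ℂ)))).order = m := by
      rw [PowerSeries.order_eq_nat]
      constructor
      · rw [PowerSeries.coeff_map, Polynomial.coeff_coe, ← hm, hmon.coeff_natDegree, map_one]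
        exact one_ne_zero
      · intro i hi
        rw [PowerSeries.coeff_map, Polynomial.coeff_coe, Ideal.Quotient.eq_zero_iff_mem]
        exact H.isDistinguishedAt.mem (by omega)
    rw [this]; rfl
  have e2 := (H.isDistinguishedAt.isWeierstrassDivisorAt').eq_of_mul_add_eq_mul_add (q := u)
    (q' := ((g /ₘ h : (PowerSeries ℂ)[X]) : PowerSeries (PowerSeries ℂ))) (r := 0) (r' := g %ₘ h)
    (by rw [Polynomial.degree_zero]; exact WithBot.bot_lt_coe _)
    (by
      rw [ho2, ← hm, ← Polynomial.degree_eq_natDegree hmon.ne_zero]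
      exact Polynomial.degree_modByMonic_lt _ hmon) e1
  refine ⟨h, g /ₘ h, hmon, ?_, ?_, hm⟩
  · rw [← e2.2, zero_add] at hdiv
    exact hmon.of_mul_monic_left (by rw [hdiv]; exact hg)
  · rw [← e2.2, zero_add] at hdiv
    exact hdiv.symm

lemma taylor_coeff_pred {R : Type*} [CommRing R] (f : R[X]) (hf : f.Monic) (n : ℕ) (hn : f.natDegree = n + 1) (c : R) :
    (f.comp (X + C c)).coeff n = f.coeff n + (n + 1) * c := by
  rw [← taylor_apply, taylor_coeff, eval_eq_sum_range' (n := 2)]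
  · rw [Finset.sum_range_succ, Finset.sum_range_one, hasseDeriv_coeff, hasseDeriv_coeff]
    have : f.coeff (1 + n) = 1 := by rw [add_comm, ← hn]; exact hf.coeff_natDegree
    rw [this]
    simp [add_comm]
  · have := natDegree_hasseDeriv_le f n
    omega

lemma shift_splits {K : Type*} [Field K] {R : Type*} [CommRing R] (φ : R →+* K) (f : R[X]) (c : R)
    (h : ((f.comp (X + C c)).map φ).Splits) : (f.map φ).Splits := by
  have := Splits.comp_X_sub_C h (φ c)
  rw [Polynomial.map_comp] at this
  simpa [Polynomial.comp_assoc] using this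

theorem puiseux : ∀ (n : ℕ) (f : (PowerSeries ℂ)[X]), f.Monic → f.natDegree = n →
    ∀ (q : ℕ) (hq : 0 < q), (f.map (emb q hq)).Splits := by
  intro n
  induction n using Nat.strong_induction_on with
  | _ n ih =>
  classical
  intro f0 hf0 hfn0 q hq
  rcases Nat.lt_or_ge n 2 with hn2 | hn2
  · exact Splits.of_natDegree_le_one ((Polynomial.natDegree_map_le).trans (by omega))
  obtain ⟨n, rfl⟩ : ∃ k, n = k + 1 := ⟨n - 1, by omega⟩
  -- kill the second coefficient
  set c0 : PowerSeries ℂ := PowerSeries.C (-((n : ℂ) + 1)⁻¹) * f0.coeff n with hc0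
  apply shift_splits _ _ c0
  set f := f0.comp (X + C c0) with hfdef
  have hf : f.Monic := hf0.comp_X_add_C c0
  have hfn : f.natDegree = n + 1 := by
    rw [hfdef, natDegree_comp, natDegree_X_add_C, mul_one, hfn0]
  have hfc : f.coeff n = 0 := by
    rw [hfdef, taylor_coeff_pred f0 hf0 n hfn0, hc0]
    have h1 : ((n : PowerSeries ℂ) + 1) = PowerSeries.C ((n : ℂ) + 1) := by simp
    have h2 : ((n : ℂ) + 1) ≠ 0 := by exact_mod_cast Nat.succ_ne_zero n
    rw [h1, ← mul_assoc, ← map_mul, mul_neg, mul_inv_cancel₀ h2]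
    simp
  by_cases hall : ∀ i < n + 1, f.coeff i = 0
  · have : f = X ^ (n + 1) := by
      ext1 i
      rw [coeff_X_pow]
      split_ifs with h
      · rw [h, ← hfn]; exact hf.coeff_natDegree
      · rcases lt_or_gt_of_ne h with h | h
        · exact hall i h
        · exact coeff_eq_zero_of_natDegree_lt (by omega)
    rw [this, Polynomial.map_pow, map_X]
    exact Splits.X_pow _
  push Not at hall
  -- slope
  obtain ⟨i0, hi0, hmin⟩ : ∃ i0, (i0 < n + 1 ∧ f.coeff i0 ≠ 0) ∧ ∀ i, i < n + 1 → f.coeff i ≠ 0 →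
      ((f.coeff i0).order.toNat : ℚ) / ((n + 1 - i0 : ℕ) : ℚ) ≤ ((f.coeff i).order.toNat : ℚ) / ((n + 1 - i : ℕ) : ℚ) := by
    obtain ⟨j, hj, hj2⟩ := hall
    obtain ⟨i0, h1, h2⟩ := ((Finset.range (n + 1)).filter (fun i => f.coeff i ≠ 0)).exists_min_image
      (fun i => ((f.coeff i).order.toNat : ℚ) / ((n + 1 - i : ℕ) : ℚ)) ⟨j, by simp [hj, hj2]⟩
    simp only [Finset.mem_filter, Finset.mem_range] at h1 h2
    exact ⟨i0, h1, fun i h3 h4 => h2 i ⟨h3, h4⟩⟩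
  set A := (f.coeff i0).order.toNat with hA
  set B := n + 1 - i0 with hB
  have hBpos : 0 < B := by omega
  have hA' : (f.coeff i0).order = A := (ENat.natCast_toNat (by rw [Ne, PowerSeries.order_eq_top]; exact hi0.2)).symm
  have hdvd : ∀ i, PowerSeries.X ^ (A * (n + 1 - i)) ∣ PowerSeries.expand B hBpos.ne' (f.coeff i) := by
    intro i
    rcases Nat.lt_or_ge i (n + 1) with hi | hi
    · by_cases hz : f.coeff i = 0
      · rw [hz, map_zero]; exact dvd_zero _
      · rw [PowerSeries.X_pow_dvd_iff]
        intro m hm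
        apply PowerSeries.coeff_of_lt_order
        rw [PowerSeries.order_expand]
        have h1 : (f.coeff i).order = (f.coeff i).order.toNat := (ENat.natCast_toNat (by rw [Ne, PowerSeries.order_eq_top]; exact hz)).symm
        rw [h1]
        have h2 := hmin i hi hz
        have hBq : (0 : ℚ) < (B : ℚ) := by exact_mod_cast hBpos
        have hiq : (0 : ℚ) < ((n + 1 - i : ℕ) : ℚ) := by
          have : 0 < n + 1 - i := by omega
          exact_mod_cast this
        rw [div_le_div_iff₀ hBq hiq] at h2
        have h3 : A * (n + 1 - i) ≤ (f.coeff i).order.toNat * B := by exact_mod_cast h2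
        rw [nsmul_eq_mul]
        have h4 : m < B * (f.coeff i).order.toNat := by rw [mul_comm B]; omega
        exact_mod_cast h4
    · rw [Nat.sub_eq_zero_of_le hi]; simp
  choose b hb using hdvd
  set g : (PowerSeries ℂ)[X] := ∑ i ∈ Finset.range (n + 2), C (b i) * X ^ i with hg
  have hgc : ∀ i, g.coeff i = if i < n + 2 then b i else 0 := by
    intro i
    rw [hg, finsetSum_coeff]
    simp only [coeff_C_mul, coeff_X_pow, mul_ite, mul_one, mul_zero]
    rw [Finset.sum_ite_eq]
    simp
  have hbn : b (n + 1) = 1 := by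
    have := hb (n + 1)
    have h1 : f.coeff (n + 1) = 1 := by rw [← hfn]; exact hf.coeff_natDegree
    rw [h1, map_one, Nat.sub_self, mul_zero, pow_zero, one_mul] at this
    exact this.symm
  have hgdeg : g.natDegree ≤ n + 1 := by
    rw [natDegree_le_iff_coeff_eq_zero]
    intro N hN
    rw [hgc, if_neg (by omega)]
  have hgn1 : g.coeff (n + 1) = 1 := by rw [hgc, if_pos (by omega), hbn]
  have hgm : g.Monic := monic_of_natDegree_le_of_coeff_eq_one (n + 1) hgdeg hgn1
  have hgn : g.natDegree = n + 1 := le_antisymm hgdeg (le_natDegree_of_ne_zero (by rw [hgn1]; exact one_ne_zero))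
  have hscale : f.map (PowerSeries.expand (R := ℂ) B hBpos.ne').toRingHom = g.scaleRoots (PowerSeries.X ^ A) := by
    ext1 i
    rw [coeff_map, coeff_scaleRoots, hgn, hgc]
    split_ifs with hi
    · rw [← pow_mul, mul_comm (b i)]; exact hb i
    · rw [zero_mul, coeff_eq_zero_of_natDegree_lt (by omega)]; simp
  have hmap : f.map (emb q hq) = (g.map (emb (q * B) (Nat.mul_pos hq hBpos))).scaleRoots (emb (q * B) (Nat.mul_pos hq hBpos) (PowerSeries.X ^ A)) := by
    rw [← map_scaleRoots _ _ _ (by rw [hgm.leadingCoeff, map_one]; exact one_ne_zero), ← hscale, Polynomial.map_map]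
    congr 1
    ext1 a
    exact (emb_expand q B hq hBpos a).symm
  rw [hmap]
  apply Splits.scaleRoots
  -- reduce mod
  have hbz : ∀ i, (f.coeff i = 0) → b i = 0 := by
    intro i hi
    have := hb i
    rw [hi, map_zero] at this
    exact (mul_eq_zero.mp this.symm).resolve_left (pow_ne_zero _ PowerSeries.X_ne_zero)
  have hbi0 : PowerSeries.constantCoeff (b i0) ≠ 0 := by
    intro h
    rw [← PowerSeries.X_dvd_iff] at h
    obtain ⟨w, hw⟩ := h
    have h1 := hb i0
    rw [hw, ← mul_assoc, ← pow_succ] at h1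
    have h2 : PowerSeries.X ^ (A * (n + 1 - i0) + 1) ∣ PowerSeries.expand B hBpos.ne' (f.coeff i0) := ⟨w, h1⟩
    have h3 := PowerSeries.X_pow_dvd_iff.mp h2 (A * B) (Nat.lt_succ_self _)
    have h4 : PowerSeries.coeff (A * B) (PowerSeries.expand B hBpos.ne' (f.coeff i0)) = PowerSeries.coeff A (f.coeff i0) := by
      rw [mul_comm, PowerSeries.coeff_expand_mul]
    rw [h4] at h3
    exact ((PowerSeries.order_eq_nat.mp hA').1) h3
  set gb := g.map (PowerSeries.constantCoeff (R := ℂ)) with hgb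
  have hgbm : gb.Monic := hgm.map _
  have hgbn : gb.natDegree = n + 1 := by rw [hgb, hgm.natDegree_map, hgn]
  obtain ⟨c, hc⟩ := IsAlgClosed.exists_root gb (by
    rw [degree_eq_natDegree hgbm.ne_zero, hgbn]; exact_mod_cast Nat.succ_ne_zero n)
  apply shift_splits _ _ (PowerSeries.C c)
  set g1 := g.comp (X + C (PowerSeries.C c)) with hg1
  have hg1m : g1.Monic := hgm.comp_X_add_C _
  have hg1n : g1.natDegree = n + 1 := by
    rw [hg1, natDegree_comp, natDegree_X_add_C, mul_one, hgn]
  have hg1b : g1.map (PowerSeries.constantCoeff (R := ℂ)) = gb.comp (X + C c) := by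
    rw [hg1, Polynomial.map_comp]; simp [hgb]
  have hco : ∀ i, PowerSeries.constantCoeff (g1.coeff i) = (gb.comp (X + C c)).coeff i := by
    intro i; rw [← hg1b, coeff_map]
  have hex : ∃ m, PowerSeries.constantCoeff (g1.coeff m) ≠ 0 := ⟨n + 1, by
    rw [← hg1n, hg1m.coeff_natDegree]; simp⟩
  set m := Nat.find hex with hm
  have hm1 : PowerSeries.constantCoeff (g1.coeff m) ≠ 0 := Nat.find_spec hex
  have hm0 : ∀ i < m, PowerSeries.constantCoeff (g1.coeff i) = 0 := fun i hi => by
    have := Nat.find_min hex hi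
    push Not at this; exact this
  have hmle : m ≤ n + 1 := Nat.find_min' hex (by rw [← hg1n, hg1m.coeff_natDegree]; simp)
  have hmpos : 0 < m := by
    rcases Nat.eq_zero_or_pos m with h | h
    · exfalso
      rw [h] at hm1
      apply hm1
      rw [hco, coeff_zero_eq_eval_zero, eval_comp]
      simpa using hc
    · exact h
  have hmne : m ≠ n + 1 := by
    intro h
    have h1 := hm0 n (by omega)
    rw [hco, taylor_coeff_pred gb hgbm n hgbn, hgb, coeff_map, hgc, if_pos (by omega), hbz n hfc, map_zero, zero_add] at h1
    have h2 : ((n : ℂ) + 1) ≠ 0 := by exact_mod_cast Nat.succ_ne_zero n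
    have h3 : c = 0 := (mul_eq_zero.mp h1).resolve_left h2
    have h4 := hm0 i0 (by omega)
    rw [hco, h3, map_zero, add_zero, comp_X, hgb, coeff_map, hgc, if_pos (by omega)] at h4
    exact hbi0 h4
  obtain ⟨h, k, hhm, hkm, hhk, hhn⟩ := weier_factor g1 hg1m m hm0 hm1
  have hkn : h.natDegree + k.natDegree = n + 1 := by
    rw [← hhm.natDegree_mul hkm, ← hhk, hg1n]
  rw [hhk, Polynomial.map_mul]
  exact (ih _ (by omega) h hhm rfl _ _).mul (ih _ (by omega) k hkm rfl _ _)

end Polynomial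
end Puiseux
end

open MvPolynomial Filter CategoryTheory Limits Topology
noncomputable section
section Theta

/-- the derivation `t d/dt`. -/
def theta (x : HQ) : HQ where
  coeff r := (r : ℂ) * x.coeff r
  isPWO_support' := x.isPWO_support.mono (fun r hr => by
    simp only [Function.mem_support] at hr
    simp only [HahnSeries.mem_support]
    exact right_ne_zero_of_mul hr)

lemma theta_coeff (x : HQ) (r : ℚ) : (theta x).coeff r = (r : ℂ) * x.coeff r := rfl

lemma theta_supp (x : HQ) : (theta x).support ⊆ x.support := fun r hr => by
    simp only [HahnSeries.mem_support, theta_coeff] at hr ⊢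
    exact right_ne_zero_of_mul hr

lemma theta_add (x y : HQ) : theta (x + y) = theta x + theta y := by
  ext r; simp [theta_coeff, mul_add]

lemma theta_mul (x y : HQ) : theta (x * y) = theta x * y + x * theta y := by
  ext r
  rw [HahnSeries.coeff_add, HahnSeries.coeff_mul_left' x.isPWO_support (theta_supp x),
    HahnSeries.coeff_mul_right' y.isPWO_support (theta_supp y), theta_coeff, HahnSeries.coeff_mul,
    Finset.mul_sum, ← Finset.sum_add_distrib]
  refine Finset.sum_congr rfl fun ij hij => ?_
  have := (Finset.mem_antidiagonal.mp hij).2.2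
  rw [theta_coeff, theta_coeff, ← this]
  push_cast
  ring

lemma theta_C (c : ℂ) : theta (HahnSeries.C c) = 0 := by
  ext r
  rw [theta_coeff, HahnSeries.C_apply, HahnSeries.coeff_single]
  split_ifs with h <;> simp [h]

lemma theta_zero : theta 0 = 0 := by ext r; simp [theta_coeff]
lemma theta_one : theta 1 = 0 := by
  rw [← map_one (HahnSeries.C (Γ := ℚ) (R := ℂ)), theta_C]

lemma theta_neg (x : HQ) : theta (-x) = - theta x := by
  ext r; simp [theta_coeff]

lemma theta_sub (x y : HQ) : theta (x - y) = theta x - theta y := by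
  rw [sub_eq_add_neg, theta_add, theta_neg, sub_eq_add_neg]

/-- the variable. -/
def tt : HQ := HahnSeries.single (1:ℚ) (1:ℂ)

lemma tt_ne : tt ≠ 0 := by simp [tt]
lemma tt_order : tt.order = 1 := HahnSeries.order_single one_ne_zero

lemma theta_tt : theta tt = tt := by
  ext r
  rw [theta_coeff, tt, HahnSeries.coeff_single]
  split_ifs with h <;> simp [h]

lemma theta_tt_pow (d : ℕ) : theta (tt ^ d) = (d : HQ) * tt ^ d := by
  induction d with
  | zero => simp [theta_one]
  | succ d ih => rw [pow_succ, theta_mul, ih, theta_tt]; push_cast; ring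

lemma theta_order_eq (x y : HQ) (h : x.support = y.support) : x.order = y.order := by
  by_cases hx : x = 0
  · have : y = 0 := by rw [← HahnSeries.support_eq_empty_iff, ← h, hx, HahnSeries.support_zero]
    rw [hx, this]
  · have hy : y ≠ 0 := by
      intro hy; apply hx; rw [← HahnSeries.support_eq_empty_iff, h, hy, HahnSeries.support_zero]
    refine le_antisymm ?_ ?_
    · apply HahnSeries.order_le_of_coeff_ne_zero
      have := (HahnSeries.coeff_order_eq_zero.not.mpr hy)
      have h2 : y.order ∈ y.support := this
      rw [← h] at h2; exact h2
    · apply HahnSeries.order_le_of_coeff_ne_zero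
      have := (HahnSeries.coeff_order_eq_zero.not.mpr hx)
      have h2 : x.order ∈ x.support := this
      rw [h] at h2; exact h2

lemma theta_support (x : HQ) : (theta x).support = (x - HahnSeries.C (x.coeff 0)).support := by
  ext r
  simp only [HahnSeries.mem_support, theta_coeff, HahnSeries.coeff_sub, HahnSeries.C_apply, HahnSeries.coeff_single]
  by_cases hr : r = 0
  · simp [hr]
  · simp [hr]

lemma theta_order (x : HQ) : (theta x).order = (x - HahnSeries.C (x.coeff 0)).order :=
  theta_order_eq _ _ (theta_support x)

lemma theta_eq_zero (x : HQ) (h : theta x = 0) : x = HahnSeries.C (x.coeff 0) := by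
  have := theta_support x
  rw [h, HahnSeries.support_zero] at this
  exact sub_eq_zero.mp (HahnSeries.support_eq_empty_iff.mp this.symm)

lemma theta_order_ne (x : HQ) (h : theta x ≠ 0) : (theta x).order ≠ 0 := by
  intro h0
  have := (HahnSeries.coeff_order_eq_zero.not.mpr h)
  rw [h0, theta_coeff] at this
  simp at this

lemma ord_sub_C (x : HQ) (h : theta x ≠ 0) (t : ℂ) :
    (x - HahnSeries.C t).order = min (theta x).order 0 +
      (if t = x.coeff 0 then max (theta x).order 0 else 0) := by
  set y := x - HahnSeries.C (x.coeff 0) with hy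
  have ho : (theta x).order = y.order := theta_order x
  have hy0 : y ≠ 0 := by
    intro h0
    apply h
    rw [← HahnSeries.support_eq_empty_iff, theta_support, ← hy, h0, HahnSeries.support_zero]
  by_cases ht : t = x.coeff 0
  · rw [if_pos ht, ht, ← hy, ho]
    rw [min_add_max, add_zero]
  · rw [if_neg ht, add_zero]
    have e : x - HahnSeries.C t = y + HahnSeries.C (x.coeff 0 - t) := by
      rw [hy, map_sub]; ring
    have hc : (HahnSeries.C (x.coeff 0 - t) : HQ) ≠ 0 := by
      exact HahnSeries.C_ne_zero (sub_ne_zero.mpr (Ne.symm ht))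
    have hne : y.orderTop ≠ (HahnSeries.C (x.coeff 0 - t) : HQ).orderTop := by
      intro hh
      apply theta_order_ne x h
      rw [ho]
      rw [← HahnSeries.order_eq_orderTop_of_ne_zero hy0, ← HahnSeries.order_eq_orderTop_of_ne_zero hc, HahnSeries.order_C] at hh
      exact_mod_cast hh
    have hs : y + HahnSeries.C (x.coeff 0 - t) ≠ 0 := by
      rw [← e]; intro h0
      apply h
      rw [sub_eq_zero.mp h0, theta_C]
    have := HahnSeries.orderTop_add_eq_left (x := y) (y := (HahnSeries.C (x.coeff 0 - t) : HQ))
    rcases lt_or_gt_of_ne hne with h1 | h1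
    · have h2 := HahnSeries.orderTop_add_eq_left h1
      rw [← HahnSeries.order_eq_orderTop_of_ne_zero hy0, ← HahnSeries.order_eq_orderTop_of_ne_zero hs] at h2
      rw [← HahnSeries.order_eq_orderTop_of_ne_zero hy0, ← HahnSeries.order_eq_orderTop_of_ne_zero hc, HahnSeries.order_C] at h1
      have h3 : y.order < 0 := by exact_mod_cast h1
      rw [e, ho, min_eq_left h3.le]; exact_mod_cast h2
    · have h2 := HahnSeries.orderTop_add_eq_right h1
      rw [← HahnSeries.order_eq_orderTop_of_ne_zero hc, ← HahnSeries.order_eq_orderTop_of_ne_zero hs] at h2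
      rw [← HahnSeries.order_eq_orderTop_of_ne_zero hy0, ← HahnSeries.order_eq_orderTop_of_ne_zero hc, HahnSeries.order_C] at h1
      have h3 : 0 < y.order := by exact_mod_cast h1
      rw [e, ho, min_eq_right h3.le]
      rw [HahnSeries.order_C] at h2
      exact_mod_cast h2

lemma algMap_emb (a : PowerSeries ℂ) : algebraMap (PowerSeries ℂ) HQ a = emb 1 one_pos a := by
  rw [HahnSeries.algebraMap_apply']
  ext r
  by_cases h : ∃ k : ℕ, (k : ℚ) / (1:ℕ) = r
  · obtain ⟨k, rfl⟩ := h
    rw [emb_coeff]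
    simp [HahnSeries.ofPowerSeries_apply_coeff]
  · push Not at h
    rw [emb_coeff_notin _ _ _ _ h, HahnSeries.ofPowerSeries_apply, HahnSeries.embDomain_of_notMem_range]
    rintro ⟨k, hk⟩
    exact h k (by simpa using hk)

lemma algMap_C (c : ℂ) : algebraMap (PowerSeries ℂ) HQ (PowerSeries.C c) = HahnSeries.C c := by
  rw [HahnSeries.algebraMap_apply']
  exact HahnSeries.ofPowerSeries_C c

lemma algMap_X : algebraMap (PowerSeries ℂ) HQ PowerSeries.X = tt := by
  rw [HahnSeries.algebraMap_apply']
  simp [tt]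

lemma algMap_order (a : PowerSeries ℂ) (ha : a ≠ 0) :
    (algebraMap (PowerSeries ℂ) HQ a).order = ((a.order.toNat : ℕ) : ℚ) := by
  rw [algMap_emb]
  have h0 : ∀ k : ℕ, (emb 1 one_pos a).coeff (k:ℚ) = PowerSeries.coeff k a := by
    intro k
    simpa using emb_coeff 1 one_pos a k
  have hne : (emb 1 one_pos a).coeff ((a.order.toNat : ℕ):ℚ) ≠ 0 := by
    rw [h0]; exact PowerSeries.coeff_order (by simpa using ha)
  apply le_antisymm
  · exact HahnSeries.order_le_of_coeff_ne_zero hne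
  · by_contra hlt
    push Not at hlt
    have h1 : emb 1 one_pos a ≠ 0 := by
      intro h; rw [h] at hne; simp at hne
    have h2 := HahnSeries.coeff_order_eq_zero.not.mpr h1
    apply h2
    by_cases h : ∃ k : ℕ, (k : ℚ) / (1:ℕ) = (emb 1 one_pos a).order
    · obtain ⟨k, hk⟩ := h
      rw [← hk] at hlt ⊢
      rw [emb_coeff]
      apply PowerSeries.coeff_of_lt_order_toNat
      simpa using hlt
    · push Not at h
      rw [emb_coeff_notin _ _ _ _ h]

/-- chain rule -/
lemma theta_chain {σ : Type*} [Fintype σ] (φ : MvPolynomial σ ℂ →+* HQ) (hφ : ∀ c, φ (C c) = HahnSeries.C c)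
    (f : MvPolynomial σ ℂ) : theta (φ f) = ∑ i, φ (pderiv i f) * theta (φ (X i)) := by
  classical
  induction f using MvPolynomial.induction_on with
  | C a => rw [hφ, theta_C]; simp
  | add p q hp hq => simp [theta_add, hp, hq, add_mul, Finset.sum_add_distrib]
  | mul_X p i hp =>
    rw [map_mul, theta_mul, hp]
    simp only [Derivation.leibniz, pderiv_X, smul_eq_mul, map_add, map_mul, add_mul, Finset.sum_add_distrib]
    rw [add_comm, Finset.sum_mul]
    congr 1
    · rw [Finset.sum_eq_single i]
      · simp
      · intro b _ hb; simp [hb]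
      · simp
    · refine Finset.sum_congr rfl fun b _ => by ring

/-- the combinatorial identity -/
theorem comb_identity (S : Multiset HQ) (hS : ∀ w ∈ S, theta w ≠ 0) (d : ℕ) (μ : ℂ → ℕ) (I : ℕ)
    (hμ : ∀ t, (μ t : ℚ) = (S.map (fun w => (d : ℚ) - 1 + (w - HahnSeries.C t).order)).sum)
    (hI : (I : ℚ) = (S.map (fun w => (d : ℚ) + (theta w).order)).sum) :
    I = Multiset.card S + sInf (Set.range μ) + ∑ᶠ t, (μ t - sInf (Set.range μ)) := by
  classical
  set G : ℚ := (S.map (fun w => (d : ℚ) - 1 + min (theta w).order 0)).sum with hG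
  set L : ℂ → ℚ := fun t => (S.map (fun w => if t = w.coeff 0 then max (theta w).order 0 else 0)).sum with hL
  have h1 : ∀ t, (μ t : ℚ) = G + L t := by
    intro t
    rw [hμ, hG, hL, ← Multiset.sum_map_add]
    congr 1
    refine Multiset.map_congr rfl fun w hw => ?_
    rw [ord_sub_C w (hS w hw) t]; ring
  have hL0 : ∀ t, 0 ≤ L t := by
    intro t
    refine Multiset.sum_nonneg fun x hx => ?_
    obtain ⟨w, -, rfl⟩ := Multiset.mem_map.mp hx
    split_ifs
    · exact le_max_right _ _
    · exact le_rfl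
  set T : Finset ℂ := (S.map (fun w => w.coeff 0)).toFinset with hT
  have hLT : ∀ t, t ∉ T → L t = 0 := by
    intro t ht
    apply Multiset.sum_eq_zero
    intro x hx
    obtain ⟨w, hw, rfl⟩ := Multiset.mem_map.mp hx
    rw [if_neg]
    rintro rfl
    exact ht (Multiset.mem_toFinset.mpr (Multiset.mem_map_of_mem _ hw))
  obtain ⟨t0, ht0⟩ := Infinite.exists_notMem_finset T
  have hg : ((sInf (Set.range μ) : ℕ) : ℚ) = G := by
    have h2 : (μ t0 : ℚ) = G := by rw [h1, hLT t0 ht0, add_zero]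
    have h3 : sInf (Set.range μ) = μ t0 := by
      apply le_antisymm
      · exact Nat.sInf_le ⟨t0, rfl⟩
      · obtain ⟨t1, h4⟩ := Nat.sInf_mem (Set.range_nonempty μ)
        rw [← h4]
        have : (μ t0 : ℚ) ≤ μ t1 := by rw [h2, h1 t1]; linarith [hL0 t1]
        exact_mod_cast this
    rw [h3, h2]
  have hle : ∀ t, sInf (Set.range μ) ≤ μ t := fun t => Nat.sInf_le ⟨t, rfl⟩
  have hLt : ∀ t, ((μ t - sInf (Set.range μ) : ℕ) : ℚ) = L t := by
    intro t
    rw [Nat.cast_sub (hle t), hg, h1]; ring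
  have hfs : ∑ᶠ t, (μ t - sInf (Set.range μ)) = ∑ t ∈ T, (μ t - sInf (Set.range μ)) := by
    apply finsum_eq_sum_of_support_subset
    intro t ht
    by_contra hc
    apply ht
    have := hLt t
    rw [hLT t (by simpa using hc)] at this
    exact_mod_cast this
  have hsum : ∑ t ∈ T, L t = (S.map (fun w => max (theta w).order 0)).sum := by
    rw [hL]
    rw [Finset.sum_multiset_map_count] 
    simp_rw [Finset.sum_multiset_map_count]
    rw [Finset.sum_comm]
    refine Finset.sum_congr rfl fun w hw => ?_
    rw [← Finset.smul_sum, Finset.sum_ite_eq' , if_pos]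
    exact Multiset.mem_toFinset.mpr (Multiset.mem_map_of_mem _ (Multiset.mem_toFinset.mp hw))
  have : (I : ℚ) = ((Multiset.card S + sInf (Set.range μ) + ∑ᶠ t, (μ t - sInf (Set.range μ)) : ℕ) : ℚ) := by
    rw [hfs]
    push_cast
    rw [hg]
    have : ∑ t ∈ T, ((μ t - sInf (Set.range μ) : ℕ) : ℚ) = ∑ t ∈ T, L t := Finset.sum_congr rfl fun t _ => hLt t
    rw [this, hsum, hI, hG]
    have hc : (Multiset.card S : ℚ) = (S.map (fun _ => (1:ℚ))).sum := by simp
    rw [hc, ← Multiset.sum_map_add, ← Multiset.sum_map_add]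
    congr 1
    refine Multiset.map_congr rfl fun w hw => ?_
    have := min_add_max (theta w).order 0
    linarith
  exact_mod_cast this

end Theta
end

open MvPolynomial Filter CategoryTheory Limits Topology
noncomputable section
set_option linter.unusedSectionVars false
section NormDim

lemma ps_associated_pow (a : PowerSeries ℂ) (ha : a ≠ 0) :
    Associated a (PowerSeries.X ^ a.order.toNat) := by
  obtain ⟨u, hu⟩ := PowerSeries.isUnit_divided_by_X_pow_order ha
  refine Associated.symm ⟨u, ?_⟩
  rw [hu]
  exact PowerSeries.X_pow_order_mul_divXPowOrder

lemma finrank_ps_pow (n : ℕ) : Module.Finite ℂ (PowerSeries ℂ ⧸ Ideal.span {(PowerSeries.X : PowerSeries ℂ) ^ n}) ∧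
    Module.finrank ℂ (PowerSeries ℂ ⧸ Ideal.span {(PowerSeries.X : PowerSeries ℂ) ^ n}) = n := by
  let f : PowerSeries ℂ →ₗ[ℂ] (Fin n → ℂ) := LinearMap.pi (fun i => PowerSeries.coeff (R := ℂ) i)
  have hs : Function.Surjective f := by
    intro v
    refine ⟨PowerSeries.mk (fun k => if h : k < n then v ⟨k, h⟩ else 0), ?_⟩
    funext i
    simp [f, PowerSeries.coeff_mk]
  have hk : LinearMap.ker f = (Ideal.span {(PowerSeries.X : PowerSeries ℂ) ^ n}).restrictScalars ℂ := by
    ext x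
    rw [LinearMap.mem_ker, Submodule.restrictScalars_mem, Ideal.mem_span_singleton, PowerSeries.X_pow_dvd_iff]
    constructor
    · intro h m hm
      exact congrFun h ⟨m, hm⟩
    · intro h
      funext i
      exact h i i.2
  let e := (Submodule.quotEquivOfEq _ _ hk).symm.trans (f.quotKerEquivOfSurjective hs)
  let e2 : (PowerSeries ℂ ⧸ Ideal.span {(PowerSeries.X : PowerSeries ℂ) ^ n}) ≃ₗ[ℂ] (Fin n → ℂ) :=
    (Submodule.Quotient.restrictScalarsEquiv ℂ (Ideal.span {(PowerSeries.X : PowerSeries ℂ) ^ n})).symm.trans e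
  exact ⟨Module.Finite.equiv e2.symm, by rw [e2.finrank_eq]; simp⟩

lemma finrank_ps_quot (a : PowerSeries ℂ) (ha : a ≠ 0) : Module.Finite ℂ (PowerSeries ℂ ⧸ Ideal.span {a}) ∧
    Module.finrank ℂ (PowerSeries ℂ ⧸ Ideal.span {a}) = a.order.toNat := by
  have h : Ideal.span {a} = Ideal.span {(PowerSeries.X : PowerSeries ℂ) ^ a.order.toNat} :=
    Ideal.span_singleton_eq_span_singleton.mpr (ps_associated_pow a ha)
  rw [h]
  exact finrank_ps_pow _

lemma ps_order_mul_toNat (a b : PowerSeries ℂ) (ha : a ≠ 0) (hb : b ≠ 0) :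
    (a * b).order.toNat = a.order.toNat + b.order.toNat := by
  rw [PowerSeries.order_mul, ENat.toNat_add]
  · simpa using ha
  · simpa using hb

lemma ps_order_assoc (a b : PowerSeries ℂ) (h : Associated a b) : a.order.toNat = b.order.toNat := by
  obtain ⟨u, rfl⟩ := h
  by_cases ha : a = 0
  · simp [ha]
  rw [ps_order_mul_toNat _ _ ha u.ne_zero]
  have : (u : PowerSeries ℂ).order = 0 := PowerSeries.order_zero_of_unit u.isUnit
  simp [this]

lemma ps_order_prod {ι : Type*} (s : Finset ι) (f : ι → PowerSeries ℂ) (h : ∀ i ∈ s, f i ≠ 0) :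
    (∏ i ∈ s, f i).order.toNat = ∑ i ∈ s, (f i).order.toNat := by
  classical
  induction s using Finset.induction_on with
  | empty => simp
  | insert i s hi ih =>
    rw [Finset.prod_insert hi, Finset.sum_insert hi, ps_order_mul_toNat _ _ (h i (by simp)), ih (fun j hj => h j (by simp [hj]))]
    exact Finset.prod_ne_zero_iff.mpr fun j hj => h j (by simp [hj])

theorem finrank_coker {M : Type*} [AddCommGroup M] [Module (PowerSeries ℂ) M] [Module.Finite (PowerSeries ℂ) M]
    [Module.Free (PowerSeries ℂ) M] [Module ℂ M] [IsScalarTower ℂ (PowerSeries ℂ) M]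
    (T : M →ₗ[PowerSeries ℂ] M) (hT : LinearMap.det T ≠ 0) :
    Module.Finite ℂ (M ⧸ LinearMap.range T) ∧
    Module.finrank ℂ (M ⧸ LinearMap.range T) = (LinearMap.det T).order.toNat := by
  classical
  have hinj : Function.Injective T := by
    rw [← LinearMap.ker_eq_bot]
    by_contra h
    exact hT (LinearMap.det_eq_zero_iff_ker_ne_bot.mpr h)
  set N := LinearMap.range T with hN
  let e : M ≃ₗ[PowerSeries ℂ] N := LinearEquiv.ofInjective T hinj
  let b := Module.Free.chooseBasis (PowerSeries ℂ) M
  have h : Module.finrank (PowerSeries ℂ) N = Module.finrank (PowerSeries ℂ) M := e.symm.finrank_eq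
  let a := Submodule.smithNormalFormCoeffs b h
  let b' := Submodule.smithNormalFormTopBasis b h
  let ab := Submodule.smithNormalFormBotBasis b h
  have ab_eq := Submodule.smithNormalFormBotBasis_def b h
  let e' : M ≃ₗ[PowerSeries ℂ] N := b'.equiv ab (Equiv.refl _)
  let f : M →ₗ[PowerSeries ℂ] M := N.subtype.comp (e' : M →ₗ[PowerSeries ℂ] N)
  have hfT : Associated (LinearMap.det T) (LinearMap.det f) := by
    refine LinearMap.associated_det_of_eq_comp (e.trans e'.symm) _ _ ?_
    intro x
    simp [f, e]
    rfl
  have ha : ∀ i, f (b' i) = a i • b' i := by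
    intro i
    show ((b'.equiv ab (Equiv.refl _)) (b' i) : M) = _
    rw [b'.equiv_apply, Equiv.refl_apply]
    exact ab_eq i
  have hdet : LinearMap.det f = ∏ i, a i := by
    rw [← LinearMap.det_toMatrix b', ← Matrix.det_diagonal]
    congr 1
    ext i j
    rw [LinearMap.toMatrix_apply, ha, map_smul, b'.repr_self, Finsupp.smul_single, smul_eq_mul, mul_one]
    by_cases hij : i = j
    · rw [hij]; simp
    · rw [Matrix.diagonal_apply_ne _ hij, Finsupp.single_eq_of_ne hij]
  have hprod : ∏ i, a i ≠ 0 := by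
    rw [← hdet]; exact fun h0 => hT (hfT.eq_zero_iff.mpr h0)
  have hai : ∀ i, a i ≠ 0 := fun i => Finset.prod_ne_zero_iff.mp hprod i (Finset.mem_univ i)
  have h1 := fun i => finrank_ps_quot (a i) (hai i)
  have : ∀ i, Module.Finite ℂ (PowerSeries ℂ ⧸ Ideal.span {a i}) := fun i => (h1 i).1
  let E : (M ⧸ N) ≃ₗ[ℂ] Π i, PowerSeries ℂ ⧸ Ideal.span {a i} :=
    (N.quotientEquivPiSpan b h).restrictScalars ℂ
  refine ⟨Module.Finite.equiv E.symm, ?_⟩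
  rw [E.finrank_eq, Module.finrank_pi_fintype, ps_order_assoc _ _ hfT, hdet, ps_order_prod _ _ (fun i _ => hai i)]
  exact Finset.sum_congr rfl fun i _ => (h1 i).2

variable {B : Type*} [CommRing B] [Algebra (PowerSeries ℂ) B] [Module.Finite (PowerSeries ℂ) B]
    [Module.Free (PowerSeries ℂ) B] [Algebra ℂ B] [IsScalarTower ℂ (PowerSeries ℂ) B]

theorem finrank_quot_norm (c : B) (hc : Algebra.norm (PowerSeries ℂ) c ≠ 0) :
    Module.Finite ℂ (B ⧸ Ideal.span {c}) ∧
    Module.finrank ℂ (B ⧸ Ideal.span {c}) = (Algebra.norm (PowerSeries ℂ) c).order.toNat := by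
  have h := finrank_coker (Algebra.lmul (PowerSeries ℂ) B c) hc
  have hr : LinearMap.range (Algebra.lmul (PowerSeries ℂ) B c) = (Ideal.span {c}).restrictScalars (PowerSeries ℂ) := by
    ext x
    simp [Ideal.mem_span_singleton', mul_comm, LinearMap.mem_range]
  rw [hr] at h
  let e : (B ⧸ (Ideal.span {c}).restrictScalars (PowerSeries ℂ)) ≃ₗ[ℂ] (B ⧸ Ideal.span {c}) :=
    (Submodule.Quotient.restrictScalarsEquiv (PowerSeries ℂ) (Ideal.span {c})).restrictScalars ℂ
  have := h.1
  exact ⟨Module.Finite.equiv e, by rw [← e.finrank_eq, h.2]; rfl⟩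

open TensorProduct in
theorem exists_split_homs {O B F : Type*} [CommRing O] [Nontrivial O] [Field F] [Algebra O F] [CommRing B] [Algebra O B] [Module.Finite O B]
    [Module.Free O B] (hsp : ∀ p : Polynomial O, p.Monic → (p.map (algebraMap O F)).Splits) :
    ∃ S : Multiset (B →ₐ[O] F), S.card = Module.finrank (O) B ∧
      ∀ c, algebraMap (O) F (Algebra.norm (O) c) = (S.map (fun φ => φ c)).prod := by
  have hA : ∀ I : Ideal (F ⊗[O] B), I.IsMaximal → Module.Finite F ((F ⊗[O] B) ⧸ I) →
      Function.Surjective (algebraMap F ((F ⊗[O] B) ⧸ I)) := by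
    intro I hI _
    have : IsDomain ((F ⊗[O] B) ⧸ I) := Ideal.Quotient.isDomain I
    have key : ∀ c : B, ∃ y : F, algebraMap F ((F ⊗[O] B) ⧸ I) y = Ideal.Quotient.mk I (1 ⊗ₜ c) := by
      intro c
      obtain ⟨p, hp, hpc⟩ := (Algebra.IsIntegral.isIntegral (R := O) c)
      have hs := hsp p hp
      have h0 : Polynomial.aeval (Ideal.Quotient.mk I (1 ⊗ₜ c : (F ⊗[O] B))) (p.map (algebraMap (O) F)) = 0 := by
        rw [Polynomial.aeval_map_algebraMap]
        let ψ : B →ₐ[O] ((F ⊗[O] B) ⧸ I) := ((Ideal.Quotient.mkₐ F I).restrictScalars (O)).comp (Algebra.TensorProduct.includeRight)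
        have : Ideal.Quotient.mk I (1 ⊗ₜ c : (F ⊗[O] B)) = ψ c := rfl
        rw [this, Polynomial.aeval_algHom_apply]
        have : Polynomial.aeval c p = 0 := hpc
        rw [this, map_zero]
      have hm : (p.map (algebraMap (O) F)).Monic := hp.map _
      rw [hs.eq_prod_roots_of_monic hm, map_multiset_prod, Multiset.prod_eq_zero_iff] at h0
      obtain ⟨q, hq, hq0⟩ := Multiset.mem_map.mp h0
      obtain ⟨r, hr, rfl⟩ := Multiset.mem_map.mp hq
      refine ⟨r, ?_⟩
      simp only [map_sub, Polynomial.aeval_X, Polynomial.aeval_C] at hq0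
      exact (sub_eq_zero.mp hq0).symm
    intro x
    obtain ⟨x, rfl⟩ := Ideal.Quotient.mk_surjective x
    induction x using TensorProduct.induction_on with
    | zero => exact ⟨0, by simp⟩
    | tmul a c =>
      obtain ⟨y, hy⟩ := key c
      refine ⟨a * y, ?_⟩
      rw [map_mul, hy]
      have : (a ⊗ₜ[O] c : (F ⊗[O] B)) = algebraMap F (F ⊗[O] B) a * (1 ⊗ₜ c) := by
        simp [Algebra.TensorProduct.algebraMap_apply]
      rw [this, map_mul]
      rfl
    | add x y hx hy =>
      obtain ⟨a, ha⟩ := hx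
      obtain ⟨b, hb⟩ := hy
      exact ⟨a + b, by rw [map_add, ha, hb, map_add]⟩
  obtain ⟨S, h1, h2⟩ := exists_chars' (F := F) (A := (F ⊗[O] B)) hA (Module.finrank F (F ⊗[O] B)) (F ⊗[O] B) rfl
  refine ⟨S.map (fun χ => (χ.restrictScalars (O)).comp Algebra.TensorProduct.includeRight), ?_, ?_⟩
  · rw [Multiset.card_map, h1]
    exact Module.finrank_baseChange
  · intro c
    have := h2 (1 ⊗ₜ c)
    rw [Multiset.map_map]
    refine Eq.trans ?_ (this.trans ?_)
    · rw [Algebra.norm_apply, ← LinearMap.det_baseChange, Algebra.baseChange_lmul]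
      rfl
    · rfl

theorem exists_puiseux_homs :
    ∃ S : Multiset (B →ₐ[PowerSeries ℂ] HQ), S.card = Module.finrank (PowerSeries ℂ) B ∧
      ∀ c, algebraMap (PowerSeries ℂ) HQ (Algebra.norm (PowerSeries ℂ) c) = (S.map (fun φ => φ c)).prod := by
  apply exists_split_homs
  intro p hp
  have hs := Polynomial.puiseux _ p hp rfl 1 one_pos
  have hmap : p.map (emb 1 one_pos) = p.map (algebraMap (PowerSeries ℂ) HQ) := by
    congr 1
    ext1 a
    exact (algMap_emb a).symm
  rwa [hmap] at hs

lemma order_multiset_prod (S : Multiset HQ) (h : ∀ x ∈ S, x ≠ 0) : S.prod.order = (S.map HahnSeries.order).sum ∧ S.prod ≠ 0 := by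
  induction S using Multiset.induction_on with
  | empty => simp
  | cons a S ih =>
    obtain ⟨h1, h2⟩ := ih (fun x hx => h x (Multiset.mem_cons_of_mem hx))
    have ha := h a (Multiset.mem_cons_self _ _)
    rw [Multiset.prod_cons, Multiset.map_cons, Multiset.sum_cons, HahnSeries.order_mul ha h2, h1]
    exact ⟨rfl, mul_ne_zero ha h2⟩

/-- main algebraic dimension formula -/
theorem dim_formula (S : Multiset (B →ₐ[PowerSeries ℂ] HQ))
    (hS : ∀ c, algebraMap (PowerSeries ℂ) HQ (Algebra.norm (PowerSeries ℂ) c) = (S.map (fun φ => φ c)).prod)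
    (c : B) (hc : ∀ φ ∈ S, φ c ≠ 0) : Module.Finite ℂ (B ⧸ Ideal.span {c}) ∧
    (Module.finrank ℂ (B ⧸ Ideal.span {c}) : ℚ) = (S.map (fun φ => (φ c).order)).sum := by
  obtain ⟨h1, h2⟩ := order_multiset_prod (S.map (fun φ => φ c)) (by
    intro x hx; obtain ⟨φ, hφ, rfl⟩ := Multiset.mem_map.mp hx; exact hc φ hφ)
  rw [← hS] at h1 h2
  have hn : Algebra.norm (PowerSeries ℂ) c ≠ 0 := fun h => h2 (by rw [h, map_zero])
  obtain ⟨h3, h4⟩ := finrank_quot_norm c hn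
  refine ⟨h3, ?_⟩
  rw [h4, ← algMap_order _ hn, h1, Multiset.map_map]
  rfl

theorem dim_rank : Module.finrank ℂ (B ⧸ Ideal.span {algebraMap (PowerSeries ℂ) B PowerSeries.X}) =
    Module.finrank (PowerSeries ℂ) B := by
  have hn : Algebra.norm (PowerSeries ℂ) (algebraMap (PowerSeries ℂ) B PowerSeries.X) =
      PowerSeries.X ^ (Module.finrank (PowerSeries ℂ) B) := by
    let b := Module.Free.chooseBasis (PowerSeries ℂ) B
    rw [Algebra.norm_algebraMap_of_basis b, Module.finrank_eq_card_basis b]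
  rw [(finrank_quot_norm _ (by rw [hn]; exact pow_ne_zero _ PowerSeries.X_ne_zero)).2, hn]
  simp

end NormDim
end

open MvPolynomial Filter CategoryTheory Limits Topology
noncomputable section
section FinFree

lemma pi_precomplete (k : ℕ) :
    IsPrecomplete (Ideal.span {(PowerSeries.X : PowerSeries ℂ)}) (Fin k → PowerSeries ℂ) := by
  have hO : IsPrecomplete (Ideal.span {(PowerSeries.X : PowerSeries ℂ)}) (PowerSeries ℂ) := by
    have := psC_complete
    rw [psC_maximalIdeal] at this
    exact this.toIsPrecomplete
  constructor
  intro f hf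
  have h1 : ∀ i : Fin k, ∃ L : PowerSeries ℂ, ∀ n, f n i ≡ L
      [SMOD (Ideal.span {(PowerSeries.X : PowerSeries ℂ)} ^ n • ⊤ : Submodule (PowerSeries ℂ) (PowerSeries ℂ))] := by
    intro i
    apply hO.prec
    intro m n hmn
    have := (hf hmn)
    rw [SModEq.sub_mem] at this ⊢
    have h2 := Submodule.mem_map_of_mem (f := LinearMap.proj (R := PowerSeries ℂ) (φ := fun _ : Fin k => PowerSeries ℂ) i) this
    rw [Submodule.map_smul''] at h2
    exact (Submodule.smul_mono le_rfl le_top : _ ≤ _) h2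
  choose L hL using h1
  refine ⟨L, fun n => ?_⟩
  rw [SModEq.sub_mem]
  have h2 : ∀ i, ∃ c : PowerSeries ℂ, f n i - L i = PowerSeries.X ^ n * c := by
    intro i
    have := hL i n
    rw [SModEq.sub_mem, Ideal.span_singleton_pow, smul_eq_mul, Ideal.mul_top, Ideal.mem_span_singleton] at this
    exact this
  choose c hc using h2
  have : f n - L = (PowerSeries.X ^ n : PowerSeries ℂ) • c := by
    funext i
    simp [hc]
  rw [this]
  exact Submodule.smul_mem_smul (Ideal.pow_mem_pow (Ideal.mem_span_singleton_self _) _) trivial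

theorem finite_free {B : Type*} [CommRing B] [IsLocalRing B] [IsNoetherianRing B]
    [Algebra (PowerSeries ℂ) B] [Algebra ℂ B] [IsScalarTower ℂ (PowerSeries ℂ) B]
    (hz : algebraMap (PowerSeries ℂ) B PowerSeries.X ∈ IsLocalRing.maximalIdeal B)
    (hreg : ∀ b : B, algebraMap (PowerSeries ℂ) B PowerSeries.X * b = 0 → b = 0)
    (hfin : Module.Finite ℂ (B ⧸ Ideal.span {algebraMap (PowerSeries ℂ) B PowerSeries.X})) :
    Module.Finite (PowerSeries ℂ) B ∧ Module.Free (PowerSeries ℂ) B := by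
  set z := algebraMap (PowerSeries ℂ) B PowerSeries.X with hzd
  have hmap : (Ideal.span {(PowerSeries.X : PowerSeries ℂ)}).map (algebraMap (PowerSeries ℂ) B) = Ideal.span {z} := by
    rw [Ideal.map_span, Set.image_singleton]
  have hH : IsHausdorff (Ideal.span {(PowerSeries.X : PowerSeries ℂ)}) B := by
    rw [← IsHausdorff.map_algebraMap_iff (S := B), hmap]
    apply IsHausdorff.of_isLocalRing
    intro h
    have : Ideal.span {z} ≤ IsLocalRing.maximalIdeal B := by
      rw [Ideal.span_le]; simpa using hz
    rw [h] at this
    exact (IsLocalRing.maximalIdeal.isMaximal B).ne_top (top_le_iff.mp this)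
  obtain ⟨k, v, hv⟩ := Module.Finite.exists_fin (R := ℂ) (M := B ⧸ Ideal.span {z})
  choose w hw using fun i => Ideal.Quotient.mk_surjective (v i)
  let f : (Fin k → PowerSeries ℂ) →ₗ[PowerSeries ℂ] B := Fintype.linearCombination (PowerSeries ℂ) w
  have := pi_precomplete k
  have hs : Function.Surjective f := by
    apply surjective_of_mkQ_comp_surjective (I := Ideal.span {(PowerSeries.X : PowerSeries ℂ)})
    intro y
    obtain ⟨b, rfl⟩ := Submodule.mkQ_surjective _ y
    have hb : Ideal.Quotient.mk (Ideal.span {z}) b ∈ Submodule.span ℂ (Set.range v) := by rw [hv]; trivial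
    rw [Submodule.mem_span_range_iff_exists_fun] at hb
    obtain ⟨c, hc⟩ := hb
    refine ⟨fun i => PowerSeries.C (c i), ?_⟩
    rw [LinearMap.comp_apply, Submodule.mkQ_apply, Submodule.mkQ_apply, Submodule.Quotient.eq]
    have hff : f (fun i => PowerSeries.C (c i)) = ∑ i, algebraMap ℂ B (c i) * w i := by
      simp only [f, Fintype.linearCombination_apply]
      refine Finset.sum_congr rfl fun i _ => ?_
      rw [Algebra.smul_def, IsScalarTower.algebraMap_apply ℂ (PowerSeries ℂ) B]
      rfl
    have hmem : f (fun i => PowerSeries.C (c i)) - b ∈ Ideal.span {z} := by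
      rw [← Ideal.Quotient.eq, ← hc, hff, map_sum]
      refine Finset.sum_congr rfl fun i _ => ?_
      rw [map_mul, hw, Algebra.smul_def]
      rfl
    rw [Ideal.mem_span_singleton] at hmem
    obtain ⟨e, he⟩ := hmem
    rw [he, hzd, ← Algebra.smul_def]
    exact Submodule.smul_mem_smul (Ideal.mem_span_singleton_self _) trivial
  have hfinite : Module.Finite (PowerSeries ℂ) B := Module.Finite.of_surjective f hs
  refine ⟨hfinite, ?_⟩
  have htf : Module.IsTorsionFree (PowerSeries ℂ) B := by
    refine ⟨fun r hr => ?_⟩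
    have hr0 : r ≠ 0 := hr.ne_zero
    obtain ⟨u, hu⟩ := ps_associated_pow r hr0
    have key : ∀ n : ℕ, ∀ b : B, z ^ n * b = 0 → b = 0 := by
      intro n
      induction n with
      | zero => intro b hb; simpa using hb
      | succ n ih =>
        intro b hb
        rw [pow_succ, mul_assoc] at hb
        exact hreg _ (ih _ hb)
    intro a b hab
    have h0 : r • (a - b) = 0 := by rw [smul_sub, sub_eq_zero]; exact hab
    have h1 : (r * ↑u : PowerSeries ℂ) • (a - b) = 0 := by
      rw [mul_comm, mul_smul, h0, smul_zero]
    have : a - b = 0 := by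
      apply key r.order.toNat
      rw [hzd, ← map_pow, ← Algebra.smul_def]
      rw [hu] at h1
      exact h1
    exact sub_eq_zero.mp this
  infer_instance
end FinFree
end

open MvPolynomial Filter CategoryTheory Limits Topology
noncomputable section
section LocalAbs

lemma hq_coeff_zero_of_pos (x : HQ) (h : x = 0 ∨ 0 < x.order) : x.coeff 0 = 0 := by
  rcases h with rfl | h
  · simp
  · exact HahnSeries.coeff_eq_zero_of_lt_order h

lemma hq_order_pow (x : HQ) (k : ℕ) : (x ^ k).order = k * x.order := by
  by_cases hx : x = 0
  · subst hx
    cases k with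
    | zero => simp
    | succ k => simp
  induction k with
  | zero => simp
  | succ k ih =>
    rw [pow_succ, HahnSeries.order_mul (pow_ne_zero _ hx) hx, ih]
    push_cast; ring

lemma hq_algMap_nonneg (a : PowerSeries ℂ) : 0 ≤ (algebraMap (PowerSeries ℂ) HQ a).order := by
  by_cases ha : a = 0
  · subst ha; rw [map_zero]; simp
  · rw [algMap_order a ha]; positivity

lemma hq_integral_order (y : HQ) (h : IsIntegral (PowerSeries ℂ) y) : 0 ≤ y.order := by
  by_contra hneg
  push Not at hneg
  have hy : y ≠ 0 := by rintro rfl; simp at hneg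
  obtain ⟨p, hp, hpy⟩ := h
  have hu : (y⁻¹).order = - y.order := by
    have : (y * y⁻¹).order = 0 := by rw [mul_inv_cancel₀ hy]; simp
    rw [HahnSeries.order_mul hy (inv_ne_zero hy)] at this
    linarith
  rw [Polynomial.eval₂_eq_sum_range, Finset.sum_range_succ, hp.coeff_natDegree, map_one, one_mul] at hpy
  have h2 : 1 + ∑ i ∈ Finset.range p.natDegree, algebraMap (PowerSeries ℂ) HQ (p.coeff i) * y⁻¹ ^ (p.natDegree - i) = 0 := by
    have : (0 : HQ) = 0 * y⁻¹ ^ p.natDegree := by ring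
    rw [this, ← hpy, add_mul, Finset.sum_mul, ← mul_pow, mul_inv_cancel₀ hy, one_pow, add_comm]
    congr 1
    refine Finset.sum_congr rfl fun i hi => ?_
    have hi' : i < p.natDegree := Finset.mem_range.mp hi
    have : p.natDegree = i + (p.natDegree - i) := by omega
    conv_rhs => rw [this, pow_add]
    rw [mul_assoc, ← mul_assoc (y ^ i), ← mul_pow, mul_inv_cancel₀ hy, one_pow, one_mul]
  have h3 := congrArg (fun x : HQ => x.coeff 0) h2
  simp only [HahnSeries.coeff_add, HahnSeries.coeff_zero, HahnSeries.coeff_sum] at h3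
  rw [Finset.sum_eq_zero] at h3
  · simp at h3
  intro i hi
  have hi' : i < p.natDegree := Finset.mem_range.mp hi
  apply hq_coeff_zero_of_pos
  by_cases h0 : algebraMap (PowerSeries ℂ) HQ (p.coeff i) = 0
  · left; rw [h0, zero_mul]
  · right
    rw [HahnSeries.order_mul h0 (pow_ne_zero _ (inv_ne_zero hy)), hq_order_pow, hu]
    have h1 := hq_algMap_nonneg (p.coeff i)
    have : (0:ℚ) < ((p.natDegree - i : ℕ) : ℚ) := by
      have : 0 < p.natDegree - i := by omega
      exact_mod_cast this
    nlinarith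

variable {σ : Type} [Fintype σ] [DecidableEq σ]

theorem local_abs {B : Type} [CommRing B]
    [Algebra (PowerSeries ℂ) B] [Algebra ℂ B] [IsScalarTower ℂ (PowerSeries ℂ) B]
    [Module.Finite (PowerSeries ℂ) B] [Module.Free (PowerSeries ℂ) B]
    (ψ : MvPolynomial σ ℂ →ₐ[ℂ] B) (j : σ) (g : MvPolynomial σ ℂ) (d : ℕ)
    (hψ : ψ (X j) = algebraMap (PowerSeries ℂ) B PowerSeries.X)
    (hker : ∀ i, i ≠ j → ψ (pderiv i g) = 0)
    (hnil : ∀ i, ∃ k : ℕ, ψ (X i) ^ k ∈ Ideal.span {ψ (X j)})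
    (hd : 1 ≤ d)
    (hg : constantCoeff g = 0)
    (hb : ∀ χ : MvPolynomial σ ℂ →+* HQ, (∀ c, χ (C c) = HahnSeries.C c) → χ (X j) = tt →
      ∀ t : ℂ, χ (g - C t * X j ^ d) = 0 → (∀ i, χ (pderiv i (g - C t * X j ^ d)) = 0) → False) :
    let μ : ℂ → ℕ := fun t => Module.finrank ℂ (B ⧸ Ideal.span {ψ (pderiv j (g - C t * X j ^ d))})
    Module.finrank ℂ (B ⧸ Ideal.span {ψ (C (d:ℂ) * g - X j * pderiv j g)}) =
      Module.finrank ℂ (B ⧸ Ideal.span {ψ (X j)}) + sInf (Set.range μ) +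
        ∑ᶠ t, (μ t - sInf (Set.range μ)) := by
  intro μ
  obtain ⟨S, hS1, hS2⟩ := exists_puiseux_homs (B := B)
  let ch : (B →ₐ[PowerSeries ℂ] HQ) → MvPolynomial σ ℂ →+* HQ := fun φ => φ.toRingHom.comp ψ.toRingHom
  have chC : ∀ φ c, ch φ (C c) = HahnSeries.C c := by
    intro φ c
    have : ψ (C c) = algebraMap (PowerSeries ℂ) B (PowerSeries.C c) := by
      rw [← MvPolynomial.algebraMap_eq, AlgHom.commutes, IsScalarTower.algebraMap_apply ℂ (PowerSeries ℂ) B]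
      rfl
    change φ (ψ (C c)) = _
    rw [this, AlgHom.commutes, algMap_C]
  have chX : ∀ φ, ch φ (X j) = tt := by
    intro φ
    change φ (ψ (X j)) = _
    rw [hψ, AlgHom.commutes, algMap_X]
  have chi : ∀ φ i, i ≠ j → ch φ (pderiv i g) = 0 := by
    intro φ i hi
    change φ (ψ _) = _
    rw [hker i hi, map_zero]
  have hpd : ∀ (t : ℂ) (i : σ), pderiv i (g - C t * X j ^ d) = pderiv i g - if i = j then C ((d:ℂ) * t) * X j ^ (d-1) else 0 := by
    intro t i
    rw [map_sub]
    congr 1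
    rw [pderiv_C_mul, pderiv_pow, pderiv_X]
    split_ifs with h
    · subst h
      simp [smul_eq_C_mul]; ring
    · rw [Pi.single_eq_of_ne (Ne.symm h)]; simp
  have hpsm : ∀ i, ∃ k, ψ (X i) ^ k ∈ Ideal.span {ψ (X j)} := hnil
  have hnonneg : ∀ (φ : B →ₐ[PowerSeries ℂ] HQ) b, 0 ≤ (φ b).order := by
    intro φ b
    apply hq_integral_order
    exact (Algebra.IsIntegral.isIntegral (R := PowerSeries ℂ) b).map φ
  have hconst : ∀ (φ : B →ₐ[PowerSeries ℂ] HQ), (ch φ g).coeff 0 = 0 := by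
    intro φ
    have hrad : ψ g ∈ (Ideal.span {ψ (X j)}).radical := by
      have h1 : g ∈ idealOfVars σ ℂ := by
        rw [← pow_one (idealOfVars σ ℂ), mem_pow_idealOfVars_iff']
        intro x hx
        have : x = 0 := by
          rw [← Finsupp.degree_eq_zero_iff]; omega
        rw [this]
        exact hg
      have h2 : idealOfVars σ ℂ ≤ ((Ideal.span {ψ (X j)}).radical).comap ψ := by
        rw [idealOfVars, Ideal.span_le]
        rintro _ ⟨i, rfl⟩
        exact hnil i
      exact h2 h1
    obtain ⟨k, hk⟩ := hrad
    rw [Ideal.mem_span_singleton] at hk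
    obtain ⟨c, hc⟩ := hk
    have h3 : (ch φ g) ^ k = tt * φ c := by
      rw [← chX φ]
      change (φ (ψ g))^k = φ (ψ (X j)) * φ c
      rw [← map_pow, hc, map_mul]
    apply hq_coeff_zero_of_pos
    by_cases h0 : ch φ g = 0
    · left; exact h0
    right
    have hne : φ c ≠ 0 := by
      intro h; rw [h, mul_zero] at h3; exact h0 (eq_zero_of_pow_eq_zero h3)
    have h4 := congrArg HahnSeries.order h3
    rw [hq_order_pow, HahnSeries.order_mul tt_ne hne, tt_order] at h4
    have h5 := hnonneg φ c
    by_contra hle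
    push Not at hle
    have : (k:ℚ) * (ch φ g).order ≤ 0 := mul_nonpos_of_nonneg_of_nonpos (by positivity) hle
    linarith
  have htheta : ∀ φ f, (∀ i, i ≠ j → ch φ (pderiv i f) = 0) → theta (ch φ f) = ch φ (pderiv j f) * tt := by
    intro φ f hf
    rw [theta_chain (ch φ) (chC φ) f, Finset.sum_eq_single j]
    · rw [chX, theta_tt]
    · intro i _ hi; rw [hf i hi, zero_mul]
    · simp
  let w : (B →ₐ[PowerSeries ℂ] HQ) → HQ := fun φ => ch φ g / tt ^ d
  have hw : ∀ φ, ch φ g = tt ^ d * w φ := by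
    intro φ
    simp only [w]
    field_simp [tt_ne]
  have hgt : ∀ φ (t : ℂ), ch φ (g - C t * X j ^ d) = tt ^ d * (w φ - HahnSeries.C t) := by
    intro φ t
    rw [map_sub, map_mul, map_pow, chC, chX, hw]; ring
  have hpt0 : ∀ φ (t : ℂ) i, i ≠ j → ch φ (pderiv i (g - C t * X j ^ d)) = 0 := by
    intro φ t i hi
    rw [hpd, if_neg hi, sub_zero, chi φ i hi]
  have hthw : ∀ φ, theta (w φ) ≠ 0 := by
    intro φ h
    have h1 := theta_eq_zero _ h
    set t := (w φ).coeff 0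
    have h2 : ch φ (g - C t * X j ^ d) = 0 := by rw [hgt, ← h1, sub_self, mul_zero]
    refine hb (ch φ) (chC φ) (chX φ) t h2 ?_
    intro i
    by_cases hi : i = j
    · subst hi
      have h3 := htheta φ (g - C t * X i ^ d) (hpt0 φ t)
      rw [h2, theta_zero] at h3
      exact (mul_eq_zero.mp h3.symm).resolve_right tt_ne
    · exact hpt0 φ t i hi
  -- the two orders
  have hA : ∀ φ, ch φ (C (d:ℂ) * g - X j * pderiv j g) = - (tt ^ d * theta (w φ)) := by
    intro φ
    have h1 := htheta φ g (chi φ)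
    rw [hw, theta_mul, theta_tt_pow] at h1
    rw [map_sub, map_mul, map_mul, chC, chX, hw, mul_comm tt, ← h1]
    simp only [map_natCast]
    ring
  have hAo : ∀ φ, ch φ (C (d:ℂ) * g - X j * pderiv j g) ≠ 0 ∧
      (ch φ (C (d:ℂ) * g - X j * pderiv j g)).order = (d:ℚ) + (theta (w φ)).order := by
    intro φ
    rw [hA]
    refine ⟨neg_ne_zero.mpr (mul_ne_zero (pow_ne_zero _ tt_ne) (hthw φ)), ?_⟩
    rw [HahnSeries.order_neg, HahnSeries.order_mul (pow_ne_zero _ tt_ne) (hthw φ), hq_order_pow, tt_order]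
    ring
  have hwt : ∀ φ (t : ℂ), w φ - HahnSeries.C t ≠ 0 := by
    intro φ t h
    apply hthw φ
    rw [sub_eq_zero.mp h, theta_C]
  have hMo : ∀ φ (t : ℂ), ch φ (pderiv j (g - C t * X j ^ d)) ≠ 0 ∧
      (ch φ (pderiv j (g - C t * X j ^ d))).order = (d:ℚ) - 1 + (w φ - HahnSeries.C t).order := by
    intro φ t
    have h1 := htheta φ (g - C t * X j ^ d) (hpt0 φ t)
    have hc : (ch φ (g - C t * X j ^ d)).coeff 0 = 0 := by
      have : (C t * X j ^ d : MvPolynomial σ ℂ) = C t * X j ^ d := rfl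
      rw [map_sub, HahnSeries.coeff_sub, hconst, map_mul, map_pow, chC, chX, zero_sub, neg_eq_zero]
      apply hq_coeff_zero_of_pos
      by_cases ht : t = 0
      · left; rw [ht]; simp
      right
      rw [HahnSeries.order_mul (by simpa using ht) (pow_ne_zero _ tt_ne), hq_order_pow, tt_order, HahnSeries.order_C]
      have : (1:ℚ) ≤ d := by exact_mod_cast hd
      linarith
    have h2 := theta_order (ch φ (g - C t * X j ^ d))
    rw [hc, map_zero, sub_zero] at h2
    have hne : ch φ (pderiv j (g - C t * X j ^ d)) ≠ 0 := by
      intro h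
      rw [h, zero_mul] at h1
      have h3 := theta_eq_zero _ h1
      rw [hc, map_zero, hgt] at h3
      exact mul_ne_zero (pow_ne_zero _ tt_ne) (hwt φ t) h3
    refine ⟨hne, ?_⟩
    rw [h1, hgt, HahnSeries.order_mul hne tt_ne, HahnSeries.order_mul (pow_ne_zero _ tt_ne) (hwt φ t),
      hq_order_pow, tt_order] at h2
    linarith
  have hcard : Module.finrank ℂ (B ⧸ Ideal.span {ψ (X j)}) = (S.map w).card := by
    rw [hψ, dim_rank, Multiset.card_map, hS1]
  rw [hcard]
  refine comb_identity (S.map w) ?_ d μ _ ?_ ?_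
  · intro x hx
    obtain ⟨φ, _, rfl⟩ := Multiset.mem_map.mp hx
    exact hthw φ
  · intro t
    rw [Multiset.map_map, (dim_formula S hS2 (ψ (pderiv j (g - C t * X j ^ d))) (fun φ _ => (hMo φ t).1)).2]
    congr 1
    refine Multiset.map_congr rfl fun φ _ => (hMo φ t).2
  · rw [Multiset.map_map, (dim_formula S hS2 (ψ (C (d:ℂ) * g - X j * pderiv j g)) (fun φ _ => (hAo φ).1)).2]
    congr 1
    refine Multiset.map_congr rfl fun φ _ => (hAo φ).2
end LocalAbs
end

open MvPolynomial Filter CategoryTheory Limits Topology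
noncomputable section
section LocalPS
set_option linter.unusedSectionVars false
open IsLocalRing

variable {σ : Type} [Fintype σ] [DecidableEq σ]

/-- dimension of power series ring modulo an ideal of polynomials -/
def psDim (J : Ideal (MvPolynomial σ ℂ)) : ℕ :=
  Module.finrank ℂ (MvPowerSeries σ ℂ ⧸ J.map (cps (σ := σ) (k := ℂ)))

/-- the quotient as an algebra map -/
def psi0 (J : Ideal (MvPolynomial σ ℂ)) : MvPolynomial σ ℂ →ₐ[ℂ] (MvPowerSeries σ ℂ ⧸ J.map (cps (σ := σ) (k := ℂ))) :=
  (Ideal.Quotient.mkₐ ℂ _).comp (coeToMvPowerSeries.algHom ℂ)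

lemma psi0_apply (J : Ideal (MvPolynomial σ ℂ)) (f) : psi0 J f = Ideal.Quotient.mk _ (cps f) := by
  have : (coeToMvPowerSeries.algHom ℂ f : MvPowerSeries σ ℂ) = cps f := by
    simp [coeToMvPowerSeries.algHom_apply]
  change Ideal.Quotient.mk _ (coeToMvPowerSeries.algHom ℂ f) = _
  rw [this]

lemma span_psi0 (J : Ideal (MvPolynomial σ ℂ)) (f : MvPolynomial σ ℂ) :
    Ideal.span {psi0 J f} = (Ideal.span {(cps f : MvPowerSeries σ ℂ)}).map
      (Ideal.Quotient.mkₐ ℂ (J.map (cps (σ := σ) (k := ℂ)))) := by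
  rw [Ideal.map_span, Set.image_singleton, psi0_apply]; rfl

lemma finrank_psi0 (J : Ideal (MvPolynomial σ ℂ)) (f : MvPolynomial σ ℂ) :
    Module.finrank ℂ ((MvPowerSeries σ ℂ ⧸ J.map (cps (σ := σ) (k := ℂ))) ⧸ Ideal.span {psi0 J f}) =
      psDim (J ⊔ Ideal.span {f}) := by
  unfold psDim
  let I := J.map (cps (σ := σ) (k := ℂ))
  have e1 : Ideal.span {psi0 J f} = (Ideal.span {(cps f : MvPowerSeries σ ℂ)}).map (Ideal.Quotient.mkₐ ℂ I) := by
    rw [Ideal.map_span, Set.image_singleton, psi0_apply]; rfl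
  have e2 : (J ⊔ Ideal.span {f}).map (cps (σ := σ) (k := ℂ)) = I ⊔ Ideal.span {cps f} := by
    rw [Ideal.map_sup, Ideal.map_span, Set.image_singleton]
  rw [e1, e2]
  exact (DoubleQuot.quotQuotEquivQuotSupₐ ℂ I (Ideal.span {cps f})).toLinearEquiv.finrank_eq

lemma pow_le_of_primes (J : Ideal (MvPowerSeries σ ℂ))
    (h : ∀ Q : Ideal (MvPowerSeries σ ℂ), Q.IsPrime → J ≤ Q → Q = maximalIdeal _) :
    ∃ N, maximalIdeal (MvPowerSeries σ ℂ) ^ N ≤ J := by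
  apply Ideal.exists_pow_le_of_le_radical_of_fg
  · rw [Ideal.radical_eq_sInf]
    refine le_sInf fun Q hQ => ?_
    rw [h Q hQ.2 hQ.1]
  · exact (isNoetherianRing_iff_ideal_fg _).mp inferInstance _

theorem local_ps (j : σ) (g : MvPolynomial σ ℂ) (d : ℕ) (hd : 1 ≤ d)
    (hg : constantCoeff g = 0)
    (hgi : ∀ i, i ≠ j → constantCoeff (pderiv i g) = 0)
    (hprim : ∀ Q : Ideal (MvPowerSeries σ ℂ), Q.IsPrime → (∀ i, i ≠ j → cps (pderiv i g) ∈ Q) →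
      cps (X j) ∈ Q → Q = maximalIdeal _)
    (hb : ∀ χ : MvPolynomial σ ℂ →+* HQ, (∀ c, χ (C c) = HahnSeries.C c) → χ (X j) = tt →
      ∀ t : ℂ, χ (g - C t * X j ^ d) = 0 → (∀ i, χ (pderiv i (g - C t * X j ^ d)) = 0) → False) :
    let J : Ideal (MvPolynomial σ ℂ) := Ideal.span ((fun i => pderiv i g) '' {i | i ≠ j})
    let μ : ℂ → ℕ := fun t => psDim (J ⊔ Ideal.span {pderiv j (g - C t * X j ^ d)})
    psDim (J ⊔ Ideal.span {C (d:ℂ) * g - X j * pderiv j g}) =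
      psDim (J ⊔ Ideal.span {X j}) + sInf (Set.range μ) +
        ∑ᶠ t, (μ t - sInf (Set.range μ)) := by
  intro J μ
  let I := J.map (cps (σ := σ) (k := ℂ))
  let bs : List (MvPowerSeries σ ℂ) := (Finset.univ.erase j).toList.map (fun i => cps (pderiv i g))
  have hbs : Ideal.ofList bs = I := by
    simp only [I, J]
    rw [Ideal.map_span, Ideal.ofList]
    congr 1
    ext x
    simp [bs]
  have hIle : ∀ Q : Ideal (MvPowerSeries σ ℂ), I ⊔ Ideal.span {cps (X j)} ≤ Q →
      (∀ i, i ≠ j → cps (pderiv i g) ∈ Q) ∧ cps (X j) ∈ Q := by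
    intro Q hQ
    constructor
    · intro i hi
      apply hQ
      apply Ideal.mem_sup_left
      apply Ideal.mem_map_of_mem
      exact Ideal.subset_span ⟨i, hi, rfl⟩
    · exact hQ (Ideal.mem_sup_right (Ideal.mem_span_singleton_self _))
  have hwr : RingTheory.Sequence.IsWeaklyRegular (MvPowerSeries σ ℂ) (bs ++ [cps (X j)]) := by
    apply ps_cm
    · have : 0 < Fintype.card σ := Fintype.card_pos_iff.mpr ⟨j⟩
      simp [bs, Finset.card_erase_of_mem]
      omega
    · intro b hb'
      rw [List.mem_append] at hb'
      rcases hb' with hb' | hb'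
      · simp only [bs, List.mem_map, Finset.mem_toList, Finset.mem_erase] at hb'
        obtain ⟨i, ⟨hi, -⟩, rfl⟩ := hb'
        have := hgi i hi
        rw [coeToMvPowerSeries.ringHom_apply]
        rw [← MvPowerSeries.coeff_zero_eq_constantCoeff_apply, MvPolynomial.coeff_coe]
        exact this
      · simp at hb'
        subst hb'
        simp
    · intro Q hQ hle
      rw [Ideal.ofList_append, hbs, Ideal.ofList_singleton] at hle
      obtain ⟨h1, h2⟩ := hIle Q hle
      exact hprim Q hQ h1 h2
  have hreg : IsSMulRegular (MvPowerSeries σ ℂ ⧸ I) (cps (X j) : MvPowerSeries σ ℂ) := by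
    have := ((cm_append bs (cps (X j))).mp hwr).2
    rwa [hbs] at this
  obtain ⟨N, hN⟩ := pow_le_of_primes (I ⊔ Ideal.span {cps (X j)}) (fun Q hQ hle => by
    obtain ⟨h1, h2⟩ := hIle Q hle
    exact hprim Q hQ h1 h2)
  have hIsup : I ⊔ Ideal.span {cps (X j)} = (J ⊔ Ideal.span {X j}).map (cps (σ := σ) (k := ℂ)) := by
    rw [Ideal.map_sup, Ideal.map_span (cps) {X j}, Set.image_singleton]
  -- finiteness
  have hfin0 : Module.Finite ℂ (MvPowerSeries σ ℂ ⧸ (I ⊔ Ideal.span {cps (X j)})) := by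
    have h1 := tauEquiv (J ⊔ Ideal.span {X j}) N
    rw [← hIsup, sup_eq_left.mpr hN] at h1
    have : Module.Finite ℂ (MvPolynomial σ ℂ ⧸ (J ⊔ Ideal.span {X j}) ⊔ idealOfVars σ ℂ ^ N) := by
      apply finite_quot_of_pow_le 0 _ N
      rw [ptI_zero]
      exact le_sup_right
    exact Module.Finite.equiv h1.symm.toLinearEquiv
  have hIm : I ≤ maximalIdeal (MvPowerSeries σ ℂ) := by
    rw [← hbs, Ideal.ofList, Ideal.span_le]
    intro x hx
    simp only [bs, List.mem_map, Finset.mem_toList, Finset.mem_erase, Set.mem_ofPred_eq] at hx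
    obtain ⟨i, ⟨hi, -⟩, rfl⟩ := hx
    rw [SetLike.mem_coe, ps_maximalIdeal_mem, coeToMvPowerSeries.ringHom_apply,
      ← MvPowerSeries.coeff_zero_eq_constantCoeff_apply, MvPolynomial.coeff_coe]
    exact hgi i hi
  have hItop : I ≠ ⊤ := by
    intro h
    have h1 := hIm
    rw [h] at h1
    exact (maximalIdeal.isMaximal _).ne_top (top_le_iff.mp h1)
  let B := MvPowerSeries σ ℂ ⧸ I
  have hnt : Nontrivial B := Ideal.Quotient.nontrivial_iff.mpr hItop
  have hloc : IsLocalRing B := IsLocalRing.of_surjective' (Ideal.Quotient.mk I) Ideal.Quotient.mk_surjective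
  let hs := PowerSeries.HasSubst.X (S := ℂ) j
  let ρ : PowerSeries ℂ →ₐ[ℂ] B := (Ideal.Quotient.mkₐ ℂ I).comp (PowerSeries.substAlgHom (R := ℂ) hs)
  let alg : Algebra (PowerSeries ℂ) B := ρ.toRingHom.toAlgebra
  have htow : IsScalarTower ℂ (PowerSeries ℂ) B := IsScalarTower.of_algebraMap_eq (fun c => (ρ.commutes c).symm)
  have hz : algebraMap (PowerSeries ℂ) B PowerSeries.X = psi0 J (X j) := by
    rw [psi0_apply]
    change Ideal.Quotient.mk I (PowerSeries.substAlgHom (R := ℂ) hs PowerSeries.X) = _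
    rw [PowerSeries.substAlgHom_X]
    simp [I]
  have hzX : algebraMap (PowerSeries ℂ) B PowerSeries.X = Ideal.Quotient.mk I (cps (X j)) := by
    rw [hz, psi0_apply]
  obtain ⟨hF1, hF2⟩ := finite_free (B := B) (by
      rw [hzX]
      have : cps (X j : MvPolynomial σ ℂ) ∈ maximalIdeal (MvPowerSeries σ ℂ) := by
        rw [ps_maximalIdeal_mem]; simp
      rw [mem_maximalIdeal, mem_nonunits_iff]
      intro hu
      obtain ⟨b, hb1⟩ := hu.exists_right_inv
      obtain ⟨b, rfl⟩ := Ideal.Quotient.mk_surjective b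
      have h2 : cps (X j) * b - 1 ∈ I := by
        rw [← Ideal.Quotient.eq_zero_iff_mem, map_sub, map_mul, hb1, map_one, sub_self]
      have h3 := Ideal.sub_mem _ (Ideal.mul_mem_right b _ this) (hIm h2)
      rw [sub_sub_cancel] at h3
      exact (maximalIdeal.isMaximal _).ne_top ((Ideal.eq_top_iff_one _).mpr h3))
    (by
      intro b hb'
      obtain ⟨b, rfl⟩ := Ideal.Quotient.mk_surjective b
      apply hreg
      refine Eq.trans ?_ (smul_zero _).symm
      rw [← hb', hzX]
      rfl)
    (by
      rw [hz]
      have e1 : Ideal.span {psi0 J (X j)} = (Ideal.span {(cps (X j) : MvPowerSeries σ ℂ)}).map (Ideal.Quotient.mkₐ ℂ I) := by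
        exact span_psi0 J (X j)
      rw [e1]
      exact Module.Finite.equiv (DoubleQuot.quotQuotEquivQuotSupₐ ℂ I (Ideal.span {cps (X j)})).symm.toLinearEquiv)
  have key := local_abs (B := B) (psi0 J) j g d hz.symm (fun i hi => by
      rw [psi0_apply, Ideal.Quotient.eq_zero_iff_mem]
      apply Ideal.mem_map_of_mem
      exact Ideal.subset_span ⟨i, hi, rfl⟩) (fun i => by
      refine ⟨N, ?_⟩
      have h1 : (cps (X i) : MvPowerSeries σ ℂ) ^ N ∈ I ⊔ Ideal.span {cps (X j)} := by
        apply hN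
        apply Ideal.pow_mem_pow
        rw [ps_maximalIdeal_mem]; simp
      rw [Submodule.mem_sup] at h1
      obtain ⟨a, ha, b, hb', hab⟩ := h1
      rw [psi0_apply, psi0_apply, ← map_pow, ← hab, map_add, Ideal.Quotient.eq_zero_iff_mem.mpr ha, zero_add]
      rw [Ideal.mem_span_singleton] at hb' ⊢
      exact map_dvd _ hb') hd hg hb
  simp only [B, I] at key
  simp only [finrank_psi0] at key
  exact key
end LocalPS
end

open MvPolynomial Filter CategoryTheory Limits Topology
noncomputable section
section DerivLemma

lemma lift_rh {K κ E : Type} [Field K] [Field κ] [CommRing E] [CharZero K] [Algebra ℂ K] [Algebra ℂ κ]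
    [Algebra.EssFiniteType ℂ κ]
    (i : K →+* κ) (hi : i.comp (algebraMap ℂ K) = algebraMap ℂ κ)
    (e : K →+* E) (g : E →+* κ) (hg : g.comp e = i)
    (hs : Function.Surjective g) (hn : IsNilpotent (RingHom.ker g)) :
    ∃ s : κ →+* E, g.comp s = RingHom.id κ ∧ s.comp i = e := by
  let a1 : Algebra K κ := i.toAlgebra
  let a2 : Algebra K E := e.toAlgebra
  have ht : IsScalarTower ℂ K κ := IsScalarTower.of_algebraMap_eq (fun c => (RingHom.congr_fun hi c).symm)
  have : Algebra.EssFiniteType K κ := Algebra.EssFiniteType.of_comp ℂ K κ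
  let g' : E →ₐ[K] κ := { g with commutes' := fun k => RingHom.congr_fun hg k }
  refine ⟨(Algebra.FormallySmooth.liftOfSurjective (AlgHom.id K κ) g' hs hn).toRingHom, ?_, ?_⟩
  · ext x
    exact Algebra.FormallySmooth.liftOfSurjective_apply (AlgHom.id K κ) g' hs hn x
  · ext x
    exact (Algebra.FormallySmooth.liftOfSurjective (AlgHom.id K κ) g' hs hn).commutes x

lemma exists_derivation {κ : Type} [Field κ] [Algebra ℂ κ] [Algebra.EssFiniteType ℂ κ] (x : κ)
    (hx : Transcendental ℂ x) : ∃ D : Derivation ℂ κ κ, D x = 1 := by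
  let K := FractionRing (Polynomial ℂ)
  have hinj : Function.Injective (Polynomial.aeval (R := ℂ) x) := transcendental_iff_injective.mp hx
  let i : K →+* κ := IsFractionRing.lift (K := K) (g := (Polynomial.aeval (R := ℂ) x).toRingHom) hinj
  let ep : Polynomial ℂ →ₐ[ℂ] DualNumber κ := Polynomial.aeval (TrivSqZeroExt.inl x + TrivSqZeroExt.inr 1)
  have hfst : ∀ p, TrivSqZeroExt.fst (ep p) = Polynomial.aeval x p := by
    intro p
    have : (TrivSqZeroExt.fstHom ℂ κ κ).comp ep = Polynomial.aeval x := by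
      apply Polynomial.algHom_ext
      simp [ep]
    exact AlgHom.congr_fun this p
  have hunit : ∀ y : nonZeroDivisors (Polynomial ℂ), IsUnit (ep.toRingHom y) := by
    intro y
    change IsUnit (ep y)
    rw [TrivSqZeroExt.isUnit_iff_isUnit_fst, hfst, isUnit_iff_ne_zero]
    intro h
    exact nonZeroDivisors.ne_zero y.2 (hinj (by rw [h, map_zero]))
  let e : K →+* DualNumber κ := IsLocalization.lift (M := nonZeroDivisors (Polynomial ℂ)) (g := ep.toRingHom) hunit
  let g : DualNumber κ →+* κ := (TrivSqZeroExt.fstHom ℂ κ κ).toRingHom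
  have hchar : CharZero K := charZero_of_injective_algebraMap (IsFractionRing.injective (Polynomial ℂ) K)
  obtain ⟨s, hs1, hs2⟩ := lift_rh i (by
      ext c
      rw [RingHom.comp_apply, IsScalarTower.algebraMap_apply ℂ (Polynomial ℂ) K, IsFractionRing.lift_algebraMap]
      simp) e g (by
      apply IsLocalization.ringHom_ext (nonZeroDivisors (Polynomial ℂ))
      refine RingHom.ext fun p => ?_
      simp only [RingHom.comp_apply, e, i, IsLocalization.lift_eq, IsFractionRing.lift_algebraMap]
      exact hfst _) (fun y => ⟨TrivSqZeroExt.inl y, by simp [g]⟩) (by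
      refine ⟨2, ?_⟩
      rw [pow_two, Ideal.zero_eq_bot, eq_bot_iff, Ideal.mul_le]
      intro a ha b hb
      have ha' : TrivSqZeroExt.fst a = 0 := ha
      have hb' : TrivSqZeroExt.fst b = 0 := hb
      rw [Ideal.mem_bot]
      ext <;> simp [ha', hb'])
  have hs1' : ∀ y, TrivSqZeroExt.fst (s y) = y := fun y => RingHom.congr_fun hs1 y
  have hsp : ∀ p : Polynomial ℂ, s (Polynomial.aeval x p) = ep p := by
    intro p
    have h1 := RingHom.congr_fun hs2 (algebraMap _ K p)
    simp only [RingHom.comp_apply, e, i, IsLocalization.lift_eq, IsFractionRing.lift_algebraMap] at h1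
    exact h1
  have hsc : ∀ c : ℂ, s (algebraMap ℂ κ c) = algebraMap ℂ _ c := by
    intro c
    have := hsp (Polynomial.C c)
    simpa [ep] using this
  let D : κ →ₗ[ℂ] κ :=
    { toFun := fun y => TrivSqZeroExt.snd (s y)
      map_add' := by intro a b; simp
      map_smul' := by
        intro c a
        rw [Algebra.smul_def, map_mul, hsc, ← Algebra.smul_def]
        simp }
  refine ⟨Derivation.mk' D ?_, ?_⟩
  · intro a b
    change TrivSqZeroExt.snd (s (a * b)) = a • TrivSqZeroExt.snd (s b) + b • TrivSqZeroExt.snd (s a)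
    rw [map_mul, TrivSqZeroExt.snd_mul, hs1', hs1']
    simp [mul_comm]
  · change TrivSqZeroExt.snd (s x) = 1
    have := hsp Polynomial.X
    rw [Polynomial.aeval_X] at this
    rw [this]
    simp [ep]

lemma alg_const {κ : Type} [Field κ] [Algebra ℂ κ] (x : κ) (h : ¬ Transcendental ℂ x) :
    ∃ c : ℂ, algebraMap ℂ κ c = x := by
  have halg : IsAlgebraic ℂ x := by simpa [Transcendental] using h
  have hd := IsAlgClosed.degree_eq_one_of_irreducible ℂ (minpoly.irreducible halg.isIntegral)
  obtain ⟨c, hc⟩ := minpoly.mem_range_of_degree_eq_one ℂ x hd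
  exact ⟨c, hc⟩

lemma const_aux {σ : Type} [Fintype σ] {κ : Type} [Field κ] [Algebra ℂ κ] [Algebra.EssFiniteType ℂ κ]
    (v : MvPolynomial σ ℂ →ₐ[ℂ] κ)
    (q : MvPolynomial σ ℂ) (hq : ∀ i, v (pderiv i q) = 0) : ∃ c : ℂ, v (q - C c) = 0 := by
  by_cases ht : Transcendental ℂ (v q)
  · exfalso
    obtain ⟨D, hD⟩ := exists_derivation (v q) ht
    have chain : ∀ f, D (v f) = ∑ i, v (pderiv i f) * D (v (X i)) := by
      intro f
      classical
      induction f using MvPolynomial.induction_on with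
      | C c =>
        rw [← MvPolynomial.algebraMap_eq, AlgHom.commutes, Derivation.map_algebraMap]
        simp
      | add p q hp hq => simp only [map_add, hp, hq, add_mul, Finset.sum_add_distrib]
      | mul_X p i hp =>
        rw [map_mul, Derivation.leibniz, hp]
        simp only [pderiv_mul, map_add, map_mul, add_mul, Finset.sum_add_distrib, pderiv_X, smul_eq_mul]
        rw [Finset.mul_sum, add_comm]
        congr 1
        · refine Finset.sum_congr rfl fun k _ => by ring
        · rw [Finset.sum_eq_single i]
          · simp
          · intro b _ hb; rw [Pi.single_eq_of_ne hb.symm]; simp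
          · simp
    have h1 := chain q
    rw [hD, Finset.sum_eq_zero] at h1
    · exact one_ne_zero h1
    · intro i _
      rw [hq i, zero_mul]
  · obtain ⟨c, hc⟩ := alg_const (v q) ht
    refine ⟨c, ?_⟩
    rw [map_sub, sub_eq_zero, ← hc, ← MvPolynomial.algebraMap_eq]
    exact (v.commutes c).symm

lemma const_of_pderiv {σ : Type} [Fintype σ] (𝔮 : Ideal (MvPolynomial σ ℂ)) (h𝔮 : 𝔮.IsPrime)
    (q : MvPolynomial σ ℂ) (hq : ∀ i, pderiv i q ∈ 𝔮) : ∃ c : ℂ, q - C c ∈ 𝔮 := by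
  let A := MvPolynomial σ ℂ ⧸ 𝔮
  let κ := FractionRing A
  let v : MvPolynomial σ ℂ →ₐ[ℂ] κ := (IsScalarTower.toAlgHom ℂ A κ).comp (Ideal.Quotient.mkₐ ℂ 𝔮)
  have hv : ∀ f, v f = 0 ↔ f ∈ 𝔮 := by
    intro f
    change algebraMap A κ (Ideal.Quotient.mk 𝔮 f) = 0 ↔ _
    rw [FaithfulSMul.algebraMap_eq_zero_iff, Ideal.Quotient.eq_zero_iff_mem]
  have hess : Algebra.EssFiniteType ℂ κ := by
    have : Algebra.EssFiniteType A κ := Algebra.EssFiniteType.of_isLocalization κ (nonZeroDivisors A)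
    exact Algebra.EssFiniteType.comp ℂ A κ
  obtain ⟨c, hc⟩ := const_aux v q (fun i => (hv _).mpr (hq i))
  exact ⟨c, (hv _).mp hc⟩
end DerivLemma
end

open MvPolynomial Filter CategoryTheory Limits Topology
noncomputable section
section LocalGerm
set_option linter.unusedSectionVars false
open IsLocalRing

lemma prime_pt {σ : Type} [Fintype σ] (𝔮 : Ideal (MvPolynomial σ ℂ)) (h𝔮 : 𝔮.IsPrime)
    (S : Set (σ → ℂ)) (hS : S.Finite) (h : ∀ b, (∀ f ∈ 𝔮, eval b f = 0) → b ∈ S) :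
    ∃ b, 𝔮 = ptI b := by
  have h1 : (∏ b ∈ hS.toFinset, ptI (b : σ → ℂ)) ≤ 𝔮 := by
    have hv := MvPolynomial.vanishingIdeal_zeroLocus_eq_radical (K := ℂ) 𝔮
    rw [h𝔮.radical] at hv
    rw [← hv]
    refine le_trans Ideal.prod_le_inf ?_
    intro f hf
    rw [Submodule.mem_finsetInf] at hf
    rw [MvPolynomial.mem_vanishingIdeal_iff]
    intro x hx
    have hxS : x ∈ S := h x (fun g hg => by
      have := hx g hg
      simpa [aeval_eq_eval] using this)
    have := hf x (by simpa using hxS)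
    have h2 : eval x f = 0 := this
    simpa [aeval_eq_eval] using h2
  obtain ⟨b, hb, hle⟩ := (Ideal.IsPrime.prod_le h𝔮).1 h1
  exact ⟨b, ((inferInstance : (ptI b).IsMaximal).eq_of_le h𝔮.ne_top hle).symm⟩

lemma pderiv_tlate {σ : Type} [Fintype σ] (a : σ → ℂ) (i : σ) (f : MvPolynomial σ ℂ) :
    pderiv i (tlate a f) = tlate a (pderiv i f) := by
  classical
  induction f using MvPolynomial.induction_on with
  | C c => simp [tlate_apply]
  | add p q hp hq => simp only [map_add, hp, hq]
  | mul_X p k hp =>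
    rw [map_mul, Derivation.leibniz, hp, Derivation.leibniz, pderiv_X]
    simp only [tlate_apply, smul_eq_mul, map_add, map_mul, aeval_X, pderiv_C, pderiv_X, add_zero]
    by_cases h : i = k
    · subst h; simp
    · simp [Ne.symm h]

lemma germDim_eq_psDim {m : ℕ} (gs : Set (MvPolynomial (Fin m) ℂ)) (a : Fin m → ℂ) :
    germDim gs a = psDim (Ideal.span ((fun g => tlate a g) '' gs)) := by
  unfold germDim psDim
  rw [Ideal.map_span, Set.image_image]
  rfl

theorem local_germ {n : ℕ} (j : Fin n) (g ginf : MvPolynomial (Fin n) ℂ) (d : ℕ) (hd : 1 ≤ d)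
    (a : Fin n → ℂ) (haj : a j = 0) (hgg : g - ginf ∈ Ideal.span {(X j : MvPolynomial (Fin n) ℂ)})
    (hgj : pderiv j ginf = 0)
    (hga : eval a g = 0) (hgai : ∀ i, i ≠ j → eval a (pderiv i g) = 0)
    (hW : {b : Fin n → ℂ | b j = 0 ∧ eval b ginf = 0 ∧ ∀ i, i ≠ j → eval b (pderiv i ginf) = 0}.Finite)
    (hS : ∀ t : ℂ, {b : Fin n → ℂ | eval b (g - C t * X j ^ d) = 0 ∧
      ∀ i, eval b (pderiv i (g - C t * X j ^ d)) = 0}.Finite)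
    (μ : ℂ → ℕ) (hμ : ∀ t : ℂ, μ t = germDim (Set.range fun i => pderiv i (g - C t * X j ^ d)) a) :
    germDim ((fun i => pderiv i g) '' {i | i ≠ j} ∪ {C (d : ℂ) * g - X j * pderiv j g}) a =
      germDim ({h | ∃ i, i ≠ j ∧ h = pderiv i ginf} ∪ {X j}) a + sInf (Set.range μ) +
        ∑ᶠ t, (μ t - sInf (Set.range μ)) := by
  have htX : tlate a (X j) = X j := by simp [tlate_apply, haj]
  obtain ⟨w, hw⟩ := Ideal.mem_span_singleton'.1 hgg
  have hderiv : ∀ i, i ≠ j → pderiv i g = pderiv i ginf + pderiv i w * X j := by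
    intro i hi
    have : g = ginf + w * X j := by rw [hw]; ring
    rw [this, map_add, Derivation.leibniz, pderiv_X_of_ne hi.symm]
    simp [mul_comm]
  have hginfa : eval a ginf = 0 := by
    have : ginf = g - w * X j := by rw [hw]; ring
    rw [this]; simp [hga, haj]
  have key := local_ps j (tlate a g) d hd ?_ ?_ ?_ ?_
  · simp only [pderiv_tlate] at key
    have e0 : ∀ t : ℂ, tlate a g - C t * X j ^ d = tlate a (g - C t * X j ^ d) := by
      intro t
      rw [map_sub, map_mul, map_pow, htX]; simp [tlate_apply]
    have eμ : (fun t : ℂ => psDim (Ideal.span ((fun i => tlate a (pderiv i g)) '' {i | i ≠ j}) ⊔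
        Ideal.span {pderiv j (tlate a g - C t * X j ^ d)})) = μ := by
      funext t
      rw [hμ, germDim_eq_psDim, ← Ideal.span_union]
      congr 2
      rw [e0, pderiv_tlate]
      ext h
      simp only [Set.mem_union, Set.mem_image, Set.mem_singleton_iff, Set.mem_range, Set.mem_ofPred_eq]
      constructor
      · rintro (⟨i, hi, rfl⟩ | rfl)
        · refine ⟨_, ⟨i, rfl⟩, ?_⟩
          rw [map_sub, Derivation.leibniz, Derivation.leibniz_pow, pderiv_X_of_ne (Ne.symm hi)]
          simp
        · exact ⟨_, ⟨j, rfl⟩, rfl⟩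
      · rintro ⟨_, ⟨i, rfl⟩, rfl⟩
        by_cases hi : i = j
        · right; rw [hi]
        · left
          refine ⟨i, hi, ?_⟩
          rw [map_sub, Derivation.leibniz, Derivation.leibniz_pow, pderiv_X_of_ne (Ne.symm hi)]
          simp
    rw [eμ] at key
    rw [germDim_eq_psDim, germDim_eq_psDim]
    convert key using 2
    · rw [← Ideal.span_union, Set.image_union, Set.image_image, Set.image_singleton]
      congr 3
      rw [map_sub, map_mul, map_mul, htX]
      simp [tlate_apply]
    · congr 1
      rw [Set.image_union, Set.image_singleton, htX, Ideal.span_union]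
      congr 1
      apply le_antisymm
      · rw [sup_le_iff]
        refine ⟨?_, le_sup_right⟩
        rw [Ideal.span_le]
        rintro _ ⟨_, ⟨i, hi, rfl⟩, rfl⟩
        have h1 : pderiv i ginf = pderiv i g - pderiv i w * X j := by rw [hderiv i hi]; ring
        simp only [h1, map_sub, map_mul, htX]
        refine Ideal.sub_mem _ (Ideal.mem_sup_left (Ideal.subset_span ⟨i, hi, rfl⟩)) ?_
        exact Ideal.mul_mem_left _ _ (Ideal.mem_sup_right (Ideal.mem_span_singleton_self _))
      · rw [sup_le_iff]
        refine ⟨?_, le_sup_right⟩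
        rw [Ideal.span_le]
        rintro _ ⟨i, hi, rfl⟩
        simp only [hderiv i hi, map_add, map_mul, htX]
        refine Ideal.add_mem _ (Ideal.mem_sup_left (Ideal.subset_span ⟨_, ⟨i, hi, rfl⟩, rfl⟩)) ?_
        exact Ideal.mul_mem_left _ _ (Ideal.mem_sup_right (Ideal.mem_span_singleton_self _))
    · apply finsum_congr
      intro t
      rw [← congrFun eμ t]
  · have := eval_tlate a g 0
    rw [← MvPolynomial.eval_zero, this]; simpa using hga
  · intro i hi
    have := eval_tlate a (pderiv i g) 0
    rw [← MvPolynomial.eval_zero, pderiv_tlate, this]; simpa using hgai i hi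
  · intro Q hQ hQi hQj
    let ρ : MvPolynomial (Fin n) ℂ →+* MvPowerSeries (Fin n) ℂ :=
      (cps (σ := Fin n) (k := ℂ)).comp (tlate a : MvPolynomial (Fin n) ℂ →+* MvPolynomial (Fin n) ℂ)
    have hρ : ∀ f, ρ f = cps (tlate a f) := fun f => rfl
    let 𝔮 := Q.comap ρ
    have h𝔮 : 𝔮.IsPrime := hQ.comap ρ
    have hmem : ∀ f, f ∈ 𝔮 ↔ cps (tlate a f) ∈ Q := fun f => Iff.rfl
    have hXj : X j ∈ 𝔮 := by rw [hmem, htX]; exact hQj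
    have hder : ∀ i, pderiv i ginf ∈ 𝔮 := by
      intro i
      by_cases hi : i = j
      · rw [hi, hgj]; exact 𝔮.zero_mem
      · have h1 : pderiv i ginf = pderiv i g - pderiv i w * X j := by rw [hderiv i hi]; ring
        rw [h1]
        refine 𝔮.sub_mem ?_ (𝔮.mul_mem_left _ hXj)
        rw [hmem, ← pderiv_tlate]; exact hQi i hi
    have hle : 𝔮 ≤ ptI a := by
      intro f hf
      have h1 := IsLocalRing.le_maximalIdeal hQ.ne_top ((hmem f).1 hf)
      rw [ps_maximalIdeal_mem] at h1
      have h2 := eval_tlate a f 0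
      change eval a f = 0
      have h3 : eval a f = eval 0 (tlate a f) := by rw [h2]; simp
      rw [h3, MvPolynomial.eval_zero]
      rw [← h1]
      simp [← MvPowerSeries.coeff_zero_eq_constantCoeff_apply, MvPolynomial.coeff_coe, MvPolynomial.constantCoeff_eq]
    obtain ⟨c, hc⟩ := const_of_pderiv 𝔮 h𝔮 ginf hder
    have hc0 : c = 0 := by
      have h1 : eval a (ginf - C c) = 0 := hle hc
      simpa [hginfa] using h1
    have hg𝔮 : ginf ∈ 𝔮 := by simpa [hc0] using hc
    obtain ⟨b, hb⟩ := prime_pt 𝔮 h𝔮 _ hW (fun b hb => ⟨by simpa using hb _ hXj, hb _ hg𝔮, fun i _ => hb _ (hder i)⟩)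
    have hba : 𝔮 = ptI a := (hb ▸ (inferInstance : (ptI b).IsMaximal) : 𝔮.IsMaximal).eq_of_le
      (inferInstance : (ptI a).IsMaximal).ne_top hle
    apply le_antisymm (IsLocalRing.le_maximalIdeal hQ.ne_top)
    apply ps_le_of_X_mem
    intro i
    have h1 : X i - C (a i) ∈ 𝔮 := by rw [hba]; change eval a _ = 0; simp
    rw [hmem] at h1
    simpa [tlate_apply] using h1
  · intro χ hχC hχX t hχg hχi
    have e0 : tlate a g - C t * X j ^ d = tlate a (g - C t * X j ^ d) := by
      rw [map_sub, map_mul, map_pow, htX]; simp [tlate_apply]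
    let ρ : MvPolynomial (Fin n) ℂ →+* HQ :=
      χ.comp (tlate a : MvPolynomial (Fin n) ℂ →+* MvPolynomial (Fin n) ℂ)
    have h𝔮 : (RingHom.ker ρ).IsPrime := RingHom.ker_isPrime ρ
    have k1 : (g - C t * X j ^ d) ∈ RingHom.ker ρ := by
      change χ (tlate a _) = 0
      rw [← e0]; exact hχg
    have k2 : ∀ i, pderiv i (g - C t * X j ^ d) ∈ RingHom.ker ρ := by
      intro i
      change χ (tlate a _) = 0
      rw [← pderiv_tlate, ← e0]; exact hχi i
    obtain ⟨b, hb⟩ := prime_pt (RingHom.ker ρ) h𝔮 _ (hS t) (fun b hb => ⟨hb _ k1, fun i => hb _ (k2 i)⟩)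
    have h1 : X j - C (b j) ∈ RingHom.ker ρ := by rw [hb]; change eval b _ = 0; simp
    have h2 : χ (tlate a (X j - C (b j))) = 0 := h1
    rw [map_sub, htX] at h2
    have h3 : tlate a (C (b j)) = C (b j) := by simp [tlate_apply]
    rw [h3, map_sub, hχX, hχC, sub_eq_zero] at h2
    have h4 := tt_order
    rw [h2, HahnSeries.order_C] at h4
    exact absurd h4 (by norm_num)
end LocalGerm
end

open MvPolynomial Filter CategoryTheory Limits Topology
noncomputable section
section Concrete
set_option linter.unusedSectionVars false

lemma pderiv_aeval_single {σ τ : Type} (φ : σ → MvPolynomial τ ℂ) (v : τ) (k0 : σ)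
    (h0 : pderiv v (φ k0) = 1) (h : ∀ k, k ≠ k0 → pderiv v (φ k) = 0) (p : MvPolynomial σ ℂ) :
    pderiv v (aeval φ p) = aeval φ (pderiv k0 p) := by
  classical
  induction p using MvPolynomial.induction_on with
  | C c => simp
  | add p q hp hq => simp only [map_add, hp, hq]
  | mul_X p k hp =>
    rw [map_mul, Derivation.leibniz, hp, Derivation.leibniz, aeval_X]
    by_cases hk : k = k0
    · subst hk; simp [h0]
    · simp [h k hk, pderiv_X_of_ne hk]

lemma hom_eval_smul {σ : Type} {p : MvPolynomial σ ℂ} {m : ℕ} (hp : p.IsHomogeneous m) (c : ℂ)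
    (u : σ → ℂ) : eval (c • u) p = c ^ m * eval u p := by
  rw [eval_eq, eval_eq, Finset.mul_sum]
  refine Finset.sum_congr rfl fun e he => ?_
  have h1 : e.degree = m := by
    by_contra hne
    exact (mem_support_iff.1 he) (hp.coeff_eq_zero hne)
  rw [← h1, Finsupp.degree_apply]
  simp only [Pi.smul_apply, smul_eq_mul, mul_pow, Finset.prod_mul_distrib, Finset.prod_pow_eq_pow_sum]
  ring

lemma euler_eval {σ : Type} [Fintype σ] {p : MvPolynomial σ ℂ} {m : ℕ} (hp : p.IsHomogeneous m)
    (u : σ → ℂ) : ∑ i, u i * eval u (pderiv i p) = m * eval u p := by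
  have := congrArg (eval u) hp.sum_X_mul_pderiv
  simpa using this

lemma proj_fin {ι : Type} (Q : (ι → ℂ) → Prop) (hQ : ∀ c : ℂ, c ≠ 0 → ∀ x, Q x → Q (c • x))
    (hfin : {p : Projectivization ℂ (ι → ℂ) | Q p.rep}.Finite) (j : ι) :
    {x : ι → ℂ | x j = 1 ∧ Q x}.Finite := by
  refine Set.Finite.subset (hfin.image (fun p => (p.rep j)⁻¹ • p.rep)) ?_
  rintro x ⟨hx, hQx⟩
  have hx0 : x ≠ 0 := by rintro rfl; simp at hx
  obtain ⟨c, hc⟩ := Projectivization.exists_smul_eq_mk_rep ℂ x hx0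
  refine ⟨Projectivization.mk ℂ x hx0, ?_, ?_⟩
  · change Q _
    rw [← hc]; exact hQ _ c.ne_zero _ hQx
  · have : c • x = (c : ℂ) • x := rfl
    simp only [← hc, this]
    rw [Pi.smul_apply, hx, smul_eq_mul, mul_one, smul_smul, inv_mul_cancel₀ c.ne_zero, one_smul]

variable {n : ℕ}

/-- the `x`-homogeneous part at parameter `s`. -/
def pS (P : MvPolynomial (XS n) ℂ) (q : ℕ) (s : ℂ) : MvPolynomial (Fin n) ℂ :=
  aeval (Sum.elim X (fun _ => C s)) (xpart P q)

lemma pS_hom (P : MvPolynomial (XS n) ℂ) (q : ℕ) (s : ℂ) : (pS P q s).IsHomogeneous q := by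
  have hw : IsWeightedHomogeneous (wtx n) (xpart P q) q :=
    weightedHomogeneousComponent_isWeightedHomogeneous q P
  unfold pS
  rw [aeval_def, eval₂_eq]
  apply IsHomogeneous.sum
  intro e he
  have hq : Finsupp.weight (wtx n) e = q := by
    by_contra hne
    exact (mem_support_iff.1 he) (hw.coeff_eq_zero e hne)
  rw [← zero_add q]
  refine IsHomogeneous.mul (isHomogeneous_C _ _) ?_
  have h2 : q = ∑ v ∈ e.support, wtx n v * e v := by
    rw [← hq, Finsupp.weight_apply, Finsupp.sum]
    exact Finset.sum_congr rfl fun v _ => by rw [smul_eq_mul, mul_comm]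
  rw [h2]
  apply IsHomogeneous.prod
  rintro (i | i) _
  · exact (isHomogeneous_X ℂ i).pow _
  · exact (isHomogeneous_C _ _).pow _

lemma eval_pS (P : MvPolynomial (XS n) ℂ) (q : ℕ) (s : ℂ) (x : Fin n → ℂ) :
    eval x (pS P q s) = eval (evA x s) (xpart P q) := by
  unfold pS
  have : ((aeval x : MvPolynomial (Fin n) ℂ →ₐ[ℂ] ℂ).comp (aeval (Sum.elim X (fun _ => C s)))) =
      (aeval (evA x s) : MvPolynomial (XS n) ℂ →ₐ[ℂ] ℂ) := by
    ext v; rcases v with i | i <;> simp [evA]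
  have := DFunLike.congr_fun this (xpart P q)
  simpa [aeval_eq_eval] using this

lemma pderiv_pS (P : MvPolynomial (XS n) ℂ) (q : ℕ) (s : ℂ) (i : Fin n) :
    pderiv i (pS P q s) = aeval (Sum.elim X (fun _ => C s)) (pderiv (Sum.inl i) (xpart P q)) := by
  unfold pS
  apply pderiv_aeval_single
  · simp
  · rintro (k | k) hk
    · simp only [Sum.elim_inl]; exact pderiv_X_of_ne (fun h => hk (by rw [h]))
    · simp

lemma eval_subst (x : Fin n → ℂ) (s : ℂ) (p : MvPolynomial (XS n) ℂ) :
    eval x (aeval (Sum.elim X (fun _ => C s)) p : MvPolynomial (Fin n) ℂ) = eval (evA x s) p := by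
  have : ((aeval x : MvPolynomial (Fin n) ℂ →ₐ[ℂ] ℂ).comp (aeval (Sum.elim X (fun _ => C s)))) =
      (aeval (evA x s) : MvPolynomial (XS n) ℂ →ₐ[ℂ] ℂ) := by
    ext v; rcases v with i | i <;> simp [evA]
  have := DFunLike.congr_fun this p
  simpa [aeval_eq_eval] using this

lemma eval_pderiv_pS (P : MvPolynomial (XS n) ℂ) (q : ℕ) (s : ℂ) (x : Fin n → ℂ) (i : Fin n) :
    eval x (pderiv i (pS P q s)) = eval (evA x s) (pderiv (Sum.inl i) (xpart P q)) := by
  rw [pderiv_pS, eval_subst]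

/-- homogenization at parameter `s`. -/
def Fh (d : ℕ) (P : MvPolynomial (XS n) ℂ) (s : ℂ) : MvPolynomial (HV n) ℂ :=
  ∑ q ∈ Finset.range (d+1), X (Sum.inr ()) ^ (d-q) * rename Sum.inl (pS P q s)

lemma Fh_hom (d : ℕ) (P : MvPolynomial (XS n) ℂ) (s : ℂ) : (Fh d P s).IsHomogeneous d := by
  apply IsHomogeneous.sum
  intro q hq
  have h : d = (d - q) + q := by have := Finset.mem_range.1 hq; omega
  conv => arg 2; rw [h]
  have h1 := (isHomogeneous_X ℂ (Sum.inr () : HV n)).pow (d - q)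
  rw [one_mul] at h1
  exact h1.mul (pS_hom P q s).rename_isHomogeneous

/-- substitution from total variables to homogeneous variables. -/
def kap (s t : ℂ) : MvPolynomial (TV n) ℂ →ₐ[ℂ] MvPolynomial (HV n) ℂ :=
  aeval (Sum.elim (fun i => X (Sum.inl i)) ![X (Sum.inr ()), C s, C t])

lemma kap_FY (d : ℕ) (P : MvPolynomial (XS n) ℂ) (s t : ℂ) :
    kap s t (FY d P) = Fh d P s - C t * X (Sum.inr ()) ^ d := by
  unfold FY Fh
  rw [map_sub, map_sum]
  congr 1
  · refine Finset.sum_congr rfl fun q _ => ?_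
    rw [map_mul, map_pow]
    congr 1
    · simp [kap]
    · unfold pS
      have : (kap s t).comp (aeval (embT (n := n))) =
          ((rename Sum.inl).comp (aeval (Sum.elim X (fun _ => C s))) : MvPolynomial (XS n) ℂ →ₐ[ℂ] MvPolynomial (HV n) ℂ) := by
        ext v; rcases v with i | i <;> simp [kap, embT]
      exact DFunLike.congr_fun this (xpart P q)
  · simp [kap]

lemma eval_kap (u : HV n → ℂ) (s t : ℂ) (p : MvPolynomial (TV n) ℂ) :
    eval u (kap s t p) = eval (evT u s t) p := by
  have : ((aeval u : MvPolynomial (HV n) ℂ →ₐ[ℂ] ℂ).comp (kap s t)) =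
      (aeval (evT u s t) : MvPolynomial (TV n) ℂ →ₐ[ℂ] ℂ) := by
    ext v
    rcases v with i | i
    · simp [evT, kap]
    · fin_cases i <;> simp [evT, kap]
  have := DFunLike.congr_fun this p
  simpa [aeval_eq_eval] using this

lemma pderiv_kap_inl (s t : ℂ) (p : MvPolynomial (TV n) ℂ) (i : Fin n) :
    pderiv (Sum.inl i) (kap s t p) = kap s t (pderiv (Sum.inl i) p) := by
  unfold kap
  apply pderiv_aeval_single
  · simp
  · rintro (k | k) hk
    · simp only [Sum.elim_inl]; exact pderiv_X_of_ne (fun h => hk (by rw [Sum.inl_injective h]))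
    · fin_cases k <;> simp

lemma pderiv_kap_inr (s t : ℂ) (p : MvPolynomial (TV n) ℂ) :
    pderiv (Sum.inr ()) (kap s t p) = kap s t (pderiv (Sum.inr 0) p) := by
  unfold kap
  apply pderiv_aeval_single
  · simp
  · rintro (k | k) hk
    · simp
    · fin_cases k
      · exact absurd rfl hk
      · simp
      · simp

/-- the equation of the fiber closure. -/
def Ft (d : ℕ) (P : MvPolynomial (XS n) ℂ) (s t : ℂ) : MvPolynomial (HV n) ℂ :=
  Fh d P s - C t * X (Sum.inr ()) ^ d

lemma Ft_hom (d : ℕ) (P : MvPolynomial (XS n) ℂ) (s t : ℂ) : (Ft d P s t).IsHomogeneous d := by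
  refine (Fh_hom d P s).sub ?_
  exact isHomogeneous_C_mul_X_pow _ _ _

lemma onY_iff (d : ℕ) (P : MvPolynomial (XS n) ℂ) (u : HV n → ℂ) (s t : ℂ) :
    OnY d P u s t ↔ eval u (Ft d P s t) = 0 := by
  unfold OnY Ft; rw [← kap_FY, eval_kap]

lemma fdv_iff (d : ℕ) (P : MvPolynomial (XS n) ℂ) (u : HV n → ℂ) (s t : ℂ) :
    FiberDerivsVanish d P u s t ↔ ∀ v, eval u (pderiv v (Ft d P s t)) = 0 := by
  unfold FiberDerivsVanish Ft; rw [← kap_FY]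
  have h : (∀ b : Unit, eval u (pderiv (Sum.inr b) (kap s t (FY d P))) = 0) ↔
      eval u (pderiv (Sum.inr ()) (kap s t (FY d P))) = 0 := ⟨fun h => h (), fun h _ => h⟩
  rw [Sum.forall, h, pderiv_kap_inr, eval_kap]
  simp only [pderiv_kap_inl, eval_kap]

/-- dehomogenization in the chart `x_j = 1`. -/
def dh (j : Fin n) : MvPolynomial (HV n) ℂ →ₐ[ℂ] MvPolynomial (Fin n) ℂ :=
  aeval (Sum.elim (fun i => if i = j then 1 else X i) (fun _ => X j))

/-- chart point. -/
def ptc (j : Fin n) (b : Fin n → ℂ) : HV n → ℂ :=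
  Sum.elim (fun i => if i = j then 1 else b i) (fun _ => b j)

lemma eval_dh (j : Fin n) (b : Fin n → ℂ) (p : MvPolynomial (HV n) ℂ) :
    eval b (dh j p) = eval (ptc j b) p := by
  have : ((aeval b : MvPolynomial (Fin n) ℂ →ₐ[ℂ] ℂ).comp (dh j)) =
      (aeval (ptc j b) : MvPolynomial (HV n) ℂ →ₐ[ℂ] ℂ) := by
    ext v
    rcases v with i | i
    · by_cases h : i = j <;> simp [ptc, dh, h]
    · simp [ptc, dh]
  have := DFunLike.congr_fun this p
  simpa [aeval_eq_eval] using this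

lemma pderiv_dh_ne (j i : Fin n) (hi : i ≠ j) (p : MvPolynomial (HV n) ℂ) :
    pderiv i (dh j p) = dh j (pderiv (Sum.inl i) p) := by
  unfold dh
  apply pderiv_aeval_single
  · simp [hi]
  · rintro (k | k) hk
    · by_cases hkj : k = j
      · simp [hkj]
      · simp only [Sum.elim_inl, hkj, if_false]; exact pderiv_X_of_ne (fun h => hk (by rw [h]))
    · simp [pderiv_X_of_ne (Ne.symm hi)]

lemma pderiv_dh_self (j : Fin n) (p : MvPolynomial (HV n) ℂ) :
    pderiv j (dh j p) = dh j (pderiv (Sum.inr ()) p) := by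
  unfold dh
  apply pderiv_aeval_single
  · simp
  · rintro (k | k) hk
    · by_cases hkj : k = j
      · simp [hkj]
      · simp only [Sum.elim_inl, hkj, if_false]; exact pderiv_X_of_ne hkj
    · exact absurd rfl hk

lemma chartEq_eq (d : ℕ) (P : MvPolynomial (XS n) ℂ) (j : Fin n) (s t : ℂ) :
    chartEq d P j s t = dh j (Ft d P s t) := by
  unfold chartEq Ft
  rw [← kap_FY]
  have : (aeval (Sum.elim (fun i => if i = j then 1 else X i) ![X j, C s, C t]) :
      MvPolynomial (TV n) ℂ →ₐ[ℂ] MvPolynomial (Fin n) ℂ) = (dh j).comp (kap s t) := by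
    ext v : 1
    rcases v with i | i
    · simp [dh, kap]
    · fin_cases i <;> simp [dh, kap]
  rw [this]; rfl

lemma dh_euler (j : Fin n) {F : MvPolynomial (HV n) ℂ} {d : ℕ} (hF : F.IsHomogeneous d) :
    dh j (pderiv (Sum.inl j) F) + ∑ i ∈ Finset.univ.erase j, X i * pderiv i (dh j F) +
      X j * pderiv j (dh j F) = C (d : ℂ) * dh j F := by
  have h := congrArg (dh j) hF.sum_X_mul_pderiv
  rw [map_sum, Fintype.sum_sum_type] at h
  simp only [map_mul, Finset.univ_unique, PUnit.default_eq_unit, Finset.sum_singleton] at h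
  have h1 : dh j (X (Sum.inr () : HV n)) = X j := by simp [dh]
  have h2 : dh j (X (Sum.inl j : HV n)) = 1 := by simp [dh]
  rw [← Finset.add_sum_erase _ _ (Finset.mem_univ j), h1, h2, one_mul] at h
  rw [pderiv_dh_self]
  have h3 : ∑ i ∈ Finset.univ.erase j, X i * pderiv i (dh j F) =
      ∑ i ∈ Finset.univ.erase j, dh j (X (Sum.inl i)) * dh j (pderiv (Sum.inl i) F) := by
    refine Finset.sum_congr rfl fun i hi => ?_
    have hij := Finset.ne_of_mem_erase hi
    rw [pderiv_dh_ne j i hij]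
    simp [dh, hij]
  rw [h3, h]
  rw [map_nsmul, nsmul_eq_mul]; simp

lemma span_dh (j : Fin n) {F : MvPolynomial (HV n) ℂ} {d : ℕ} (hF : F.IsHomogeneous d) :
    Ideal.span (Set.range fun i => dh j (pderiv (Sum.inl i) F)) =
      Ideal.span ((fun i => pderiv i (dh j F)) '' {i | i ≠ j} ∪ {C (d : ℂ) * dh j F - X j * pderiv j (dh j F)}) := by
  have he := dh_euler j hF
  have he' : C (d : ℂ) * dh j F - X j * pderiv j (dh j F) = dh j (pderiv (Sum.inl j) F) + ∑ i ∈ Finset.univ.erase j, X i * pderiv i (dh j F) := by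
    rw [← he]; ring
  have he'' : dh j (pderiv (Sum.inl j) F) = (C (d : ℂ) * dh j F - X j * pderiv j (dh j F)) -
      ∑ i ∈ Finset.univ.erase j, X i * pderiv i (dh j F) := by rw [← he]; ring
  apply le_antisymm
  · rw [Ideal.span_le]
    rintro _ ⟨i, rfl⟩
    by_cases hi : i = j
    · subst hi
      simp only [he'']
      refine Ideal.sub_mem _ (Ideal.subset_span (Or.inr rfl)) (Ideal.sum_mem _ fun k hk => ?_)
      exact Ideal.mul_mem_left _ _ (Ideal.subset_span (Or.inl ⟨k, Finset.ne_of_mem_erase hk, rfl⟩))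
    · simp only [← pderiv_dh_ne j i hi]
      exact Ideal.subset_span (Or.inl ⟨i, hi, rfl⟩)
  · rw [Ideal.span_le]
    rintro _ (⟨i, hi, rfl⟩ | h)
    · simp only [pderiv_dh_ne j i hi]
      exact Ideal.subset_span ⟨i, rfl⟩
    · rw [Set.mem_singleton_iff] at h
      rw [h, he']
      refine Ideal.add_mem _ (Ideal.subset_span ⟨j, rfl⟩) (Ideal.sum_mem _ fun k hk => ?_)
      rw [pderiv_dh_ne j k (Finset.ne_of_mem_erase hk)]
      exact Ideal.mul_mem_left _ _ (Ideal.subset_span ⟨k, rfl⟩)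

lemma germDim_congr (G G' : Set (MvPolynomial (Fin n) ℂ)) (a : Fin n → ℂ)
    (h : Ideal.span G = Ideal.span G') : germDim G a = germDim G' a := by
  have key : ∀ G : Set (MvPolynomial (Fin n) ℂ), psDim (Ideal.span ((fun g => tlate a g) '' G)) =
      psDim ((Ideal.span G).map (tlate a : MvPolynomial (Fin n) ℂ →+* MvPolynomial (Fin n) ℂ)) := by
    intro G; rw [Ideal.map_span]; rfl
  rw [germDim_eq_psDim, germDim_eq_psDim, key, key, h]

lemma chartEqInf_eq (d : ℕ) (P : MvPolynomial (XS n) ℂ) (j : Fin n) (s : ℂ) :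
    chartEqInf d P j s = dh j (rename Sum.inl (pS P d s)) := by
  unfold chartEqInf dh
  rw [aeval_rename]; rfl

end Concrete
end

open MvPolynomial Filter CategoryTheory Limits Topology
noncomputable section
section Concrete2
set_option linter.unusedSectionVars false
variable {n : ℕ}

lemma pderiv_Fh (d : ℕ) (P : MvPolynomial (XS n) ℂ) (s : ℂ) (i : Fin n) :
    pderiv (Sum.inl i) (Fh d P s) =
      ∑ q ∈ Finset.range (d+1), X (Sum.inr ()) ^ (d-q) * rename Sum.inl (pderiv i (pS P q s)) := by
  unfold Fh
  rw [map_sum]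
  refine Finset.sum_congr rfl fun q _ => ?_
  rw [Derivation.leibniz, Derivation.leibniz_pow, pderiv_X_of_ne (by simp), pderiv_rename Sum.inl_injective]
  simp

lemma pderiv_inr_rename (p : MvPolynomial (Fin n) ℂ) :
    pderiv (Sum.inr () : HV n) (rename Sum.inl p) = 0 := by
  apply pderiv_eq_zero_of_notMem_vars
  intro h
  classical
  have := vars_rename (Sum.inl : Fin n → HV n) p h
  simp at this

lemma pderiv_Fh_inr (d : ℕ) (P : MvPolynomial (XS n) ℂ) (s : ℂ) :
    pderiv (Sum.inr ()) (Fh d P s) =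
      ∑ q ∈ Finset.range (d+1), C ((d-q : ℕ) : ℂ) * X (Sum.inr ()) ^ (d-q-1) * rename Sum.inl (pS P q s) := by
  unfold Fh
  rw [map_sum]
  refine Finset.sum_congr rfl fun q _ => ?_
  rw [Derivation.leibniz, Derivation.leibniz_pow, pderiv_inr_rename]
  simp; ring

lemma eval_sum_inf (d : ℕ) (x : Fin n → ℂ) (G : ℕ → MvPolynomial (Fin n) ℂ) :
    eval (Sum.elim x (fun _ => 0) : HV n → ℂ)
      (∑ q ∈ Finset.range (d+1), X (Sum.inr ()) ^ (d-q) * rename Sum.inl (G q)) = eval x (G d) := by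
  rw [map_sum, Finset.sum_range_succ, Finset.sum_eq_zero]
  · simp [eval_rename]
  · intro q hq
    have : d - q ≠ 0 := by have := Finset.mem_range.1 hq; omega
    simp [this]

lemma eval_Fh_inf (d : ℕ) (P : MvPolynomial (XS n) ℂ) (s : ℂ) (x : Fin n → ℂ) :
    eval (Sum.elim x (fun _ => 0) : HV n → ℂ) (Fh d P s) = eval x (pS P d s) := eval_sum_inf d x _

lemma eval_pderiv_Fh_inf (d : ℕ) (P : MvPolynomial (XS n) ℂ) (s : ℂ) (x : Fin n → ℂ) (i : Fin n) :
    eval (Sum.elim x (fun _ => 0) : HV n → ℂ) (pderiv (Sum.inl i) (Fh d P s)) =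
      eval (evA x s) (pderiv (Sum.inl i) (xpart P d)) := by
  rw [pderiv_Fh, eval_sum_inf d x (fun q => pderiv i (pS P q s)), eval_pderiv_pS]

lemma wcond_iff (d : ℕ) (P : MvPolynomial (XS n) ℂ) (s : ℂ) (x : Fin n → ℂ) :
    WCond d P x s ↔ ∀ i, eval x (pderiv i (pS P d s)) = 0 := by
  unfold WCond; simp only [eval_pderiv_pS]

lemma wcond_smul (d : ℕ) (P : MvPolynomial (XS n) ℂ) (s : ℂ) (c : ℂ) (x : Fin n → ℂ)
    (h : WCond d P x s) : WCond d P (c • x) s := by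
  rw [wcond_iff] at *
  intro i
  rw [hom_eval_smul (pS_hom P d s).pderiv, h i, mul_zero]

lemma wcond_zero (d : ℕ) (hd : 1 ≤ d) (P : MvPolynomial (XS n) ℂ) (s : ℂ) (x : Fin n → ℂ)
    (h : WCond d P x s) : eval x (pS P d s) = 0 := by
  rw [wcond_iff] at h
  have := euler_eval (pS_hom P d s) x
  simp only [h, mul_zero, Finset.sum_const_zero] at this
  have hd' : (d : ℂ) ≠ 0 := by exact_mod_cast (by omega : d ≠ 0)
  exact (mul_eq_zero.1 this.symm).resolve_left hd'

lemma ptc_chartPt (p : PrjInf n) :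
    ptc (jp p) (chartPt p) = Sum.elim ((p.rep (jp p))⁻¹ • p.rep) (fun _ => 0) := by
  funext v
  rcases v with i | i
  · by_cases h : i = jp p
    · simp [ptc, h, inv_mul_cancel₀ (jp_spec p)]
    · simp [ptc, h, chartPt, div_eq_inv_mul]
  · simp [ptc, chartPt]

lemma chartEq_eq' (d : ℕ) (P : MvPolynomial (XS n) ℂ) (j : Fin n) (s t : ℂ) :
    chartEq d P j s t = dh j (Fh d P s) - C t * X j ^ d := by
  rw [chartEq_eq, Ft, map_sub]; simp [dh]

theorem conc_local {d : ℕ} (hd : 2 ≤ d) (P : MvPolynomial (XS n) ℂ) (hfisi : FISIat d P 0)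
    (p : PrjInf n) (hp : p ∈ Wset d P 0) :
    germDim (Set.range fun i => dh (jp p) (pderiv (Sum.inl i) (Fh d P 0))) (chartPt p) =
      muInf d P p 0 + muGen d P p 0 + ∑ᶠ t : ℂ, lamP d P p t 0 := by
  rw [germDim_congr _ _ _ (span_dh (jp p) (Fh_hom d P 0))]
  set j := jp p with hj
  have hwx : WCond d P ((p.rep j)⁻¹ • p.rep) 0 := wcond_smul _ _ _ _ _ hp
  have hbx : ∀ b : Fin n → ℂ, b j = 0 → ptc j b = Sum.elim (fun i => if i = j then 1 else b i) (fun _ => 0) := by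
    intro b hb; funext v; rcases v with i | i <;> simp [ptc, hb]
  have hren : ∀ (b : Fin n → ℂ) (q : MvPolynomial (Fin n) ℂ),
      eval b (dh j (rename Sum.inl q)) = eval (fun i => if i = j then 1 else b i) q := by
    intro b q; rw [eval_dh, eval_rename]; rfl
  refine local_germ j (dh j (Fh d P 0)) (chartEqInf d P j 0) d (by omega) (chartPt p) ?_ ?_ ?_ ?_ ?_ ?_ ?_
    (muP d P p 0) ?_
  · simp [chartPt, hj]
  · rw [chartEqInf_eq, Fh, Finset.sum_range_succ, map_add]
    simp only [Nat.sub_self, pow_zero, one_mul, add_sub_cancel_right]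
    rw [map_sum]
    refine Ideal.sum_mem _ fun q hq => ?_
    rw [map_mul, map_pow]
    have h1 : dh j (X (Sum.inr () : HV n)) = X j := by simp [dh]
    rw [h1]
    have : d - q ≠ 0 := by have := Finset.mem_range.1 hq; omega
    exact Ideal.mul_mem_right _ _ (Ideal.pow_mem_of_mem _ (Ideal.mem_span_singleton_self _) _ (by omega))
  · rw [chartEqInf_eq, pderiv_dh_self, pderiv_inr_rename, map_zero]
  · rw [eval_dh, hj, ptc_chartPt, eval_Fh_inf]
    exact wcond_zero d (by omega) P 0 _ hwx
  · intro i hi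
    rw [pderiv_dh_ne _ _ hi, eval_dh, hj, ptc_chartPt, eval_pderiv_Fh_inf]
    exact hwx i
  · have hf := proj_fin (fun x => WCond d P x 0) (fun c _ x hx => wcond_smul d P 0 c x hx) hfisi.2.2 j
    refine Set.Finite.subset (hf.image (fun x => fun i => if i = j then 0 else x i)) ?_
    rintro b ⟨hbj, hb0, hbi⟩
    refine ⟨fun i => if i = j then 1 else b i, ⟨by simp, ?_⟩, ?_⟩
    · rw [chartEqInf_eq] at hb0 hbi
      rw [hren] at hb0
      have hne : ∀ i, i ≠ j → eval (fun i => if i = j then 1 else b i) (pderiv i (pS P d 0)) = 0 := by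
        intro i hi
        have := hbi i hi
        rwa [pderiv_dh_ne _ _ hi, pderiv_rename Sum.inl_injective, hren] at this
      rw [wcond_iff]
      intro i
      by_cases hi : i = j
      · have he := euler_eval (pS_hom P d 0) (fun i => if i = j then 1 else b i)
        rw [hb0, mul_zero, Finset.sum_eq_single j] at he
        · rw [hi]; simpa using he
        · intro k _ hk; rw [hne k hk, mul_zero]
        · simp
      · exact hne i hi
    · funext i
      by_cases hi : i = j
      · simp [hi, hbj]
      · simp [hi]
  · intro t
    have hf := proj_fin (fun u : HV n → ℂ => OnY d P u 0 t ∧ FiberDerivsVanish d P u 0 t) (fun c _ x hx => by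
      rw [onY_iff, fdv_iff] at *
      refine ⟨?_, fun v => ?_⟩
      · rw [hom_eval_smul (Ft_hom d P 0 t), hx.1, mul_zero]
      · rw [hom_eval_smul (Ft_hom d P 0 t).pderiv, hx.2 v, mul_zero]) (hfisi.2.1 t) (Sum.inl j)
    refine Set.Finite.subset (hf.image (fun u => fun i => if i = j then u (Sum.inr ()) else u (Sum.inl i))) ?_
    rintro b ⟨hb0, hbi⟩
    rw [← chartEq_eq', chartEq_eq] at hb0 hbi
    refine ⟨ptc j b, ⟨by simp [ptc], ?_⟩, ?_⟩
    · rw [onY_iff, fdv_iff]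
      rw [eval_dh] at hb0
      refine ⟨hb0, ?_⟩
      have hr : eval (ptc j b) (pderiv (Sum.inr ()) (Ft d P 0 t)) = 0 := by
        rw [← eval_dh, ← pderiv_dh_self]; exact hbi j
      have hl : ∀ i, i ≠ j → eval (ptc j b) (pderiv (Sum.inl i) (Ft d P 0 t)) = 0 := by
        intro i hi
        rw [← eval_dh, ← pderiv_dh_ne j i hi]; exact hbi i
      rintro (i | i)
      · by_cases hi : i = j
        · have he := euler_eval (Ft_hom d P 0 t) (ptc j b)
          rw [hb0, mul_zero, Finset.sum_eq_single (Sum.inl j)] at he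
          · rw [hi]; simpa [ptc] using he
          · rintro (k | k) _ hk
            · rw [hl k (fun h => hk (by rw [h])), mul_zero]
            · rw [hr, mul_zero]
          · simp
        · exact hl i hi
      · exact hr
    · funext i
      by_cases hi : i = j
      · simp [hi, ptc]
      · simp [hi, ptc]
  · intro t
    rw [← chartEq_eq']; rfl

lemma germDim_zero_of_unit (G : Set (MvPolynomial (Fin n) ℂ)) (a : Fin n → ℂ) (g) (hg : g ∈ G)
    (h : eval a g ≠ 0) : germDim G a = 0 := by
  rw [germDim_eq_psDim, psDim]
  have : (Ideal.span ((fun g => tlate a g) '' G)).map (cps (σ := Fin n) (k := ℂ)) = ⊤ := by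
    apply Ideal.eq_top_of_isUnit_mem _ (x := cps (tlate a g))
    · exact Ideal.mem_map_of_mem _ (Ideal.subset_span ⟨g, hg, rfl⟩)
    · rw [MvPowerSeries.isUnit_iff_constantCoeff]
      have h3 : eval a g = eval 0 (tlate a g) := by rw [eval_tlate]; simp
      have h4 : MvPowerSeries.constantCoeff (cps (tlate a g)) = eval a g := by
        rw [h3, MvPolynomial.eval_zero]
        simp [← MvPowerSeries.coeff_zero_eq_constantCoeff_apply, MvPolynomial.coeff_coe, MvPolynomial.constantCoeff_eq]
      rw [h4]; exact isUnit_iff_ne_zero.2 h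
  rw [this]
  have : Subsingleton (MvPowerSeries (Fin n) ℂ ⧸ (⊤ : Ideal (MvPowerSeries (Fin n) ℂ))) :=
    Ideal.Quotient.subsingleton_iff.2 rfl
  exact Module.finrank_zero_of_subsingleton

lemma lam_off {d : ℕ} (hd : 2 ≤ d) (P : MvPolynomial (XS n) ℂ)
    (p : PrjInf n) (hp : p ∈ Wset d P 0) (hs : p ∉ Sigset d P 0) (t : ℂ) : lamP d P p t 0 = 0 := by
  have : muP d P p 0 t = 0 := by
    refine germDim_zero_of_unit _ _ _ ⟨jp p, rfl⟩ ?_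
    beta_reduce
    rw [chartEq_eq, pderiv_dh_self, eval_dh, ptc_chartPt, Ft, map_sub, pderiv_Fh_inr]
    rw [Derivation.leibniz, Derivation.leibniz_pow, map_sub, map_sum]
    obtain ⟨e, rfl⟩ : ∃ e, d = e + 2 := ⟨d - 2, by omega⟩
    rw [Finset.sum_range_succ, Finset.sum_range_succ, Finset.sum_eq_zero]
    · have hne : eval p.rep (pS P (e + 1) 0) ≠ 0 := by
        intro h
        apply hs
        refine ⟨hp, ?_⟩
        rw [← eval_pS]; exact h
      have hsm := hom_eval_smul (pS_hom P (e+1) 0) ((p.rep (jp p))⁻¹) p.rep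
      have e1 : eval (Sum.elim ((p.rep (jp p))⁻¹ • p.rep) (fun _ => 0) : HV n → ℂ)
        (rename Sum.inl (pS P (e+1) 0)) = ((p.rep (jp p))⁻¹)^(e+1) * eval p.rep (pS P (e+1) 0) := by
        rw [eval_rename, ← hsm]; rfl
      have e2 : e + 2 - (e + 1) = 1 := by omega
      simp only [map_mul, e1, e2]
      simp [hne, jp_spec p]
    · intro q hq
      have : e + 2 - q - 1 ≠ 0 := by have := Finset.mem_range.1 hq; omega
      simp [this]
  simp [lamP, this]

theorem rhs_eq {d : ℕ} (hd : 2 ≤ d) (P : MvPolynomial (XS n) ℂ) (hfisi : FISIat d P 0) :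
    lamTot d P 0 + ∑ᶠ p ∈ Wset d P 0, (muGen d P p 0 + muInf d P p 0) =
      ∑ p ∈ hfisi.2.2.toFinset,
        germDim (Set.range fun i => dh (jp p) (pderiv (Sum.inl i) (Fh d P 0))) (chartPt p) := by
  classical
  have h1 : lamTot d P 0 = ∑ p ∈ hfisi.2.2.toFinset, ∑ᶠ t : ℂ, lamP d P p t 0 := by
    unfold lamTot
    have hsub : Sigset d P 0 ⊆ Wset d P 0 := fun p hp => hp.1
    have hfS : (Sigset d P 0).Finite := hfisi.2.2.subset hsub
    rw [finsum_mem_eq_finite_toFinset_sum _ hfS]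
    apply Finset.sum_subset
    · intro p hp; simp only [Set.Finite.mem_toFinset] at *; exact hsub hp
    · intro p hp hp'
      simp only [Set.Finite.mem_toFinset] at *
      simp [lam_off hd P p hp hp']
  rw [h1, finsum_mem_eq_finite_toFinset_sum _ hfisi.2.2, ← Finset.sum_add_distrib]
  refine Finset.sum_congr rfl fun p hp => ?_
  rw [conc_local hd P hfisi p (by simpa using hp)]
  ring

lemma fS_eq {d : ℕ} (P : MvPolynomial (XS n) ℂ) (s : ℂ) (h : DegXAt d P s) :
    fS P s = ∑ q ∈ Finset.range (d+1), pS P q s := by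
  have hz : ∀ q, d < q → pS P q s = 0 := by
    intro q hq
    apply MvPolynomial.funext
    intro x
    rw [eval_pS, h.1 q hq x, map_zero]
  have h1 := sum_weightedHomogeneousComponent (wtx n) P
  rw [finsum_eq_sum _ (weightedHomogeneousComponent_finsupp P)] at h1
  unfold fS
  conv_lhs => rw [← h1]
  rw [map_sum]
  set T := (weightedHomogeneousComponent_finsupp (w := wtx n) P).toFinset
  have h2 : ∀ q, q ∉ T → pS P q s = 0 := by
    intro q hq
    have : weightedHomogeneousComponent (wtx n) q P = 0 := by
      by_contra hne
      exact hq ((Set.Finite.mem_toFinset _).2 hne)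
    unfold pS xpart; rw [this, map_zero]
  change ∑ q ∈ T, pS P q s = _
  rw [← Finset.sum_subset (Finset.inter_subset_left : T ∩ Finset.range (d+1) ⊆ T),
    ← Finset.sum_subset (Finset.inter_subset_right : T ∩ Finset.range (d+1) ⊆ Finset.range (d+1))]
  · intro q hq hq'
    apply h2
    intro hT; exact hq' (Finset.mem_inter.2 ⟨hT, hq⟩)
  · intro q hq hq'
    apply hz
    by_contra hle
    exact hq' (Finset.mem_inter.2 ⟨hq, Finset.mem_range.2 (by omega)⟩)

/-- dehomogenization at `x₀ = 1`. -/
def dh0 : MvPolynomial (HV n) ℂ →ₐ[ℂ] MvPolynomial (Fin n) ℂ := aeval (Sum.elim X (fun _ => 1))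

lemma dh0_pderiv {d : ℕ} (P : MvPolynomial (XS n) ℂ) (s : ℂ) (h : DegXAt d P s) (i : Fin n) :
    dh0 (pderiv (Sum.inl i) (Fh d P s)) = pderiv i (fS P s) := by
  rw [fS_eq P s h, pderiv_Fh, map_sum, map_sum]
  refine Finset.sum_congr rfl fun q _ => ?_
  unfold dh0
  rw [map_mul, aeval_rename]
  have : (Sum.elim X (fun _ => 1) : HV n → MvPolynomial (Fin n) ℂ) ∘ Sum.inl = X := rfl
  rw [this]
  simp

lemma eval_dh0 (x : Fin n → ℂ) (p : MvPolynomial (HV n) ℂ) :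
    eval x (dh0 p) = eval (Sum.elim x (fun _ => 1) : HV n → ℂ) p := by
  have : ((aeval x : MvPolynomial (Fin n) ℂ →ₐ[ℂ] ℂ).comp dh0) =
      (aeval (Sum.elim x (fun _ => 1)) : MvPolynomial (HV n) ℂ →ₐ[ℂ] ℂ) := by
    ext v
    rcases v with i | i <;> simp [dh0]
  have := DFunLike.congr_fun this p
  simpa [aeval_eq_eval] using this

lemma critPt_iff {d : ℕ} (P : MvPolynomial (XS n) ℂ) (s : ℂ) (h : DegXAt d P s) (x : Fin n → ℂ) :
    CritPt P x s ↔ ∀ i, eval (Sum.elim x (fun _ => 1) : HV n → ℂ) (pderiv (Sum.inl i) (Fh d P s)) = 0 := by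
  have : ∀ i, pderiv i (fS P s) = aeval (Sum.elim X (fun _ => C s)) (pderiv (Sum.inl i) P) := by
    intro i
    unfold fS
    apply pderiv_aeval_single
    · simp
    · rintro (k | k) hk
      · simp only [Sum.elim_inl]; exact pderiv_X_of_ne (fun h => hk (by rw [h]))
      · simp
  unfold CritPt
  simp only [← eval_dh0, dh0_pderiv P s h, this, eval_subst]

end Concrete2
end

open MvPolynomial Filter CategoryTheory Limits Topology
noncomputable section
section Graded
set_option linter.unusedSectionVars false
open RingTheory.Sequence

variable {σ : Type*} [Fintype σ] {k : Type*} [Field k]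

lemma hcomp_mem {S : Set (MvPolynomial σ k)} (hS : ∀ h ∈ S, ∃ e, h.IsHomogeneous e)
    {f : MvPolynomial σ k} (hf : f ∈ Ideal.span S) (D : ℕ) :
    homogeneousComponent D f ∈ Ideal.span S := by
  let _ : GradedAlgebra (homogeneousSubmodule σ k) := MvPolynomial.gradedAlgebra
  refine homogeneousComponent_mem_of_mem ?_ hf D
  refine Ideal.homogeneous_span _ _ ?_
  intro h hh
  obtain ⟨e, he⟩ := hS h hh
  exact ⟨e, he⟩

lemma hcomp_mul {h b : MvPolynomial σ k} {e : ℕ} (hh : h.IsHomogeneous e) (D : ℕ) :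
    homogeneousComponent (e + D) (h * b) = h * homogeneousComponent D b := by
  conv_lhs => rw [← sum_homogeneousComponent b, Finset.mul_sum, map_sum]
  have : ∀ i ∈ Finset.range (b.totalDegree + 1),
      homogeneousComponent (e + D) (h * homogeneousComponent i b) =
      if i = D then h * homogeneousComponent D b else 0 := by
    intro i _
    have h1 : (h * homogeneousComponent i b).IsHomogeneous (e + i) :=
      hh.mul (homogeneousComponent_isHomogeneous i b)
    rw [homogeneousComponent_of_mem h1]
    by_cases hi : i = D
    · subst hi; simp
    · simp [hi]; intro h; omega
  rw [Finset.sum_congr rfl this, Finset.sum_ite_eq']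
  split_ifs with h1
  · rfl
  · rw [homogeneousComponent_eq_zero, mul_zero]
    simp at h1; omega

lemma hcomp_mul_lt {h b : MvPolynomial σ k} {e : ℕ} (hh : h.IsHomogeneous e) (D : ℕ) (hD : D < e) :
    homogeneousComponent D (h * b) = 0 := by
  conv_lhs => rw [← sum_homogeneousComponent b, Finset.mul_sum, map_sum]
  refine Finset.sum_eq_zero fun i _ => ?_
  have h1 : (h * homogeneousComponent i b).IsHomogeneous (e + i) :=
    hh.mul (homogeneousComponent_isHomogeneous i b)
  rw [homogeneousComponent_of_mem h1, if_neg (by omega)]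

/-- degree-D part of an ideal -/
def gp (I : Ideal (MvPolynomial σ k)) (D : ℕ) : Submodule k (MvPolynomial σ k) :=
  Submodule.restrictScalars k I ⊓ homogeneousSubmodule σ k D

lemma mem_gp {I : Ideal (MvPolynomial σ k)} {D : ℕ} {f : MvPolynomial σ k} :
    f ∈ gp I D ↔ f ∈ I ∧ f.IsHomogeneous D := Iff.rfl

instance homSub_finite (D : ℕ) : Module.Finite k (homogeneousSubmodule σ k D) :=
  Module.Finite.iff_fg.mpr (homogeneousSubmodule_fg _ _ D)

instance gp_finite (I : Ideal (MvPolynomial σ k)) (D : ℕ) : Module.Finite k (gp I D) :=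
  Submodule.finiteDimensional_of_le (inf_le_right : gp I D ≤ homogeneousSubmodule σ k D)

lemma hreg (L : List (MvPolynomial σ k)) (h : MvPolynomial σ k)
    (hL : ∀ g ∈ L, ∃ e, g.IsHomogeneous e)
    (hr : IsWeaklyRegular (MvPowerSeries σ k) (L.map cps ++ [cps h]))
    {f : MvPolynomial σ k} {D : ℕ} (hf : f.IsHomogeneous D) (hm : h * f ∈ Ideal.ofList L) :
    f ∈ Ideal.ofList L := by
  obtain ⟨-, h2⟩ := (cm_append _ _).mp hr
  have hmap : (Ideal.ofList L).map (cps : MvPolynomial σ k →+* MvPowerSeries σ k)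
      = Ideal.ofList (L.map cps) := Ideal.map_ofList _ _
  have h3 : cps f ∈ (Ideal.ofList L).map (cps : MvPolynomial σ k →+* MvPowerSeries σ k) := by
    rw [hmap, ← Ideal.Quotient.eq_zero_iff_mem]
    apply h2
    simp only [smul_zero]
    rw [← Ideal.Quotient.mk_eq_mk, ← Submodule.Quotient.mk_smul, smul_eq_mul]
    rw [Ideal.Quotient.mk_eq_mk, Ideal.Quotient.eq_zero_iff_mem, ← hmap, ← map_mul]
    exact Ideal.mem_map_of_mem _ hm
  have h4 := mem_of_cps_mem _ _ h3 (D + 1)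
  obtain ⟨a, ha, b, hb, hab⟩ := Submodule.mem_sup.mp h4
  have h5 : homogeneousComponent D b = 0 := by
    rw [MvPolynomial.mem_pow_idealOfVars_iff'] at hb
    refine homogeneousComponent_eq_zero' _ _ fun m hm => ?_
    intro hmD
    exact absurd (hb m (by rw [hmD]; omega)) (by simpa using hm)
  have h6 : homogeneousComponent D f = f := homogeneousComponent_eq_self hf
  rw [← h6, ← hab, map_add, h5, add_zero]
  exact hcomp_mem hL ha D

lemma gp_append (L : List (MvPolynomial σ k)) (h : MvPolynomial σ k) {e : ℕ}
    (hL : ∀ g ∈ L, ∃ e, g.IsHomogeneous e) (hh : h.IsHomogeneous e) (h0 : h ≠ 0)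
    (hr : IsWeaklyRegular (MvPowerSeries σ k) (L.map cps ++ [cps h])) (D : ℕ) :
    Module.finrank k (gp (Ideal.ofList (L ++ [h])) (e + D)) + Module.finrank k (gp (Ideal.ofList L) D)
     = Module.finrank k (gp (Ideal.ofList L) (e + D)) + Module.finrank k (homogeneousSubmodule σ k D) := by
  set m : MvPolynomial σ k →ₗ[k] MvPolynomial σ k := LinearMap.mulLeft k h with hm
  have hinj : Function.Injective m := by
    intro a b hab
    exact mul_left_cancel₀ h0 hab
  have e1 : gp (Ideal.ofList (L ++ [h])) (e + D)
      = gp (Ideal.ofList L) (e + D) ⊔ (homogeneousSubmodule σ k D).map m := by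
    apply le_antisymm
    · rintro f ⟨hf1, hf2⟩
      rw [SetLike.mem_coe, Submodule.restrictScalars_mem, Ideal.ofList_append, Ideal.ofList_singleton] at hf1
      obtain ⟨a, ha, b, hb, hab⟩ := Submodule.mem_sup.mp hf1
      obtain ⟨c, rfl⟩ := Ideal.mem_span_singleton'.mp hb
      have : f = homogeneousComponent (e + D) a + h * homogeneousComponent D c := by
        rw [← hcomp_mul hh, ← map_add, mul_comm h, hab]
        exact (homogeneousComponent_eq_self hf2).symm
      rw [this]
      refine Submodule.add_mem_sup ⟨hcomp_mem hL ha _, homogeneousComponent_mem _ _⟩ ⟨homogeneousComponent D c, homogeneousComponent_mem _ _, rfl⟩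
    · refine sup_le ?_ ?_
      · rintro f ⟨hf1, hf2⟩
        refine ⟨?_, hf2⟩
        rw [SetLike.mem_coe, Submodule.restrictScalars_mem, Ideal.ofList_append]
        exact Ideal.mem_sup_left hf1
      · rintro _ ⟨c, hc, rfl⟩
        refine ⟨?_, hh.mul hc⟩
        rw [SetLike.mem_coe, Submodule.restrictScalars_mem, Ideal.ofList_append, Ideal.ofList_singleton]
        exact Ideal.mem_sup_right (Ideal.mul_mem_right _ _ (Ideal.mem_span_singleton_self h))
  have e2 : gp (Ideal.ofList L) (e + D) ⊓ (homogeneousSubmodule σ k D).map m = (gp (Ideal.ofList L) D).map m := by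
    apply le_antisymm
    · rintro _ ⟨⟨hf1, hf2⟩, ⟨c, hc, rfl⟩⟩
      exact ⟨c, ⟨hreg L h hL hr hc hf1, hc⟩, rfl⟩
    · rintro _ ⟨c, ⟨hc1, hc2⟩, rfl⟩
      exact ⟨⟨Ideal.mul_mem_left _ _ hc1, hh.mul hc2⟩, ⟨c, hc2, rfl⟩⟩
  have e3 := Submodule.finrank_sup_add_finrank_inf_eq (gp (Ideal.ofList L) (e + D)) ((homogeneousSubmodule σ k D).map m)
  rw [← e1, e2] at e3
  have f1 := (Submodule.equivMapOfInjective m hinj (gp (Ideal.ofList L) D)).finrank_eq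
  have f2 := (Submodule.equivMapOfInjective m hinj (homogeneousSubmodule σ k D)).finrank_eq
  omega

lemma gp_append_lt (L : List (MvPolynomial σ k)) (h : MvPolynomial σ k) {e : ℕ}
    (hL : ∀ g ∈ L, ∃ e, g.IsHomogeneous e) (hh : h.IsHomogeneous e) (D : ℕ) (hD : D < e) :
    gp (Ideal.ofList (L ++ [h])) D = gp (Ideal.ofList L) D := by
  apply le_antisymm
  · rintro f ⟨hf1, hf2⟩
    refine ⟨?_, hf2⟩
    rw [SetLike.mem_coe, Submodule.restrictScalars_mem, Ideal.ofList_append, Ideal.ofList_singleton] at hf1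
    obtain ⟨a, ha, b, hb, hab⟩ := Submodule.mem_sup.mp hf1
    obtain ⟨c, rfl⟩ := Ideal.mem_span_singleton'.mp hb
    have : f = homogeneousComponent D a := by
      rw [← homogeneousComponent_eq_self hf2, ← hab, map_add, mul_comm c, hcomp_mul_lt hh D hD, add_zero]
    rw [this]
    exact hcomp_mem hL ha _
  · rintro f ⟨hf1, hf2⟩
    refine ⟨?_, hf2⟩
    rw [SetLike.mem_coe, Submodule.restrictScalars_mem, Ideal.ofList_append]
    exact Ideal.mem_sup_left hf1

variable (σ k) in
/-- Hilbert function of a regular sequence. -/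
def hphi (e : ℕ) : ℕ → ℕ → ℕ
  | 0, _ => 0
  | (m + 1), D => if D < e then hphi e m D else
      hphi e m D + Module.finrank k (homogeneousSubmodule σ k (D - e)) - hphi e m (D - e)

lemma gp_finrank (L : List (MvPolynomial σ k)) {e : ℕ} (he : 1 ≤ e)
    (hL : ∀ g ∈ L, g.IsHomogeneous e) (hr : IsWeaklyRegular (MvPowerSeries σ k) (L.map cps)) (D : ℕ) :
    Module.finrank k (gp (Ideal.ofList L) D) = hphi σ k e L.length D := by
  induction L using List.reverseRecOn generalizing D with
  | nil =>
    have : gp (Ideal.ofList ([] : List (MvPolynomial σ k))) D = ⊥ := by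
      rw [gp, Ideal.ofList_nil]
      apply le_antisymm _ bot_le
      rintro f ⟨hf, -⟩
      exact hf
    rw [this]; simp [hphi]
  | append_singleton L h ih =>
    rw [List.map_append, List.map_singleton] at hr
    have hL1 : ∀ g ∈ L, g.IsHomogeneous e := fun g hg => hL g (List.mem_append_left _ hg)
    have hL2 : ∀ g ∈ L, ∃ e, g.IsHomogeneous e := fun g hg => ⟨e, hL1 g hg⟩
    have hh : h.IsHomogeneous e := hL h (by simp)
    have ih' := ih hL1 ((cm_append _ _).mp hr).1
    rw [List.length_append, List.length_singleton, hphi]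
    split_ifs with hD
    · rw [gp_append_lt L h hL2 hh D hD, ih']
    · have h0 : h ≠ 0 := by
        rintro rfl
        have h1 : (1 : MvPolynomial σ k) ∈ Ideal.ofList L :=
          hreg L 0 hL2 hr (isHomogeneous_one _ _) (by simp)
        have h2 : Ideal.ofList L ≤ RingHom.ker (eval (0 : σ → k)) := by
          refine Ideal.span_le.mpr fun g hg => ?_
          show eval 0 g = 0
          have := (hL1 g hg).coeff_eq_zero (d := 0) (by simp; omega)
          rwa [← constantCoeff_eq, ← MvPolynomial.eval_zero] at this
        have := h2 h1
        simp [RingHom.mem_ker] at this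
      have := gp_append L h hL2 hh h0 hr (D - e)
      rw [show e + (D - e) = D by omega, ih', ih'] at this
      omega

end Graded
end

open MvPolynomial Filter CategoryTheory Limits Topology
noncomputable section
section Graded2
set_option linter.unusedSectionVars false
open RingTheory.Sequence

variable {σ : Type*} [Fintype σ] {k : Type*} [Field k]
variable {m : ℕ} (H : Fin m → MvPolynomial σ k) (l : MvPolynomial σ k)

lemma hom_eval_zero {f : MvPolynomial σ k} {e : ℕ} (he : 1 ≤ e) (hf : f.IsHomogeneous e) :
    constantCoeff f = 0 := by
  rw [constantCoeff_eq]
  exact hf.coeff_eq_zero (d := 0) (by simp; omega)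

lemma ofList_ofFn' : Ideal.ofList (List.ofFn H) = Ideal.span (Set.range H) := by
  rw [Ideal.ofList]; congr 1; ext x; simp

lemma reg_of_prim {e D0 : ℕ} (hm : m + 1 = Fintype.card σ) (he : 1 ≤ e)
    (hH : ∀ i, (H i).IsHomogeneous e) (hl : l.IsHomogeneous 1)
    (hK : idealOfVars σ k ^ D0 ≤ Ideal.span (Set.range H) ⊔ Ideal.span {l}) :
    IsWeaklyRegular (MvPowerSeries σ k) ((List.ofFn H).map cps ++ [cps l]) := by
  have hcc : ∀ f : MvPolynomial σ k, MvPowerSeries.constantCoeff (cps f) = constantCoeff f := by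
    intro f
    rw [← MvPowerSeries.coeff_zero_eq_constantCoeff_apply, constantCoeff_eq]
    exact MvPolynomial.coeff_coe f 0
  apply ps_cm
  · simp [hm]
  · intro b hb
    rw [List.mem_append, List.mem_map, List.mem_singleton] at hb
    rcases hb with ⟨a, ha, rfl⟩ | rfl
    · rw [List.mem_ofFn] at ha
      obtain ⟨i, rfl⟩ := ha
      rw [hcc, hom_eval_zero he (hH i)]
    · rw [hcc, hom_eval_zero le_rfl hl]
  · intro Q hQ hle
    apply le_antisymm (IsLocalRing.le_maximalIdeal hQ.ne_top)
    apply ps_le_of_X_mem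
    intro i
    have h1 : (X i : MvPolynomial σ k) ^ D0 ∈ Ideal.span (Set.range H) ⊔ Ideal.span {l} :=
      by
      refine hK (Ideal.pow_mem_pow ?_ _)
      exact Ideal.subset_span (Set.mem_range_self i)
    have h2 : Ideal.span (Set.range H) ⊔ Ideal.span {l} ≤ Q.comap (cps : MvPolynomial σ k →+* _) := by
      refine sup_le (Ideal.span_le.mpr ?_) (Ideal.span_le.mpr ?_)
      · rintro _ ⟨j, rfl⟩
        exact hle (Ideal.subset_span (by simp))
      · rintro _ rfl
        exact hle (Ideal.subset_span (by simp))
    have h3 := h2 h1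
    rw [Ideal.mem_comap, map_pow] at h3
    have h4 := hQ.mem_of_pow_mem _ h3
    have h5 : cps (X i : MvPolynomial σ k) = MvPowerSeries.X i := MvPolynomial.coe_X i
    rwa [h5] at h4

/-- the ideal of the affine slice -/
def sliceI : Ideal (MvPolynomial σ k) := Ideal.span (Set.range H) ⊔ Ideal.span {l - 1}

variable {H l}

lemma slice_ker {e D0 : ℕ} (hm : m + 1 = Fintype.card σ) (he : 1 ≤ e)
    (hH : ∀ i, (H i).IsHomogeneous e) (hl : l.IsHomogeneous 1)
    (hK : idealOfVars σ k ^ D0 ≤ Ideal.span (Set.range H) ⊔ Ideal.span {l})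
    {f : MvPolynomial σ k} {D : ℕ} (hf : f.IsHomogeneous D) (hfs : f ∈ sliceI H l) :
    f ∈ Ideal.span (Set.range H) := by
  have hr := reg_of_prim H l hm he hH hl hK
  have hLh : ∀ g ∈ Set.range H, ∃ e, g.IsHomogeneous e := by
    rintro _ ⟨i, rfl⟩; exact ⟨e, hH i⟩
  obtain ⟨a, ha, b, hb, hab⟩ := Submodule.mem_sup.mp hfs
  obtain ⟨c, rfl⟩ := Ideal.mem_span_singleton'.mp hb
  set J := Ideal.span (Set.range H) with hJ
  have h0 : homogeneousComponent 0 c + homogeneousComponent 0 f ∈ J := by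
    have : homogeneousComponent 0 c + homogeneousComponent 0 f = homogeneousComponent 0 a := by
      rw [← hab, map_add, mul_sub, map_sub, mul_comm c l, hcomp_mul_lt hl 0 one_pos]
      simp
    rw [this]; exact hcomp_mem hLh ha 0
  have hs : ∀ j, homogeneousComponent (j+1) c - l * homogeneousComponent j c
      + homogeneousComponent (j+1) f ∈ J := by
    intro j
    have : homogeneousComponent (j+1) c - l * homogeneousComponent j c
      + homogeneousComponent (j+1) f = homogeneousComponent (j+1) a := by
      have := hcomp_mul (b := c) hl j
      rw [← hab, map_add, mul_sub, map_sub, mul_comm c l, add_comm j 1, this, mul_one]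
      ring
    rw [this]; exact hcomp_mem hLh ha _
  have hfc : ∀ j, j ≠ D → homogeneousComponent j f = 0 := by
    intro j hj
    rw [homogeneousComponent_of_mem hf, if_neg hj]
  have hfD : homogeneousComponent D f = f := homogeneousComponent_eq_self hf
  have hlow : ∀ j, j < D → homogeneousComponent j c ∈ J := by
    intro j
    induction j with
    | zero => intro hj; simpa [hfc 0 (by omega)] using h0
    | succ j ih =>
      intro hj
      have h1 := hs j
      rw [hfc (j+1) (by omega), add_zero] at h1
      have := J.add_mem h1 (J.mul_mem_left l (ih (by omega)))
      simpa using this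
  have hD : homogeneousComponent D c + f ∈ J := by
    rcases D with _ | D
    · rwa [hfD] at h0
    · have h1 := hs D
      rw [hfD] at h1
      have := J.add_mem h1 (J.mul_mem_left l (hlow D (by omega)))
      convert this using 1; ring
  have hhigh : ∀ j, homogeneousComponent (D + j) c + l ^ j * f ∈ J := by
    intro j
    induction j with
    | zero => simpa using hD
    | succ j ih =>
      have h1 := hs (D + j)
      rw [hfc _ (by omega)] at h1
      have := J.add_mem h1 (J.mul_mem_left l ih)
      convert this using 1; ring_nf
  have hl2 := hhigh (c.totalDegree + 1)
  rw [homogeneousComponent_eq_zero _ _ (by omega), zero_add] at hl2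
  clear hhigh
  have key : ∀ t : ℕ, l ^ t * f ∈ J → f ∈ J := by
    intro t
    induction t with
    | zero => simp
    | succ t ih =>
      intro ht
      apply ih
      rw [hJ, ← ofList_ofFn'] at ht ⊢
      refine hreg (List.ofFn H) l ?_ hr ((hl.pow t).mul hf) ?_
      · intro g hg; exact hLh g (by simpa using hg)
      · convert ht using 1; ring
  exact key _ hl2

lemma homSub_le_pow {f : MvPolynomial σ k} {D D0 : ℕ} (hf : f.IsHomogeneous D) (h : D0 ≤ D) :
    f ∈ idealOfVars σ k ^ D0 := by
  rw [mem_pow_idealOfVars_iff']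
  intro x hx
  exact hf.coeff_eq_zero (by omega)

lemma slice_surj {e D0 : ℕ} (hH : ∀ i, (H i).IsHomogeneous e) (hl : l.IsHomogeneous 1)
    (hK : idealOfVars σ k ^ D0 ≤ Ideal.span (Set.range H) ⊔ Ideal.span {l})
    {D : ℕ} (hD : D0 ≤ D) (f : MvPolynomial σ k) :
    ∃ g, g.IsHomogeneous D ∧ f - g ∈ sliceI H l := by
  have hLh : ∀ g ∈ Set.range H, ∃ e, g.IsHomogeneous e := by
    rintro _ ⟨i, rfl⟩; exact ⟨e, hH i⟩
  have hl1 : l - 1 ∈ sliceI H l := Ideal.mem_sup_right (Ideal.mem_span_singleton_self _)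
  have up : ∀ t, ∀ i (f : MvPolynomial σ k), f.IsHomogeneous i →
      ∃ g, g.IsHomogeneous (i + t) ∧ f - g ∈ sliceI H l := by
    intro t
    induction t with
    | zero => intro i f hf; exact ⟨f, hf, by simp⟩
    | succ t ih =>
      intro i f hf
      obtain ⟨g, hg1, hg2⟩ := ih i f hf
      refine ⟨l * g, by rw [← add_assoc, add_comm (i + t)]; exact hl.mul hg1, ?_⟩
      have := (sliceI H l).sub_mem hg2 ((sliceI H l).mul_mem_right g hl1)
      convert this using 1; ring
  have down : ∀ t, ∀ (f : MvPolynomial σ k), f.IsHomogeneous (D + t) →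
      ∃ g, g.IsHomogeneous D ∧ f - g ∈ sliceI H l := by
    intro t
    induction t with
    | zero => intro f hf; exact ⟨f, hf, by simp⟩
    | succ t ih =>
      intro f hf
      have h1 := hK (homSub_le_pow hf (show D0 ≤ D + (t + 1) by omega))
      obtain ⟨a, ha, b, hb, hab⟩ := Submodule.mem_sup.mp h1
      obtain ⟨c, rfl⟩ := Ideal.mem_span_singleton'.mp hb
      have h2 : f = homogeneousComponent (D + (t+1)) a + l * homogeneousComponent (D + t) c := by
        rw [← hcomp_mul hl, show 1 + (D + t) = D + (t + 1) by ring, ← map_add, mul_comm l, hab]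
        exact (homogeneousComponent_eq_self hf).symm
      obtain ⟨g, hg1, hg2⟩ := ih _ (homogeneousComponent_isHomogeneous (D + t) c)
      refine ⟨g, hg1, ?_⟩
      have h3 : homogeneousComponent (D + (t+1)) a ∈ sliceI H l :=
        Ideal.mem_sup_left (hcomp_mem hLh ha _)
      have := (sliceI H l).add_mem (Ideal.add_mem _ h3 ((sliceI H l).mul_mem_right (homogeneousComponent (D + t) c) hl1)) hg2
      rw [h2]
      convert this using 1; ring
  have all : ∀ i (f : MvPolynomial σ k), f.IsHomogeneous i → ∃ g, g.IsHomogeneous D ∧ f - g ∈ sliceI H l := by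
    intro i f hf
    obtain ⟨g, hg1, hg2⟩ := up D i f hf
    rw [add_comm] at hg1
    obtain ⟨g', hg1', hg2'⟩ := down i g hg1
    refine ⟨g', hg1', ?_⟩
    have := Ideal.add_mem _ hg2 hg2'
    convert this using 1; ring
  choose g hg1 hg2 using fun i => all i (homogeneousComponent i f) (homogeneousComponent_isHomogeneous i f)
  refine ⟨∑ i ∈ Finset.range (f.totalDegree + 1), g i, IsHomogeneous.sum _ _ _ fun i _ => hg1 i, ?_⟩
  have hsum := Ideal.sum_mem (sliceI H l) (t := Finset.range (f.totalDegree + 1)) (fun i _ => hg2 i)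
  rwa [Finset.sum_sub_distrib, sum_homogeneousComponent] at hsum

/-- restriction of the quotient map to a homogeneous component -/
def sliceMap (H : Fin m → MvPolynomial σ k) (l : MvPolynomial σ k) (D : ℕ) :
    homogeneousSubmodule σ k D →ₗ[k] (MvPolynomial σ k ⧸ sliceI H l) :=
  (Ideal.Quotient.mkₐ k (sliceI H l)).toLinearMap ∘ₗ (homogeneousSubmodule σ k D).subtype

lemma sliceMap_apply (D : ℕ) (f : homogeneousSubmodule σ k D) :
    sliceMap H l D f = Ideal.Quotient.mk (sliceI H l) f.1 := rfl

lemma sliceMap_surj {e D0 : ℕ} (hH : ∀ i, (H i).IsHomogeneous e) (hl : l.IsHomogeneous 1)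
    (hK : idealOfVars σ k ^ D0 ≤ Ideal.span (Set.range H) ⊔ Ideal.span {l})
    {D : ℕ} (hD : D0 ≤ D) : Function.Surjective (sliceMap H l D) := by
  intro a
  obtain ⟨f, rfl⟩ := Ideal.Quotient.mk_surjective a
  obtain ⟨g, hg1, hg2⟩ := slice_surj hH hl hK hD f
  refine ⟨⟨g, hg1⟩, ?_⟩
  rw [sliceMap_apply]
  exact ((Ideal.Quotient.mk_eq_mk_iff_sub_mem _ _).mpr hg2).symm

lemma slice_finite {e D0 : ℕ} (hH : ∀ i, (H i).IsHomogeneous e) (hl : l.IsHomogeneous 1)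
    (hK : idealOfVars σ k ^ D0 ≤ Ideal.span (Set.range H) ⊔ Ideal.span {l}) :
    Module.Finite k (MvPolynomial σ k ⧸ sliceI H l) :=
  Module.Finite.of_surjective _ (sliceMap_surj hH hl hK le_rfl)

lemma slice_finrank {e D0 : ℕ} (hm : m + 1 = Fintype.card σ) (he : 1 ≤ e)
    (hH : ∀ i, (H i).IsHomogeneous e) (hl : l.IsHomogeneous 1)
    (hK : idealOfVars σ k ^ D0 ≤ Ideal.span (Set.range H) ⊔ Ideal.span {l})
    {D : ℕ} (hD : D0 ≤ D) :
    Module.finrank k (MvPolynomial σ k ⧸ sliceI H l) + hphi σ k e m D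
      = Module.finrank k (homogeneousSubmodule σ k D) := by
  have h1 := LinearMap.finrank_range_add_finrank_ker (sliceMap H l D)
  rw [LinearMap.range_eq_top.mpr (sliceMap_surj hH hl hK hD), finrank_top] at h1
  have hr := reg_of_prim H l hm he hH hl hK
  have h2 := gp_finrank (List.ofFn H) he (by intro g hg; rw [List.mem_ofFn] at hg; obtain ⟨i, rfl⟩ := hg; exact hH i)
    ((cm_append _ _).mp hr).1 D
  rw [List.length_ofFn, ofList_ofFn'] at h2
  rw [← h2, ← h1]
  congr 1
  have h3 : (LinearMap.ker (sliceMap H l D)).map (homogeneousSubmodule σ k D).subtype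
      = gp (Ideal.span (Set.range H)) D := by
    ext f
    rw [mem_gp]
    constructor
    · rintro ⟨⟨g, hg⟩, hg2, rfl⟩
      refine ⟨?_, hg⟩
      have : g ∈ sliceI H l := Ideal.Quotient.eq_zero_iff_mem.mp hg2
      exact slice_ker hm he hH hl hK hg this
    · rintro ⟨h3, h4⟩
      refine ⟨⟨f, h4⟩, ?_, rfl⟩
      exact Ideal.Quotient.eq_zero_iff_mem.mpr (Ideal.mem_sup_left h3)
  rw [← h3]
  exact (Submodule.equivMapOfInjective (homogeneousSubmodule σ k D).subtype (Submodule.subtype_injective _) (LinearMap.ker (sliceMap H l D))).finrank_eq.symm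

end Graded2
end

open MvPolynomial Filter CategoryTheory Limits Topology
noncomputable section
section GlobalFamily
set_option linter.unusedSectionVars false

variable {σ : Type*} [Fintype σ]

lemma lsmul_C_eq (J : Ideal (MvPolynomial σ ℂ)) (z : ℂ) :
    (Algebra.lsmul ℂ ℂ (MvPolynomial σ ℂ ⧸ J) (C z : MvPolynomial σ ℂ)) = z • LinearMap.id := by
  refine LinearMap.ext fun a => ?_
  show (C z : MvPolynomial σ ℂ) • a = z • a
  rw [← MvPolynomial.algebraMap_eq, algebraMap_smul]

set_option maxHeartbeats 1000000 in
lemma slice_cont {m r e D0 : ℕ} (hm : m + 1 = Fintype.card σ) (he : 1 ≤ e)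
    (Hk : ℕ → Fin m → MvPolynomial σ ℂ) (hHk : ∀ k i, (Hk k i).IsHomogeneous e)
    (H : ℂ → Fin m → MvPolynomial σ ℂ) (hH : ∀ s i, H s i = ∑ k ∈ Finset.range r, s ^ k • Hk k i)
    (l : MvPolynomial σ ℂ) (hl : l.IsHomogeneous 1)
    (hK : idealOfVars σ ℂ ^ D0 ≤ Ideal.span (Set.range (H 0)) ⊔ Ideal.span {l}) :
    ∃ (N : ℕ) (M : σ → ℂ → Matrix (Fin N) (Fin N) ℂ), (∀ j, ContinuousAt (M j) 0) ∧
      ∀ᶠ s in 𝓝 (0 : ℂ), (∃ D1 : ℕ, idealOfVars σ ℂ ^ D1 ≤ Ideal.span (Set.range (H s)) ⊔ Ideal.span {l}) ∧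
      Module.Finite ℂ (MvPolynomial σ ℂ ⧸ sliceI (H s) l) ∧
        Module.finrank ℂ (MvPolynomial σ ℂ ⧸ sliceI (H s) l) = N ∧
        ∀ j (c : ℂ), dact ℂ (MvPolynomial σ ℂ ⧸ sliceI (H s) l) (C c - X j) = (M j s).charpoly.eval c := by
  classical
  have hHs : ∀ s i, (H s i).IsHomogeneous e := by
    intro s i
    rw [hH]
    exact IsHomogeneous.sum _ _ _ fun k _ => (homogeneousSubmodule σ ℂ e).smul_mem _ (hHk k i)
  -- degrees
  obtain ⟨q, D, hDq, hD0⟩ : ∃ q D, e + q = D + 1 ∧ D0 ≤ D := ⟨D0 + 1, e + D0, by ring, by omega⟩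
  have hl1 : ∀ s, l - 1 ∈ sliceI (H s) l := fun s => Ideal.mem_sup_right (Ideal.mem_span_singleton_self _)
  -- basis at zero
  have hfin0 := slice_finite (hHs 0) hl hK
  set N := Module.finrank ℂ (MvPolynomial σ ℂ ⧸ sliceI (H 0) l) with hN
  let β := Module.finBasis ℂ (MvPolynomial σ ℂ ⧸ sliceI (H 0) l)
  choose b hb using fun i => sliceMap_surj (hHs 0) hl hK hD0 (β i)
  -- the decomposition at zero
  have dec0 : ∀ f : MvPolynomial σ ℂ, f.IsHomogeneous (D + 1) → ∃ (c : Fin N → ℂ) (t : Fin m → MvPolynomial σ ℂ),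
      (∀ j, (t j).IsHomogeneous q) ∧ f = (∑ i, c i • (l * (b i).1)) + ∑ j, H 0 j * t j := by
    intro f hf
    set c := fun i => β.repr (Ideal.Quotient.mk _ f) i with hc
    have hmem : f - ∑ i, c i • (l * (b i).1) ∈ sliceI (H 0) l := by
      rw [← Ideal.Quotient.eq_zero_iff_mem, map_sub, sub_eq_zero]
      conv_lhs => rw [← β.sum_repr (Ideal.Quotient.mk _ f)]
      rw [map_sum]
      refine Finset.sum_congr rfl fun i _ => ?_
      have h1 : Ideal.Quotient.mk (sliceI (H 0) l) l = 1 := by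
        rw [← sub_eq_zero, ← map_one (Ideal.Quotient.mk (sliceI (H 0) l)), ← map_sub, Ideal.Quotient.eq_zero_iff_mem]
        exact hl1 0
      have h2 : Ideal.Quotient.mk (sliceI (H 0) l) (c i • (l * (b i).1)) = c i • Ideal.Quotient.mk (sliceI (H 0) l) (l * (b i).1) := rfl
      rw [h2, map_mul, h1, one_mul, ← hb i, sliceMap_apply]
    have hhom : (f - ∑ i, c i • (l * (b i).1)).IsHomogeneous (D + 1) := by
      refine hf.sub (IsHomogeneous.sum _ _ _ fun i _ => (homogeneousSubmodule σ ℂ _).smul_mem _ ?_)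
      rw [add_comm]
      exact hl.mul (b i).2
    have h3 := slice_ker hm he (hHs 0) hl hK hhom hmem
    rw [Ideal.mem_span_range_iff_exists_fun] at h3
    obtain ⟨t, ht⟩ := h3
    refine ⟨c, fun j => homogeneousComponent q (t j), fun j => homogeneousComponent_isHomogeneous _ _, ?_⟩
    have h4 : f - ∑ i, c i • (l * (b i).1) = ∑ j, H 0 j * homogeneousComponent q (t j) := by
      rw [← homogeneousComponent_eq_self hhom, ← ht, map_sum]
      refine Finset.sum_congr rfl fun j _ => ?_
      rw [mul_comm (t j), ← hDq, hcomp_mul (hHs 0 j)]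
    rw [← h4]; ring
  let w := Module.finBasis ℂ (homogeneousSubmodule σ ℂ (D + 1))
  choose c t ht hct using fun v => dec0 (w v).1 (w v).2
  -- deformation
  let T0 : Fin (Module.finrank ℂ (homogeneousSubmodule σ ℂ (D + 1))) → homogeneousSubmodule σ ℂ (D + 1) := fun v =>
    ⟨∑ i, c v i • (l * (b i).1), IsHomogeneous.sum _ _ _ fun i _ => (homogeneousSubmodule σ ℂ _).smul_mem _ (by
      rw [add_comm]; exact hl.mul (b i).2)⟩
  let Tk : ℕ → Fin (Module.finrank ℂ (homogeneousSubmodule σ ℂ (D + 1))) → homogeneousSubmodule σ ℂ (D + 1) := fun k v =>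
    ⟨∑ j, Hk k j * t v j, IsHomogeneous.sum _ _ _ fun j _ => (by
      rw [← hDq]; exact (hHk k j).mul (ht v j))⟩
  let T : ℂ → Fin (Module.finrank ℂ (homogeneousSubmodule σ ℂ (D + 1))) → homogeneousSubmodule σ ℂ (D + 1) := fun s v =>
    T0 v + ∑ k ∈ Finset.range r, s ^ k • Tk k v
  have hT : ∀ s v, (T s v).1 = (∑ i, c v i • (l * (b i).1)) + ∑ j, H s j * t v j := by
    intro s v
    simp only [T, T0, Tk, Submodule.coe_add, Submodule.coe_sum, Submodule.coe_smul]
    congr 1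
    simp only [hH, Finset.sum_mul, Finset.smul_sum, smul_mul_assoc]
    rw [Finset.sum_comm]
  have hT0 : ∀ v, T 0 v = w v := fun v => Subtype.ext (by rw [hT, ← hct])
  let Tm : ℂ → Matrix (Fin (Module.finrank ℂ (homogeneousSubmodule σ ℂ (D + 1)))) (Fin (Module.finrank ℂ (homogeneousSubmodule σ ℂ (D + 1)))) ℂ :=
    fun s => Matrix.of fun u v => w.repr (T s v) u
  have hTm : Continuous Tm := by
    refine continuous_matrix fun u v => ?_
    simp only [Tm, T, Matrix.of_apply, map_add, map_sum, map_smul, Finsupp.add_apply, Finsupp.coe_finsetSum,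
      Finset.sum_apply, Finsupp.smul_apply, smul_eq_mul]
    fun_prop
  have hTm0 : Tm 0 = 1 := by
    ext u v
    simp only [Tm, Matrix.of_apply, hT0, Module.Basis.repr_self, Finsupp.single_apply, Matrix.one_apply, eq_comm]
  have hdet : ∀ᶠ s in 𝓝 (0 : ℂ), (Tm s).det ≠ 0 := by
    have h1 : ContinuousAt (fun s => (Tm s).det) 0 := (hTm.matrix_det).continuousAt
    exact h1.eventually_ne (by simp [hTm0])
  have hinv : ContinuousAt (fun s => (Tm s)⁻¹) 0 := by
    have h1 : ContinuousAt (fun s => (Tm s).det) 0 := (hTm.matrix_det).continuousAt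
    have h2 : (fun s => (Tm s)⁻¹) = fun s => ((Tm s).det)⁻¹ • (Tm s).adjugate := by
      funext s; rw [Matrix.inv_def, Ring.inverse_eq_inv']
    rw [h2]
    exact (h1.inv₀ (by simp [hTm0])).smul (hTm.matrix_adjugate).continuousAt
  -- decomposition for s
  have decs : ∀ s, (Tm s).det ≠ 0 → ∀ f : homogeneousSubmodule σ ℂ (D + 1),
      f.1 - ∑ i, (∑ v, ((Tm s)⁻¹.mulVec (fun u => w.repr f u)) v * c v i) • (l * (b i).1) ∈ Ideal.span (Set.range (H s)) := by
    intro s hs f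
    set y := (Tm s)⁻¹.mulVec (fun u => w.repr f u) with hy
    have h1 : f = ∑ v, y v • T s v := by
      apply w.repr.injective
      ext u
      have h2 : (Tm s).mulVec y = fun u => w.repr f u := by
        rw [hy, Matrix.mulVec_mulVec, Matrix.mul_nonsing_inv _ (isUnit_iff_ne_zero.mpr hs), Matrix.one_mulVec]
      rw [← congrFun h2 u]
      simp only [Matrix.mulVec, dotProduct, Tm, Matrix.of_apply, map_sum, map_smul, Finsupp.coe_finsetSum,
        Finset.sum_apply, Finsupp.smul_apply, smul_eq_mul]
      exact Finset.sum_congr rfl fun v _ => mul_comm _ _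
    have h3 : f.1 = ∑ v, y v • ((∑ i, c v i • (l * (b i).1)) + ∑ j, H s j * t v j) := by
      conv_lhs => rw [h1]
      simp only [Submodule.coe_sum, Submodule.coe_smul, hT]
    have h4 : f.1 - ∑ i, (∑ v, y v * c v i) • (l * (b i).1) = ∑ v, y v • ∑ j, H s j * t v j := by
      rw [h3]
      simp only [smul_add, Finset.sum_add_distrib, Finset.smul_sum, Finset.sum_smul, smul_smul]
      rw [Finset.sum_comm (f := fun v i => (y v * c v i) • (l * (b i).1))]
      ring
    rw [h4]
    refine Ideal.sum_mem _ fun v _ => ?_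
    refine Submodule.smul_of_tower_mem _ _ (Ideal.sum_mem _ fun j _ => ?_)
    exact Ideal.mul_mem_right _ _ (Ideal.subset_span ⟨j, rfl⟩)
  have hXb : ∀ j i, X j * (b i).1 ∈ homogeneousSubmodule σ ℂ (D + 1) := fun j i => by
    rw [add_comm]; exact (isHomogeneous_X ℂ j).mul (b i).2
  refine ⟨N, fun j s => Matrix.of fun i' i =>
    ∑ v, ((Tm s)⁻¹.mulVec (fun u => w.repr ⟨X j * (b i).1, hXb j i⟩ u)) v * c v i', ?_, ?_⟩
  · intro j
    refine continuousAt_pi.mpr fun i' => continuousAt_pi.mpr fun i => ?_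
    simp only [Matrix.of_apply, Matrix.mulVec, dotProduct]
    refine tendsto_finsetSum _ fun v _ => Tendsto.mul_const _ (tendsto_finsetSum _ fun u _ => Tendsto.mul_const _ ?_)
    exact (continuousAt_pi.mp (continuousAt_pi.mp hinv v) u)
  filter_upwards [hdet] with s hs
  have hKs : idealOfVars σ ℂ ^ (D + 1) ≤ Ideal.span (Set.range (H s)) ⊔ Ideal.span {l} := by
    rw [pow_idealOfVars_eq_span, Ideal.span_le]
    rintro _ ⟨x, hx, rfl⟩
    have hx' : (monomial x (1:ℂ)).IsHomogeneous (D + 1) := isHomogeneous_monomial _ hx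
    have h1 := decs s hs ⟨_, hx'⟩
    have h2 := Ideal.add_mem _ (Ideal.mem_sup_left (T := Ideal.span {l}) h1)
      (b := ∑ i, (∑ v, ((Tm s)⁻¹.mulVec (fun u => w.repr ⟨_, hx'⟩ u)) v * c v i) • (l * (b i).1))
      (Ideal.mem_sup_right (Ideal.sum_mem _ fun i _ => Submodule.smul_of_tower_mem _ _
        (Ideal.mul_mem_right _ _ (Ideal.mem_span_singleton_self l))))
    rw [sub_add_cancel] at h2
    exact h2
  have hfin := slice_finite (hHs s) hl hKs
  have hNs : Module.finrank ℂ (MvPolynomial σ ℂ ⧸ sliceI (H s) l) = N := by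
    have h1 := slice_finrank hm he (hHs s) hl hKs (D := D + 1) le_rfl
    have h2 := slice_finrank hm he (hHs 0) hl hK (D := D + 1) (by omega)
    omega
  refine ⟨⟨D + 1, hKs⟩, hfin, hNs, ?_⟩
  -- relations in the quotient
  have hmkl : Ideal.Quotient.mk (sliceI (H s) l) l = 1 := by
    rw [← sub_eq_zero, ← map_one (Ideal.Quotient.mk (sliceI (H s) l)), ← map_sub, Ideal.Quotient.eq_zero_iff_mem]
    exact hl1 s
  have rel : ∀ f : homogeneousSubmodule σ ℂ (D + 1), Ideal.Quotient.mk (sliceI (H s) l) f.1 =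
      ∑ i, (∑ v, ((Tm s)⁻¹.mulVec (fun u => w.repr f u)) v * c v i) • Ideal.Quotient.mk (sliceI (H s) l) (b i).1 := by
    intro f
    have h1 : f.1 - _ ∈ sliceI (H s) l := Ideal.mem_sup_left (decs s hs f)
    rw [← Ideal.Quotient.eq_zero_iff_mem, map_sub, sub_eq_zero] at h1
    rw [h1, map_sum]
    refine Finset.sum_congr rfl fun i _ => ?_
    have h2 : ∀ (z : ℂ) (g : MvPolynomial σ ℂ), Ideal.Quotient.mk (sliceI (H s) l) (z • g) = z • Ideal.Quotient.mk (sliceI (H s) l) g := fun _ _ => rfl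
    rw [h2, map_mul, hmkl, one_mul]
  have hspan : ⊤ ≤ Submodule.span ℂ (Set.range fun i => Ideal.Quotient.mk (sliceI (H s) l) (b i).1) := by
    rintro a -
    obtain ⟨f, rfl⟩ := sliceMap_surj (hHs s) hl hKs le_rfl a
    rw [sliceMap_apply, rel]
    exact Submodule.sum_mem _ fun i _ => Submodule.smul_mem _ _ (Submodule.subset_span ⟨i, rfl⟩)
  let B := basisOfTopLeSpanOfCardEqFinrank _ hspan (by rw [hNs, Fintype.card_fin])
  have hB : ∀ i, B i = Ideal.Quotient.mk (sliceI (H s) l) (b i).1 := fun i => by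
    simp only [B, coe_basisOfTopLeSpanOfCardEqFinrank]
  intro j z
  rw [dact, ← LinearMap.det_toMatrix B, Matrix.eval_charpoly]
  congr 1
  have hmat : LinearMap.toMatrix B B (Algebra.lsmul ℂ ℂ (MvPolynomial σ ℂ ⧸ sliceI (H s) l) (X j : MvPolynomial σ ℂ)) = Matrix.of fun i' i =>
    ∑ v, ((Tm s)⁻¹.mulVec (fun u => w.repr ⟨X j * (b i).1, hXb j i⟩ u)) v * c v i' := by
    ext i' i
    rw [LinearMap.toMatrix_apply, Matrix.of_apply, hB]
    have h1 : (Algebra.lsmul ℂ ℂ (MvPolynomial σ ℂ ⧸ sliceI (H s) l) (X j : MvPolynomial σ ℂ)) (Ideal.Quotient.mk (sliceI (H s) l) (b i).1)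
      = Ideal.Quotient.mk (sliceI (H s) l) (⟨X j * (b i).1, hXb j i⟩ : homogeneousSubmodule σ ℂ (D + 1)).1 := rfl
    rw [h1, rel]
    simp only [← hB]
    exact congrFun (B.repr_sum_self _) i'
  rw [map_sub, map_sub, hmat, lsmul_C_eq, map_smul, LinearMap.toMatrix_id, Matrix.scalar_apply, Matrix.smul_one_eq_diagonal]

end GlobalFamily
end

open MvPolynomial Filter CategoryTheory Limits Topology
noncomputable section
section ChartMult
set_option linter.unusedSectionVars false

lemma hom_aeval_mul {ι B : Type*} [CommRing B] [Algebra ℂ B] {g : MvPolynomial ι ℂ} {D : ℕ}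
    (hg : g.IsHomogeneous D) (x : ι → B) (c : B) :
    aeval (fun i => x i * c) g = aeval x g * c ^ D := by
  rw [aeval_def, aeval_def, eval₂_eq, eval₂_eq, Finset.sum_mul]
  refine Finset.sum_congr rfl fun d hd => ?_
  have h1 : d.degree = D := by
    by_contra h
    exact (mem_support_iff.mp hd) (hg.coeff_eq_zero h)
  rw [← h1, Finsupp.degree_apply]
  simp only [mul_pow, Finset.prod_mul_distrib, Finset.prod_pow_eq_pow_sum]
  ring

lemma aev_eq {ι : Type*} (v : ι → ℂ) (f : MvPolynomial ι ℂ) : aeval v f = eval v f := by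
  rw [← coe_aeval_eq_eval]; rfl

lemma unit_of_eval {τ : Type*} (a : τ → ℂ) (J : Ideal (MvPolynomial τ ℂ)) (K : ℕ) (hJ : ptI a ^ K ≤ J)
    (u : MvPolynomial τ ℂ) (hu : eval a u ≠ 0) : IsUnit (Ideal.Quotient.mk J u) := by
  have h1 : IsNilpotent (Ideal.Quotient.mk J (u - C (eval a u))) := by
    refine ⟨K, ?_⟩
    rw [← map_pow, Ideal.Quotient.eq_zero_iff_mem]
    refine hJ (Ideal.pow_mem_pow ?_ _)
    show eval a _ = 0
    simp
  have h2 : IsUnit (Ideal.Quotient.mk J (C (eval a u))) :=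
    ((isUnit_iff_ne_zero.mpr hu).map C).map _
  have h3 := h1.isUnit_add_left_of_commute h2 (Commute.all _ _)
  rwa [← map_add, add_sub_cancel] at h3

lemma pt_map {ι B : Type*} [CommRing B] [Algebra ℂ B] (φ : MvPolynomial ι ℂ →ₐ[ℂ] B) (v : ι → ℂ)
    (𝔫 : Ideal B) (K : ℕ) (hn : 𝔫 ^ K = ⊥) (h : ∀ i, φ (X i) - algebraMap ℂ B (v i) ∈ 𝔫) :
    ptI v ^ K ≤ RingHom.ker φ := by
  have h1 : ptI v ≤ 𝔫.comap φ := by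
    intro f hf
    have h2 : (Ideal.Quotient.mkₐ ℂ 𝔫).comp φ = (Algebra.ofId ℂ (B ⧸ 𝔫)).comp (aeval v) := by
      apply MvPolynomial.algHom_ext
      intro i
      simp only [AlgHom.comp_apply, aeval_X]
      have h3 := h i
      rw [← Ideal.Quotient.eq_zero_iff_mem, map_sub, sub_eq_zero] at h3
      exact h3
    have h4 := DFunLike.congr_fun h2 f
    simp only [AlgHom.comp_apply] at h4
    have h5 : aeval v f = 0 := by rw [aev_eq]; exact hf
    rw [h5, map_zero] at h4
    exact (Ideal.Quotient.eq_zero_iff_mem (I := 𝔫)).mp h4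
  intro f hf
  have h6 := Ideal.pow_right_mono h1 K hf
  have h7 := Ideal.le_comap_pow (K := 𝔫) φ K h6
  rw [hn] at h7
  exact h7

lemma chart_mult {ι τ : Type*} [Fintype ι] {m e : ℕ} (θ : ι → MvPolynomial τ ℂ) (w : ι) (ρ : τ → ι)
    (hθw : θ w = 1) (hθρ : ∀ k, θ (ρ k) = X k) (hcov : ∀ i, i = w ∨ ∃ k, i = ρ k)
    (H : Fin m → MvPolynomial ι ℂ) (hH : ∀ i, (H i).IsHomogeneous e)
    (l : MvPolynomial ι ℂ) (hl : l.IsHomogeneous 1) (v : ι → ℂ) (hlv : eval v l = 1) (hvw : v w ≠ 0)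
    (a : τ → ℂ) (ha : ∀ k, a k = v (ρ k) / v w) (K : ℕ) :
    Module.finrank ℂ (MvPolynomial ι ℂ ⧸ (sliceI H l ⊔ ptI v ^ K))
      = Module.finrank ℂ (MvPolynomial τ ℂ ⧸ (Ideal.span (Set.range fun i => aeval θ (H i)) ⊔ ptI a ^ K)) := by
  set δ : MvPolynomial ι ℂ →ₐ[ℂ] MvPolynomial τ ℂ := aeval θ with hδ
  set IA := sliceI H l ⊔ ptI v ^ K with hIA
  set IB := Ideal.span (Set.range fun i => δ (H i)) ⊔ ptI a ^ K with hIB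
  -- evaluation of θ
  have hev : ∀ i, eval a (θ i) = v i * (v w)⁻¹ := by
    intro i
    rcases hcov i with rfl | ⟨k, rfl⟩
    · rw [hθw]; simp [hvw]
    · rw [hθρ, eval_X, ha, div_eq_mul_inv]
  have hevl : eval a (δ l) = (v w)⁻¹ := by
    have h1 : eval a (δ l) = aeval (fun i => v i * (v w)⁻¹) l := by
      rw [← aev_eq]
      have : (aeval a).comp δ = (aeval (fun i => v i * (v w)⁻¹) : MvPolynomial ι ℂ →ₐ[ℂ] ℂ) := by
        apply MvPolynomial.algHom_ext
        intro i
        rw [AlgHom.comp_apply, hδ, aeval_X, aeval_X, ← hev i, aev_eq]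
      exact DFunLike.congr_fun this l
    rw [h1, hom_aeval_mul hl, aev_eq, hlv, one_mul, pow_one]
  -- units
  obtain ⟨lam, hlam⟩ : ∃ lam, Ideal.Quotient.mk IB (δ l) * lam = 1 :=
    (unit_of_eval a IB K le_sup_right (δ l) (by rw [hevl]; exact inv_ne_zero hvw)).exists_right_inv
  obtain ⟨om, hom⟩ : ∃ om, Ideal.Quotient.mk IA (X w) * om = 1 :=
    (unit_of_eval v IA K le_sup_right (X w) (by simpa using hvw)).exists_right_inv
  have hmkl : Ideal.Quotient.mk IA l = 1 := by
    rw [← sub_eq_zero, ← map_one (Ideal.Quotient.mk IA), ← map_sub, Ideal.Quotient.eq_zero_iff_mem]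
    exact Ideal.mem_sup_left (Ideal.mem_sup_right (Ideal.mem_span_singleton_self _))
  -- maps
  let φ : MvPolynomial ι ℂ →ₐ[ℂ] (MvPolynomial τ ℂ ⧸ IB) := aeval (fun i => Ideal.Quotient.mk IB (θ i) * lam)
  let ψ : MvPolynomial τ ℂ →ₐ[ℂ] (MvPolynomial ι ℂ ⧸ IA) := aeval (fun k => Ideal.Quotient.mk IA (X (ρ k)) * om)
  have hφ : ∀ {g : MvPolynomial ι ℂ} {D : ℕ}, g.IsHomogeneous D → φ g = Ideal.Quotient.mk IB (δ g) * lam ^ D := by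
    intro g D hg
    simp only [φ]
    rw [hom_aeval_mul hg]
    congr 1
    have : (aeval fun i => Ideal.Quotient.mk IB (θ i)) = (Ideal.Quotient.mkₐ ℂ IB).comp δ := by
      apply MvPolynomial.algHom_ext
      intro i
      rw [AlgHom.comp_apply, hδ, aeval_X, aeval_X]; rfl
    rw [this]; rfl
  have hψX : ∀ i, ψ (θ i) = Ideal.Quotient.mk IA (X i) * om := by
    intro i
    rcases hcov i with rfl | ⟨k, rfl⟩
    · rw [hθw, map_one, hom]
    · rw [hθρ]; simp only [ψ, aeval_X]
  have hψ : ∀ {g : MvPolynomial ι ℂ} {D : ℕ}, g.IsHomogeneous D → ψ (δ g) = Ideal.Quotient.mk IA g * om ^ D := by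
    intro g D hg
    have h1 : ψ.comp δ = aeval (fun i => Ideal.Quotient.mk IA (X i) * om) := by
      apply MvPolynomial.algHom_ext
      intro i
      rw [AlgHom.comp_apply, hδ, aeval_X, aeval_X, hψX]
    have h2 := DFunLike.congr_fun h1 g
    rw [AlgHom.comp_apply, hom_aeval_mul hg] at h2
    rw [h2]
    congr 1
    have : (aeval fun i => Ideal.Quotient.mk IA (X i)) = (Ideal.Quotient.mkₐ ℂ IA) := by
      apply MvPolynomial.algHom_ext
      intro i
      rw [aeval_X]; rfl
    rw [this]; rfl
  have hnB : (Ideal.map (Ideal.Quotient.mk IB) (ptI a)) ^ K = ⊥ := by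
    rw [← Ideal.map_pow, Ideal.map_eq_bot_iff_le_ker, Ideal.mk_ker]; exact le_sup_right
  have hnA : (Ideal.map (Ideal.Quotient.mk IA) (ptI v)) ^ K = ⊥ := by
    rw [← Ideal.map_pow, Ideal.map_eq_bot_iff_le_ker, Ideal.mk_ker]; exact le_sup_right
  have hφ0 : IA ≤ RingHom.ker φ := by
    refine sup_le (sup_le (Ideal.span_le.mpr ?_) (Ideal.span_le.mpr ?_)) ?_
    · rintro _ ⟨i, rfl⟩
      show φ (H i) = 0
      rw [hφ (hH i), Ideal.Quotient.eq_zero_iff_mem.mpr, zero_mul]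
      exact Ideal.mem_sup_left (Ideal.subset_span ⟨i, rfl⟩)
    · rintro _ rfl
      show φ (l - 1) = 0
      rw [map_sub, hφ hl, pow_one, hlam, map_one, sub_self]
    · refine pt_map φ v _ K hnB fun i => ?_
      have h1 : φ (X i) - algebraMap ℂ _ (v i) = Ideal.Quotient.mk IB (θ i - C (v i) * δ l) * lam := by
        rw [map_sub, map_mul, sub_mul, mul_assoc, hlam, mul_one]
        simp only [φ, aeval_X]
        rfl
      rw [h1]
      refine Ideal.mul_mem_right _ _ (Ideal.mem_map_of_mem _ ?_)
      show eval a _ = 0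
      rw [map_sub, map_mul, eval_C, hevl, hev, sub_self]
  have hψ0 : IB ≤ RingHom.ker ψ := by
    refine sup_le (Ideal.span_le.mpr ?_) ?_
    · rintro _ ⟨i, rfl⟩
      show ψ (δ (H i)) = 0
      rw [hψ (hH i), Ideal.Quotient.eq_zero_iff_mem.mpr, zero_mul]
      exact Ideal.mem_sup_left (Ideal.mem_sup_left (Ideal.subset_span ⟨i, rfl⟩))
    · refine pt_map ψ a _ K hnA fun k => ?_
      have h1 : ψ (X k) - algebraMap ℂ _ (a k) = Ideal.Quotient.mk IA (X (ρ k) - C (a k) * X w) * om := by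
        rw [map_sub, map_mul, sub_mul, mul_assoc, hom, mul_one]
        simp only [ψ, aeval_X]
        rfl
      rw [h1]
      refine Ideal.mul_mem_right _ _ (Ideal.mem_map_of_mem _ ?_)
      show eval v _ = 0
      rw [map_sub, map_mul, eval_C, eval_X, eval_X, ha]
      field_simp
      simp
  let Φ : (MvPolynomial ι ℂ ⧸ IA) →ₐ[ℂ] (MvPolynomial τ ℂ ⧸ IB) := Ideal.Quotient.liftₐ IA φ (fun x hx => hφ0 hx)
  let Ψ : (MvPolynomial τ ℂ ⧸ IB) →ₐ[ℂ] (MvPolynomial ι ℂ ⧸ IA) := Ideal.Quotient.liftₐ IB ψ (fun x hx => hψ0 hx)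
  have hΦ : ∀ g, Φ (Ideal.Quotient.mk IA g) = φ g := fun g => rfl
  have hΨ : ∀ g, Ψ (Ideal.Quotient.mk IB g) = ψ g := fun g => rfl
  have hΨlam : om * Ψ lam = 1 := by
    have := congrArg Ψ hlam
    rw [map_mul, map_one, hΨ, hψ hl, hmkl, one_mul, pow_one] at this
    exact this
  have hΦom : lam * Φ om = 1 := by
    have := congrArg Φ hom
    rw [map_mul, map_one, hΦ] at this
    simp only [φ, aeval_X, hθw, map_one, one_mul] at this
    exact this
  have c1 : Φ.comp Ψ = AlgHom.id ℂ _ := by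
    apply Ideal.Quotient.algHom_ext
    apply MvPolynomial.algHom_ext
    intro k
    show Φ (ψ (X k)) = Ideal.Quotient.mk IB (X k)
    simp only [ψ, aeval_X]
    rw [map_mul, hΦ]
    simp only [φ, aeval_X]
    rw [mul_assoc, hΦom, mul_one, hθρ]
  have c2 : Ψ.comp Φ = AlgHom.id ℂ _ := by
    apply Ideal.Quotient.algHom_ext
    apply MvPolynomial.algHom_ext
    intro i
    show Ψ (φ (X i)) = Ideal.Quotient.mk IA (X i)
    simp only [φ, aeval_X]
    rw [map_mul, hΨ, hψX, mul_assoc, hΨlam, mul_one]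
  exact (AlgEquiv.ofAlgHom Φ Ψ c1 c2).toLinearEquiv.finrank_eq

end ChartMult
end

open MvPolynomial Filter CategoryTheory Limits Topology
noncomputable section
section ChartInst
set_option linter.unusedSectionVars false
variable {n : ℕ}

lemma dh_mult {e : ℕ} (H : Fin n → MvPolynomial (HV n) ℂ) (hH : ∀ i, (H i).IsHomogeneous e)
    (l : MvPolynomial (HV n) ℂ) (hl : l.IsHomogeneous 1) (v : HV n → ℂ) (hlv : eval v l = 1) (p : PrjInf n)
    (c : ℂ) (hc : c ≠ 0) (hv : v = c • Sum.elim p.rep (fun _ => 0)) (N : ℕ) (hN : IsMult (sliceI H l) v N) :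
    germDim (Set.range fun i => dh (jp p) (H i)) (chartPt p) = N := by
  have hj := jp_spec p
  apply germ_of_mult
  unfold IsMult at hN ⊢
  filter_upwards [hN] with K hK
  rw [← hK]
  symm
  refine chart_mult (Sum.elim (fun i => if i = jp p then 1 else X i) (fun _ => X (jp p))) (Sum.inl (jp p))
    (fun k => if k = jp p then Sum.inr () else Sum.inl k) (by simp) ?_ ?_ H hH l hl v hlv ?_ (chartPt p) ?_ K
  · intro k
    beta_reduce
    split_ifs with h
    · subst h; simp
    · simp [h]
  · rintro (i | u)
    · by_cases h : i = jp p
      · left; rw [h]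
      · right; exact ⟨i, by simp [h]⟩
    · right; exact ⟨jp p, by simp⟩
  · rw [hv]; simp [hc, hj]
  · intro k
    beta_reduce
    unfold chartPt
    split_ifs with h
    · rw [hv]; simp
    · rw [hv]; simp only [Pi.smul_apply, Sum.elim_inl, smul_eq_mul]
      rw [mul_div_mul_left _ _ hc]

lemma dh0_mult {e : ℕ} (H : Fin n → MvPolynomial (HV n) ℂ) (hH : ∀ i, (H i).IsHomogeneous e)
    (l : MvPolynomial (HV n) ℂ) (hl : l.IsHomogeneous 1) (v : HV n → ℂ) (hlv : eval v l = 1) (a : Fin n → ℂ)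
    (c : ℂ) (hc : c ≠ 0) (hv : v = c • Sum.elim a (fun _ => 1)) (N : ℕ) (hN : IsMult (sliceI H l) v N) :
    germDim (Set.range fun i => dh0 (H i)) a = N := by
  apply germ_of_mult
  unfold IsMult at hN ⊢
  filter_upwards [hN] with K hK
  rw [← hK]
  symm
  refine chart_mult (Sum.elim X (fun _ => 1)) (Sum.inr ())
    (fun k => Sum.inl k) (by simp) ?_ ?_ H hH l hl v hlv ?_ a ?_ K
  · intro k; simp
  · rintro (i | u)
    · right; exact ⟨i, rfl⟩
    · left; rfl
  · rw [hv]; simp [hc]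
  · intro k
    rw [hv]; simp [hc]

/-- polynomial dependence on the parameter -/
lemma subst_expand (p : MvPolynomial (XS n) ℂ) : ∃ (r : ℕ) (g : ℕ → MvPolynomial (Fin n) ℂ), (∀ k, r ≤ k → g k = 0) ∧
    ∀ s : ℂ, aeval (Sum.elim X (fun _ => C s)) p = ∑ k ∈ Finset.range r, s ^ k • g k := by
  induction p using MvPolynomial.induction_on with
  | C a => 
    refine ⟨1, fun k => if k = 0 then C a else 0, ?_, ?_⟩
    · intro k hk; simp; omega
    · intro s; simp
  | add p q hp hq =>
    obtain ⟨r, g, h0, hg⟩ := hp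
    obtain ⟨r', g', h0', hg'⟩ := hq
    have ext : ∀ (r : ℕ) (g : ℕ → MvPolynomial (Fin n) ℂ) (h0 : ∀ k, r ≤ k → g k = 0) (R : ℕ) (hR : r ≤ R) (s : ℂ),
        ∑ k ∈ Finset.range r, s ^ k • g k = ∑ k ∈ Finset.range R, s ^ k • g k := by
      intro r g h0 R hR s
      refine Finset.sum_subset (Finset.range_mono hR) fun k _ hk => ?_
      rw [h0 k (by simpa using hk), smul_zero]
    refine ⟨max r r', fun k => g k + g' k, ?_, ?_⟩
    · intro k hk
      beta_reduce
      rw [h0 k (le_trans (le_max_left _ _) hk), h0' k (le_trans (le_max_right _ _) hk), add_zero]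
    · intro s
      rw [map_add, hg, hg', ext r g h0 (max r r') (le_max_left _ _), ext r' g' h0' (max r r') (le_max_right _ _),
        ← Finset.sum_add_distrib]
      exact Finset.sum_congr rfl fun k _ => (smul_add _ _ _).symm
  | mul_X p j hp =>
    obtain ⟨r, g, h0, hg⟩ := hp
    rcases j with i | u
    · refine ⟨r, fun k => g k * X i, ?_, ?_⟩
      · intro k hk; beta_reduce; rw [h0 k hk, zero_mul]
      · intro s
        rw [map_mul, hg, Finset.sum_mul]
        simp
    · refine ⟨r + 1, fun k => if k = 0 then 0 else g (k - 1), ?_, ?_⟩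
      · intro k hk
        beta_reduce
        rw [if_neg (by omega), h0 _ (by omega)]
      · intro s
        rw [map_mul, hg, Finset.sum_range_succ', Finset.sum_mul]
        simp only [aeval_X, Sum.elim_inr, if_pos, smul_zero, add_zero, Nat.add_eq_zero_iff, one_ne_zero, and_false,
          if_false, Nat.add_sub_cancel]
        refine Finset.sum_congr rfl fun k _ => ?_
        rw [pow_succ, smul_mul_assoc, mul_comm (g k), C_mul', smul_smul]

lemma H_expand (d : ℕ) (P : MvPolynomial (XS n) ℂ) : ∃ (r : ℕ) (Hk : ℕ → Fin n → MvPolynomial (HV n) ℂ),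
    (∀ k i, (Hk k i).IsHomogeneous (d - 1)) ∧ ∀ (s : ℂ) i,
      pderiv (Sum.inl i) (Fh d P s) = ∑ k ∈ Finset.range r, s ^ k • Hk k i := by
  choose r g h0 hg using fun q => subst_expand (n := n) (xpart P q)
  let R := ∑ q ∈ Finset.range (d+1), r q
  have h1 : ∀ q ∈ Finset.range (d+1), ∀ s : ℂ, pS P q s = ∑ k ∈ Finset.range R, s ^ k • g q k := by
    intro q hq s
    rw [pS, hg]
    refine Finset.sum_subset (Finset.range_mono (Finset.single_le_sum (fun _ _ => Nat.zero_le _) hq)) fun k _ hk => ?_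
    rw [h0 q k (by simpa using hk), smul_zero]
  refine ⟨R, fun k i => homogeneousComponent (d - 1) (∑ q ∈ Finset.range (d+1), X (Sum.inr ()) ^ (d - q) * rename Sum.inl (pderiv i (g q k))),
    fun k i => homogeneousComponent_isHomogeneous _ _, ?_⟩
  intro s i
  rw [← homogeneousComponent_eq_self ((Fh_hom d P s).pderiv (i := Sum.inl i)), pderiv_Fh]
  simp only [← map_smul, ← map_sum]
  congr 1
  simp only [Finset.smul_sum]
  rw [Finset.sum_comm]
  refine Finset.sum_congr rfl fun q hq => ?_
  rw [h1 q hq s]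
  simp only [map_sum, Finset.mul_sum]
  refine Finset.sum_congr rfl fun k _ => ?_
  rw [Derivation.map_smul, map_smul, mul_smul_comm]

end ChartInst
end

open MvPolynomial Filter CategoryTheory Limits Topology
noncomputable section
section CountCont
set_option linter.unusedSectionVars false
variable {σ : Type} [Fintype σ]

lemma charpoly_root_bound {N : ℕ} (M : Matrix (Fin N) (Fin N) ℂ) (c : ℂ) (h : M.charpoly.eval c = 0) :
    ‖c‖ ≤ ∑ i, ∑ j, ‖M i j‖ := by
  by_contra hlt
  push Not at hlt
  rw [Matrix.eval_charpoly] at h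
  refine det_ne_zero_of_sum_row_lt_diag (A := Matrix.scalar (Fin N) c - M) ?_ h
  intro k
  have h1 : ∑ j ∈ Finset.univ.erase k, ‖(Matrix.scalar (Fin N) c - M) k j‖ = ∑ j ∈ Finset.univ.erase k, ‖M k j‖ := by
    refine Finset.sum_congr rfl fun j hj => ?_
    have hjk : k ≠ j := fun h => (Finset.ne_of_mem_erase hj) h.symm
    simp [Matrix.scalar_apply, Matrix.diagonal_apply_ne _ hjk]
  have h2 : (Matrix.scalar (Fin N) c - M) k k = c - M k k := by simp [Matrix.scalar_apply]
  have h3 : ∑ j ∈ Finset.univ.erase k, ‖M k j‖ + ‖M k k‖ = ∑ j, ‖M k j‖ :=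
    Finset.sum_erase_add _ _ (Finset.mem_univ k)
  have h4 : ∑ j, ‖M k j‖ ≤ ∑ i, ∑ j, ‖M i j‖ :=
    Finset.single_le_sum (f := fun i => ∑ j, ‖M i j‖) (fun i _ => Finset.sum_nonneg fun j _ => norm_nonneg _) (Finset.mem_univ k)
  have h5 : ‖c‖ - ‖M k k‖ ≤ ‖c - M k k‖ := norm_sub_norm_le _ _
  rw [h1, h2]
  linarith

lemma exists_tuple {α : Type*} (S : Multiset α) (N : ℕ) (h : S.card = N) :
    ∃ f : Fin N → α, S = Finset.univ.val.map f := by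
  induction S using Quot.inductionOn with
  | h L =>
    have hL : L.length = N := h
    subst hL
    refine ⟨L.get, ?_⟩
    rw [Fin.univ_val_map, List.ofFn_get]
    rfl

theorem count_cont (S : ℂ → Multiset (σ → ℂ)) (N : ℕ) (M : σ → ℂ → Matrix (Fin N) (Fin N) ℂ)
    (hM : ∀ j, ContinuousAt (M j) 0)
    (hS : ∀ᶠ s in 𝓝 (0:ℂ), (S s).card = N ∧ ∀ j (c : ℂ), ((S s).map (fun v => c - v j)).prod = (M j s).charpoly.eval c)
    (hcl : ∀ v0, v0 ∉ S 0 → ∀ᶠ q in 𝓝 ((0:ℂ), v0), q.2 ∉ S q.1) (j0 : σ)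
    (Q : (σ → ℂ) → Prop) [DecidablePred Q] [DecidablePred fun v : σ → ℂ => v j0 = 0]
    (hQ1 : ∀ v0 ∈ S 0, v0 j0 = 0 → ∀ᶠ v in 𝓝 v0, Q v) (hQ2 : ∀ v0 ∈ S 0, v0 j0 ≠ 0 → ∀ᶠ v in 𝓝 v0, ¬ Q v) :
    ∀ᶠ s in 𝓝 (0:ℂ), (S s).countP Q = (S 0).countP (fun v => v j0 = 0) := by
  classical
  by_contra hcon
  rw [Filter.not_eventually] at hcon
  -- bounds
  have hb : ∀ᶠ s in 𝓝 (0:ℂ), ∀ j, ∑ i, ∑ i', ‖M j s i i'‖ ≤ (∑ i, ∑ i', ‖M j 0 i i'‖) + 1 := by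
    rw [Filter.eventually_all]
    intro j
    have h1 : Tendsto (fun s => ∑ i, ∑ i', ‖M j s i i'‖) (𝓝 0) (𝓝 (∑ i, ∑ i', ‖M j 0 i i'‖)) := by
      refine tendsto_finsetSum _ fun i _ => tendsto_finsetSum _ fun i' _ => Tendsto.norm ?_
      exact continuousAt_pi.mp (continuousAt_pi.mp (hM j) i) i'
    exact (h1.eventually (gt_mem_nhds (lt_add_one _))).mono fun s hs => le_of_lt hs
  obtain ⟨sk, hsk, hbad⟩ := Filter.exists_seq_forall_of_frequently (hcon.and_eventually (hS.and hb))
  choose f hf using fun k => exists_tuple (S (sk k)) N (hbad k).2.1.1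
  have hfm : ∀ k i, f k i ∈ S (sk k) := fun k i => by rw [hf k]; exact Multiset.mem_map_of_mem _ (Finset.mem_univ_val i)
  have hfb : ∀ k i j, ‖f k i j‖ ≤ ∑ j, ((∑ i, ∑ i', ‖M j 0 i i'‖) + 1) := by
    intro k i j
    have h0 : (M j (sk k)).charpoly.eval (f k i j) = 0 := by
      rw [← (hbad k).2.1.2]
      exact Multiset.prod_eq_zero (Multiset.mem_map.mpr ⟨f k i, hfm k i, sub_self _⟩)
    refine (charpoly_root_bound _ _ h0).trans (((hbad k).2.2 j).trans ?_)
    exact Finset.single_le_sum (f := fun j => (∑ i, ∑ i', ‖M j 0 i i'‖) + 1) (fun j _ => by positivity) (Finset.mem_univ j)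
  have hbd : Bornology.IsBounded (Set.range f) := by
    rw [isBounded_iff_forall_norm_le]
    refine ⟨∑ j, ((∑ i, ∑ i', ‖M j 0 i i'‖) + 1), ?_⟩
    rintro _ ⟨k, rfl⟩
    have hnn : 0 ≤ ∑ j : σ, ((∑ i, ∑ i', ‖M j 0 i i'‖) + 1) := Finset.sum_nonneg fun j _ => by positivity
    exact (pi_norm_le_iff_of_nonneg hnn).mpr fun i => (pi_norm_le_iff_of_nonneg hnn).mpr fun j => hfb k i j
  obtain ⟨a, -, φ, hφ, ha⟩ := tendsto_subseq_of_bounded hbd (fun k => Set.mem_range_self k)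
  have hsφ : Tendsto (fun k => sk (φ k)) atTop (𝓝 0) := hsk.comp hφ.tendsto_atTop
  have hai : ∀ i, Tendsto (fun k => f (φ k) i) atTop (𝓝 (a i)) := fun i => (tendsto_pi_nhds.mp ha) i
  have haS : ∀ i, a i ∈ S 0 := by
    intro i
    by_contra hi
    have h1 := (hsφ.prodMk_nhds (hai i)).eventually (hcl _ hi)
    obtain ⟨k, hk⟩ := h1.exists
    exact hk (hfm _ i)
  have hprod : Finset.univ.val.map (fun i => a i j0) = (S 0).map (fun v => v j0) := by
    apply multiset_eq_of_prod
    intro c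
    rw [Multiset.map_map, Multiset.map_map]
    have e2 : ((S 0).map ((fun a => c - a) ∘ fun v => v j0)).prod = (M j0 0).charpoly.eval c := hS.self_of_nhds.2 j0 c
    have e1 : (Finset.univ.val.map ((fun a => c - a) ∘ fun i => a i j0)).prod = ∏ i, (c - a i j0) := rfl
    rw [e1, e2]
    have t1 : Tendsto (fun k => ∏ i, (c - f (φ k) i j0)) atTop (𝓝 (∏ i, (c - a i j0))) :=
      tendsto_finsetProd _ fun i _ => tendsto_const_nhds.sub ((tendsto_pi_nhds.mp (hai i)) j0)
    have t2 : Tendsto (fun k => (M j0 (sk (φ k))).charpoly.eval c) atTop (𝓝 ((M j0 0).charpoly.eval c)) := by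
      simp only [Matrix.eval_charpoly]
      have hc : Continuous fun A : Matrix (Fin N) (Fin N) ℂ => (Matrix.scalar (Fin N) c - A).det :=
        (continuous_const.sub continuous_id).matrix_det
      exact (hc.tendsto _).comp ((hM j0).tendsto.comp hsφ)
    refine tendsto_nhds_unique t1 (t2.congr fun k => ?_)
    rw [← (hbad (φ k)).2.1.2, hf, Multiset.map_map]
    rfl
  have hQ : ∀ᶠ k in atTop, ∀ i, Q (f (φ k) i) ↔ a i j0 = 0 := by
    rw [Filter.eventually_all]
    intro i
    by_cases h : a i j0 = 0
    · filter_upwards [(hai i).eventually (hQ1 _ (haS i) h)] with k hk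
      simp [h, hk]
    · filter_upwards [(hai i).eventually (hQ2 _ (haS i) h)] with k hk
      simp [h, hk]
  obtain ⟨k, hk⟩ := hQ.exists
  apply (hbad (φ k)).1
  have c1 : (S 0).countP (fun v => v j0 = 0) = ((S 0).map (fun v => v j0)).countP (fun z => z = 0) := by
    rw [Multiset.countP_map, Multiset.countP_eq_card_filter]
    congr!
  have c2 : (S (sk (φ k))).countP Q = (Finset.univ.val.map (fun i => a i j0)).countP (fun z => z = 0) := by
    rw [hf, Multiset.countP_map, Multiset.countP_map]
    congr 1
    simp only [hk]
    congr!
  rw [c1, c2, hprod]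

lemma exists_linear_form (T : Set (σ → ℂ)) (hT : T.Finite) (h0 : ∀ v ∈ T, v ≠ 0) :
    ∃ l : MvPolynomial σ ℂ, l.IsHomogeneous 1 ∧ ∀ v ∈ T, eval v l ≠ 0 := by
  classical
  have : Finite T := hT
  obtain ⟨f, hf⟩ := Module.exists_dual_forall_apply_ne_zero (K := ℂ) (fun v : T => v.1) (fun v => h0 v.1 v.2)
  refine ⟨∑ j, C (f (Pi.single j 1)) * X j, IsHomogeneous.sum _ _ _ fun j _ => ?_, ?_⟩
  · have := (isHomogeneous_C σ (f (Pi.single j 1))).mul (isHomogeneous_X ℂ j)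
    simpa using this
  · intro v hv
    have h1 : eval v (∑ j, C (f (Pi.single j 1)) * X j) = f v := by
      rw [map_sum]
      conv_rhs => rw [pi_eq_sum_univ v]
      rw [map_sum]
      refine Finset.sum_congr rfl fun j _ => ?_
      rw [map_smul]
      simp only [map_mul, eval_C, eval_X, smul_eq_mul]
      rw [mul_comm]
      congr 2
      ext i
      simp [Pi.single_apply, eq_comm]
    rw [h1]
    exact hf ⟨v, hv⟩

lemma pow_le_of_zeros (I : Ideal (MvPolynomial σ ℂ)) (h : ∀ u : σ → ℂ, (∀ f ∈ I, eval u f = 0) → u = 0) :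
    ∃ D, idealOfVars σ ℂ ^ D ≤ I := by
  refine Ideal.exists_pow_le_of_le_radical_of_fg ?_ (idealOfVars_fg σ ℂ)
  rw [← MvPolynomial.vanishingIdeal_zeroLocus_eq_radical (K := ℂ) I, Ideal.span_le]
  rintro _ ⟨j, rfl⟩
  rw [SetLike.mem_coe, MvPolynomial.mem_vanishingIdeal_iff]
  intro x hx
  have := h x fun g hg => by
    have := hx g hg
    simpa [aeval_eq_eval] using this
  rw [this]; simp

lemma zeros_of_pow_le (I : Ideal (MvPolynomial σ ℂ)) (D : ℕ) (hD : idealOfVars σ ℂ ^ D ≤ I) (u : σ → ℂ)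
    (h : ∀ f ∈ I, eval u f = 0) : u = 0 := by
  funext j
  have h1 : (X j : MvPolynomial σ ℂ) ^ D ∈ I := hD (Ideal.pow_mem_pow (Ideal.subset_span (Set.mem_range_self j)) _)
  have h2 := h _ h1
  rw [map_pow, eval_X] at h2
  exact eq_zero_of_pow_eq_zero h2

lemma zero_span {m : ℕ} (H : Fin m → MvPolynomial σ ℂ) (l : MvPolynomial σ ℂ) (u : σ → ℂ) :
    (∀ f ∈ Ideal.span (Set.range H) ⊔ Ideal.span {l}, eval u f = 0) ↔ (∀ i, eval u (H i) = 0) ∧ eval u l = 0 := by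
  constructor
  · intro h
    exact ⟨fun i => h _ (Ideal.mem_sup_left (Ideal.subset_span ⟨i, rfl⟩)),
      h _ (Ideal.mem_sup_right (Ideal.mem_span_singleton_self _))⟩
  · rintro ⟨h1, h2⟩ f hf
    have h3 : Ideal.span (Set.range H) ⊔ Ideal.span {l} ≤ ptI u := by
      refine sup_le ?_ ?_
      · rw [Ideal.span_le]
        rintro _ ⟨i, rfl⟩
        exact h1 i
      · rw [Ideal.span_le, Set.singleton_subset_iff]
        exact h2
    exact h3 hf

end CountCont
end

open MvPolynomial Filter CategoryTheory Limits Topology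
noncomputable section
section FinalAsm
set_option linter.unusedSectionVars false
variable {n : ℕ}

def Hs (d : ℕ) (P : MvPolynomial (XS n) ℂ) (s : ℂ) (i : Fin n) : MvPolynomial (HV n) ℂ :=
  pderiv (Sum.inl i) (Fh d P s)

lemma Hs_hom (d : ℕ) (P : MvPolynomial (XS n) ℂ) (s : ℂ) (i : Fin n) : (Hs d P s i).IsHomogeneous (d - 1) :=
  (Fh_hom d P s).pderiv

lemma hv_split (u : HV n → ℂ) : u = Sum.elim (fun i => u (Sum.inl i)) (fun _ => u (Sum.inr ())) := by
  funext j
  rcases j with i | b <;> rfl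

lemma Hs_smul (d : ℕ) (P : MvPolynomial (XS n) ℂ) (s : ℂ) (u : HV n → ℂ) (h : ∀ i, eval u (Hs d P s i) = 0) (c : ℂ) (i : Fin n) :
    eval (c • u) (Hs d P s i) = 0 := by
  rw [hom_eval_smul (Hs_hom d P s i), h, mul_zero]

lemma Hs_fin {d : ℕ} (P : MvPolynomial (XS n) ℂ) (s : ℂ) (hs : DegXAt d P s) (u : HV n → ℂ)
    (h : ∀ i, eval u (Hs d P s i) = 0) (hu : u (Sum.inr ()) ≠ 0) :
    CritPt P ((u (Sum.inr ()))⁻¹ • fun i => u (Sum.inl i)) s ∧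
      u = u (Sum.inr ()) • Sum.elim ((u (Sum.inr ()))⁻¹ • fun i => u (Sum.inl i)) (fun _ => 1) := by
  have h1 : (u (Sum.inr ()))⁻¹ • u = Sum.elim ((u (Sum.inr ()))⁻¹ • fun i => u (Sum.inl i)) (fun _ => 1) := by
    funext j
    rcases j with i | b
    · rfl
    · change (u (Sum.inr ()))⁻¹ * u (Sum.inr ()) = 1
      exact inv_mul_cancel₀ hu
  refine ⟨?_, ?_⟩
  · rw [critPt_iff P s hs]
    intro i
    rw [← h1]
    exact Hs_smul d P s u h _ i
  · rw [← h1, smul_smul, mul_inv_cancel₀ hu, one_smul]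

lemma Hs_inf {d : ℕ} (P : MvPolynomial (XS n) ℂ) (s : ℂ) (u : HV n → ℂ)
    (h : ∀ i, eval u (Hs d P s i) = 0) (hu : u (Sum.inr ()) = 0) :
    WCond d P (fun i => u (Sum.inl i)) s ∧ u = Sum.elim (fun i => u (Sum.inl i)) (fun _ => 0) := by
  have h1 := hv_split u
  rw [hu] at h1
  refine ⟨fun i => ?_, h1⟩
  rw [← eval_pderiv_Fh_inf, ← h1]
  exact h i

lemma W_rep {d : ℕ} (P : MvPolynomial (XS n) ℂ) (s : ℂ) (x : Fin n → ℂ) (hx : x ≠ 0) (hW : WCond d P x s) :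
    ∃ p ∈ Wset d P s, ∃ c : ℂ, c ≠ 0 ∧ x = c • p.rep := by
  obtain ⟨c, hc⟩ := Projectivization.exists_smul_eq_mk_rep ℂ x hx
  refine ⟨Projectivization.mk ℂ x hx, ?_, (c⁻¹ : ℂˣ), Units.ne_zero _, ?_⟩
  · change WCond d P (Projectivization.mk ℂ x hx).rep s
    rw [← hc]
    exact wcond_smul d P s _ x hW
  · rw [← hc, Units.smul_def, smul_smul, Units.inv_mul, one_smul]

lemma elim_smul (c : ℂ) (x : Fin n → ℂ) (z : ℂ) :
    (Sum.elim (c • x) (fun _ => c * z) : HV n → ℂ) = c • Sum.elim x (fun _ => z) := by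
  funext j
  rcases j with i | b <;> rfl

lemma cnt_filter {α : Type*} [DecidableEq α] (S : Multiset α) (Q : α → Prop) [DecidablePred Q] :
    ∑ v ∈ (S.filter Q).toFinset, S.count v = S.countP Q := by
  rw [Multiset.countP_eq_card_filter, ← Multiset.toFinset_sum_count_eq]
  refine Finset.sum_congr rfl fun v hv => ?_
  rw [Multiset.count_filter_of_pos]
  rw [Multiset.mem_toFinset, Multiset.mem_filter] at hv
  exact hv.2

def Good (d : ℕ) (P : MvPolynomial (XS n) ℂ) (l : MvPolynomial (HV n) ℂ) (N : ℕ) (M : HV n → ℂ → Matrix (Fin N) (Fin N) ℂ)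
    (s : ℂ) (S : Multiset (HV n → ℂ)) : Prop :=
  S.card = N ∧ (∀ j (c : ℂ), (S.map (fun v => c - v j)).prod = (M j s).charpoly.eval c) ∧
  (∀ v, v ∈ S ↔ eval v l = 1 ∧ ∀ i, eval v (Hs d P s i) = 0) ∧
  (∀ u, (∀ i, eval u (Hs d P s i) = 0) → eval u l = 0 → u = 0) ∧
  (∀ v [DecidableEq (HV n → ℂ)], IsMult (sliceI (Hs d P s) l) v (S.count v))

theorem family {d : ℕ} (hd : 2 ≤ d) (P : MvPolynomial (XS n) ℂ) (hdeg : DegXAt d P 0) (hfisi : FISIat d P 0) :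
    ∃ (l : MvPolynomial (HV n) ℂ) (_ : l.IsHomogeneous 1) (N : ℕ) (M : HV n → ℂ → Matrix (Fin N) (Fin N) ℂ)
      (S : ℂ → Multiset (HV n → ℂ)), (∀ j, ContinuousAt (M j) 0) ∧ ∀ᶠ s in 𝓝 (0:ℂ), Good d P l N M s (S s) := by
  classical
  obtain ⟨l, hl, hlT⟩ := exists_linear_form (σ := HV n)
    ((fun p : PrjInf n => (Sum.elim p.rep (fun _ => 0) : HV n → ℂ)) '' (Wset d P 0) ∪
      (fun a : Fin n → ℂ => (Sum.elim a (fun _ => 1) : HV n → ℂ)) '' {x | CritPt P x 0})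
    ((hfisi.2.2.image _).union (hfisi.1.image _)) (by
      rintro v (⟨p, hp, rfl⟩ | ⟨a, ha, rfl⟩) h0
      · exact p.rep_nonzero (funext fun i => congrFun h0 (Sum.inl i))
      · exact one_ne_zero (congrFun h0 (Sum.inr ())))
  have hz : ∀ u, (∀ i, eval u (Hs d P 0 i) = 0) → eval u l = 0 → u = 0 := by
    intro u hu hlu
    by_contra hne
    by_cases h0 : u (Sum.inr ()) = 0
    · obtain ⟨hW, hue⟩ := Hs_inf P 0 u hu h0
      have hx : (fun i => u (Sum.inl i)) ≠ 0 := by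
        intro hx
        apply hne
        rw [hue, hx]
        funext j
        rcases j with i | b <;> rfl
      obtain ⟨p, hp, c, hc, hxe⟩ := W_rep P 0 _ hx hW
      have h1 : u = c • Sum.elim p.rep (fun _ => 0) := by
        rw [hue, hxe, ← elim_smul, mul_zero]
      rw [h1, hom_eval_smul hl, pow_one] at hlu
      exact hlT _ (Or.inl ⟨p, hp, rfl⟩) ((mul_eq_zero.mp hlu).resolve_left hc)
    · obtain ⟨hC, hue⟩ := Hs_fin P 0 hdeg u hu h0
      rw [hue, hom_eval_smul hl, pow_one] at hlu
      exact hlT _ (Or.inr ⟨_, hC, rfl⟩) ((mul_eq_zero.mp hlu).resolve_left h0)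
  obtain ⟨D0, hD0⟩ := pow_le_of_zeros (Ideal.span (Set.range (Hs d P 0)) ⊔ Ideal.span {l}) (fun u hu => by
    obtain ⟨h1, h2⟩ := (zero_span _ _ _).mp hu
    exact hz u h1 h2)
  obtain ⟨r, Hk, hHk, hexp⟩ := H_expand d P
  obtain ⟨N, M, hM, hev⟩ := slice_cont (σ := HV n) (m := n) (e := d - 1) (by simp) (by omega) Hk hHk (Hs d P) hexp l hl hD0
  have hch : ∀ s, ∃ S : Multiset (HV n → ℂ), ((∃ D1 : ℕ, idealOfVars (HV n) ℂ ^ D1 ≤ Ideal.span (Set.range (Hs d P s)) ⊔ Ideal.span {l}) ∧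
      Module.Finite ℂ (MvPolynomial (HV n) ℂ ⧸ sliceI (Hs d P s) l) ∧
        Module.finrank ℂ (MvPolynomial (HV n) ℂ ⧸ sliceI (Hs d P s) l) = N ∧
        ∀ j (c : ℂ), dact ℂ (MvPolynomial (HV n) ℂ ⧸ sliceI (Hs d P s) l) (C c - X j) = (M j s).charpoly.eval c) → Good d P l N M s S := by
    intro s
    by_cases h : ((∃ D1 : ℕ, idealOfVars (HV n) ℂ ^ D1 ≤ Ideal.span (Set.range (Hs d P s)) ⊔ Ideal.span {l}) ∧
      Module.Finite ℂ (MvPolynomial (HV n) ℂ ⧸ sliceI (Hs d P s) l) ∧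
        Module.finrank ℂ (MvPolynomial (HV n) ℂ ⧸ sliceI (Hs d P s) l) = N ∧
        ∀ j (c : ℂ), dact ℂ (MvPolynomial (HV n) ℂ ⧸ sliceI (Hs d P s) l) (C c - X j) = (M j s).charpoly.eval c)
    · obtain ⟨⟨D1, hD1⟩, hfin, hN, hdact⟩ := h
      obtain ⟨S, s1, s2, s3, s4, s5⟩ := exists_mult_pts (sliceI (Hs d P s) l)
      have hzz : ∀ v, (∀ u ∈ sliceI (Hs d P s) l, eval v u = 0) ↔ eval v l = 1 ∧ ∀ i, eval v (Hs d P s i) = 0 := by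
        intro v
        rw [sliceI, zero_span, map_sub, map_one, sub_eq_zero, and_comm]
      refine ⟨S, fun _ => ⟨s1.trans hN, ?_, ?_, ?_, s5⟩⟩
      · intro j c
        rw [← hdact, s2]
        simp
      · intro v
        rw [← hzz]
        exact ⟨s3 v, s4 v⟩
      · intro u hu hlu
        exact zeros_of_pow_le _ D1 hD1 u ((zero_span _ _ _).mpr ⟨hu, hlu⟩)
    · exact ⟨0, fun h' => absurd h' h⟩
  choose S hS using hch
  exact ⟨l, hl, N, M, S, hM, hev.mono fun s hs => hS s hs⟩

end FinalAsm
end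

open MvPolynomial Filter CategoryTheory Limits Topology
noncomputable section
section FinalAsm2
set_option linter.unusedSectionVars false
variable {n : ℕ}

lemma lhs_count {d N : ℕ} (P : MvPolynomial (XS n) ℂ) (l : MvPolynomial (HV n) ℂ) (hl : l.IsHomogeneous 1)
    (M : HV n → ℂ → Matrix (Fin N) (Fin N) ℂ) (s : ℂ) (S : Multiset (HV n → ℂ)) (hG : Good d P l N M s S)
    (hs : DegXAt d P s) (hGI : ∀ x, WCond d P x s → x = 0) (R : ℝ)
    [DecidablePred fun v : HV n → ℂ => R * ‖v (Sum.inr ())‖ < ‖fun i => v (Sum.inl i)‖] :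
    (∑ᶠ a ∈ {a : Fin n → ℂ | CritPt P a s ∧ R < ‖a‖}, muAt P s a) =
      S.countP (fun v : HV n → ℂ => R * ‖v (Sum.inr ())‖ < ‖fun i => v (Sum.inl i)‖) := by
  classical
  obtain ⟨-, -, hmem, hzero, hmult⟩ := hG
  rw [← cnt_filter, ← finsum_mem_coe_finset]
  have hla : ∀ a : Fin n → ℂ, CritPt P a s → eval (Sum.elim a (fun _ => 1) : HV n → ℂ) l ≠ 0 := by
    intro a ha h0
    have := hzero _ ((critPt_iff P s hs a).mp ha) h0
    exact one_ne_zero (congrFun this (Sum.inr ()))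
  have hlv : ∀ a : Fin n → ℂ, CritPt P a s → eval ((eval (Sum.elim a (fun _ => 1) : HV n → ℂ) l)⁻¹ • (Sum.elim a (fun _ => 1) : HV n → ℂ)) l = 1 := by
    intro a ha
    rw [hom_eval_smul hl, pow_one, inv_mul_cancel₀ (hla a ha)]
  refine finsum_mem_eq_of_bijOn (fun a : Fin n → ℂ => (eval (Sum.elim a (fun _ => 1) : HV n → ℂ) l)⁻¹ • (Sum.elim a (fun _ => 1) : HV n → ℂ)) ⟨?_, ?_, ?_⟩ ?_
  · rintro a ⟨ha, hR⟩
    rw [Finset.mem_coe, Multiset.mem_toFinset, Multiset.mem_filter, hmem]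
    refine ⟨⟨hlv a ha, Hs_smul d P s _ ((critPt_iff P s hs a).mp ha) _⟩, ?_⟩
    have hc : 0 < ‖(eval (Sum.elim a (fun _ => 1) : HV n → ℂ) l)⁻¹‖ := norm_pos_iff.mpr (inv_ne_zero (hla a ha))
    change R * ‖(eval (Sum.elim a (fun _ => 1) : HV n → ℂ) l)⁻¹ * 1‖ < ‖(eval (Sum.elim a (fun _ => 1) : HV n → ℂ) l)⁻¹ • a‖
    rw [norm_smul, mul_one, mul_comm]
    exact mul_lt_mul_of_pos_left hR hc
  · rintro a ⟨ha, -⟩ b ⟨hb, -⟩ hab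
    beta_reduce at hab
    have h1 := congrFun hab (Sum.inr ())
    simp only [Pi.smul_apply, Sum.elim_inr, smul_eq_mul, mul_one] at h1
    funext i
    have h2 := congrFun hab (Sum.inl i)
    simp only [Pi.smul_apply, Sum.elim_inl, smul_eq_mul] at h2
    rw [← h1] at h2
    exact mul_left_cancel₀ (inv_ne_zero (hla a ha)) h2
  · intro v hv
    rw [Finset.mem_coe, Multiset.mem_toFinset, Multiset.mem_filter, hmem] at hv
    obtain ⟨⟨hv1, hvH⟩, hvR⟩ := hv
    have h0 : v (Sum.inr ()) ≠ 0 := by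
      intro h0
      obtain ⟨hW, hve⟩ := Hs_inf P s v hvH h0
      have hx := hGI _ hW
      have hv0 : v = (0:ℂ) • v := by
        rw [zero_smul, hve, hx]
        funext j
        rcases j with i | b <;> rfl
      rw [hv0, hom_eval_smul hl, pow_one, zero_mul] at hv1
      exact zero_ne_one hv1
    obtain ⟨hC, hve⟩ := Hs_fin P s hs v hvH h0
    set a := (v (Sum.inr ()))⁻¹ • fun i => v (Sum.inl i) with ha
    have hl1 : v (Sum.inr ()) * eval (Sum.elim a (fun _ => 1) : HV n → ℂ) l = 1 := by
      have h2 := hv1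
      rw [hve, hom_eval_smul hl, pow_one] at h2
      exact h2
    refine ⟨a, ⟨hC, ?_⟩, ?_⟩
    · rw [ha, norm_smul, norm_inv]
      have hp : 0 < ‖v (Sum.inr ())‖ := norm_pos_iff.mpr h0
      rw [← div_eq_inv_mul, lt_div_iff₀ hp]
      exact hvR
    · beta_reduce
      rw [← eq_inv_of_mul_eq_one_left hl1]
      exact hve.symm
  · rintro a ⟨ha, -⟩
    have h1 := dh0_mult (Hs d P s) (Hs_hom d P s) l hl _ (hlv a ha) a _ (inv_ne_zero (hla a ha)) rfl _ (hmult _)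
    rw [← h1]
    unfold muAt
    congr 2
    funext i
    exact (dh0_pderiv P s hs i).symm

lemma rhs_count {d N : ℕ} (P : MvPolynomial (XS n) ℂ) (l : MvPolynomial (HV n) ℂ) (hl : l.IsHomogeneous 1)
    (M : HV n → ℂ → Matrix (Fin N) (Fin N) ℂ) (S : Multiset (HV n → ℂ)) (hG : Good d P l N M 0 S)
    (hfin : (Wset d P 0).Finite)
    [DecidablePred fun v : HV n → ℂ => v (Sum.inr ()) = 0] :
    ∑ p ∈ hfin.toFinset, germDim (Set.range fun i => dh (jp p) (pderiv (Sum.inl i) (Fh d P 0))) (chartPt p) =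
      S.countP (fun v : HV n → ℂ => v (Sum.inr ()) = 0) := by
  classical
  obtain ⟨-, -, hmem, hzero, hmult⟩ := hG
  rw [← cnt_filter, ← finsum_mem_coe_finset, ← finsum_mem_coe_finset]
  have hWH : ∀ p ∈ Wset d P 0, ∀ i, eval (Sum.elim p.rep (fun _ => 0) : HV n → ℂ) (Hs d P 0 i) = 0 := by
    intro p hp i
    rw [Hs, eval_pderiv_Fh_inf]
    exact hp i
  have hla : ∀ p ∈ Wset d P 0, eval (Sum.elim p.rep (fun _ => 0) : HV n → ℂ) l ≠ 0 := by
    intro p hp h0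
    have := hzero _ (hWH p hp) h0
    exact p.rep_nonzero (funext fun i => congrFun this (Sum.inl i))
  have hlv : ∀ p ∈ Wset d P 0, eval ((eval (Sum.elim p.rep (fun _ => 0) : HV n → ℂ) l)⁻¹ • (Sum.elim p.rep (fun _ => 0) : HV n → ℂ)) l = 1 := by
    intro p hp
    rw [hom_eval_smul hl, pow_one, inv_mul_cancel₀ (hla p hp)]
  rw [hfin.coe_toFinset]
  refine finsum_mem_eq_of_bijOn (fun p : PrjInf n => (eval (Sum.elim p.rep (fun _ => 0) : HV n → ℂ) l)⁻¹ • (Sum.elim p.rep (fun _ => 0) : HV n → ℂ)) ⟨?_, ?_, ?_⟩ ?_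
  · intro p hp
    rw [Finset.mem_coe, Multiset.mem_toFinset, Multiset.mem_filter, hmem]
    refine ⟨⟨hlv p hp, Hs_smul d P 0 _ (hWH p hp) _⟩, ?_⟩
    simp
  · intro p hp q hq hpq
    beta_reduce at hpq
    have hcp := inv_ne_zero (hla p hp)
    have hcq := inv_ne_zero (hla q hq)
    rw [← p.mk_rep, ← q.mk_rep, Projectivization.mk_eq_mk_iff']
    refine ⟨(eval (Sum.elim p.rep (fun _ => 0) : HV n → ℂ) l) * (eval (Sum.elim q.rep (fun _ => 0) : HV n → ℂ) l)⁻¹, ?_⟩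
    funext i
    have h2 := congrFun hpq (Sum.inl i)
    simp only [Pi.smul_apply, Sum.elim_inl, smul_eq_mul] at h2
    rw [Pi.smul_apply, smul_eq_mul, mul_assoc, ← h2, ← mul_assoc, mul_inv_cancel₀ (hla p hp), one_mul]
  · intro v hv
    rw [Finset.mem_coe, Multiset.mem_toFinset, Multiset.mem_filter, hmem] at hv
    obtain ⟨⟨hv1, hvH⟩, h0⟩ := hv
    obtain ⟨hW, hve⟩ := Hs_inf P 0 v hvH h0
    have hx : (fun i => v (Sum.inl i)) ≠ 0 := by
      intro hx
      have hv0 : v = (0:ℂ) • v := by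
        rw [zero_smul, hve, hx]
        funext j
        rcases j with i | b <;> rfl
      rw [hv0, hom_eval_smul hl, pow_one, zero_mul] at hv1
      exact zero_ne_one hv1
    obtain ⟨p, hp, c, hc, hxe⟩ := W_rep P 0 _ hx hW
    have h1 : v = c • Sum.elim p.rep (fun _ => 0) := by
      rw [hve, hxe, ← elim_smul, mul_zero]
    refine ⟨p, hp, ?_⟩
    beta_reduce
    rw [h1, hom_eval_smul hl, pow_one] at hv1
    rw [← eq_inv_of_mul_eq_one_left hv1, h1]
  · intro p hp
    have h1 := dh_mult (Hs d P 0) (Hs_hom d P 0) l hl _ (hlv p hp) p _ (inv_ne_zero (hla p hp)) rfl _ (hmult _)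
    rw [← h1]
    rfl

theorem main_thm {n d : ℕ} (hd : 2 ≤ d) (P : MvPolynomial (XS n) ℂ)
    (hdeg : ∃ ε > (0:ℝ), ∀ s : ℂ, ‖s‖ < ε → DegXAt d P s) (hfisi : FISIat d P 0)
    (hGI : ∃ ε > (0:ℝ), ∀ s : ℂ, 0 < ‖s‖ → ‖s‖ < ε → ∀ x : Fin n → ℂ, WCond d P x s → x = 0) :
    ∃ R₀ : ℝ, 0 < R₀ ∧ ∀ R ≥ R₀, ∃ ε > (0:ℝ), ∀ s : ℂ, 0 < ‖s‖ → ‖s‖ < ε →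
      (∑ᶠ a ∈ {a : Fin n → ℂ | CritPt P a s ∧ R < ‖a‖}, muAt P s a)
        = lamTot d P 0 + ∑ᶠ p ∈ Wset d P 0, (muGen d P p 0 + muInf d P p 0) := by
  classical
  obtain ⟨ε1, hε1, hdeg⟩ := hdeg
  obtain ⟨ε2, hε2, hGI⟩ := hGI
  have hdeg0 : DegXAt d P 0 := hdeg 0 (by simpa using hε1)
  obtain ⟨l, hl, N, M, S, hM, hev⟩ := family hd P hdeg0 hfisi
  have hG0 := hev.self_of_nhds
  obtain ⟨B, hB⟩ := isBounded_iff_forall_norm_le.mp hfisi.1.isBounded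
  refine ⟨max B 0 + 1, by positivity, fun R hR => ?_⟩
  have hBR : ∀ a : Fin n → ℂ, CritPt P a 0 → ‖a‖ < R := fun a ha => by
    have h1 := hB a ha
    have h2 := le_max_left B 0
    linarith
  have hcont : ∀ i, Continuous fun q : ℂ × (HV n → ℂ) => eval q.2 (Hs d P q.1 i) := by
    intro i
    obtain ⟨r, Hk, hHk, hexp⟩ := H_expand d P
    have : (fun q : ℂ × (HV n → ℂ) => eval q.2 (Hs d P q.1 i)) =
        fun q => ∑ k ∈ Finset.range r, q.1 ^ k * eval q.2 (Hk k i) := by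
      funext q
      rw [Hs, hexp, map_sum]
      simp only [smul_eval]
    rw [this]
    refine continuous_finsetSum _ fun k _ => (continuous_fst.pow k).mul ?_
    exact (MvPolynomial.continuous_eval (Hk k i)).comp continuous_snd
  have hcnt := count_cont S N M hM (hev.mono fun s hs => ⟨hs.1, hs.2.1⟩) (by
    intro v0 hv0
    have hg : ∀ᶠ q in 𝓝 ((0:ℂ), v0), Good d P l N M q.1 (S q.1) :=
      (continuous_fst.tendsto ((0:ℂ), v0)).eventually hev
    rw [hG0.2.2.1] at hv0
    by_cases h1 : eval v0 l = 1
    · have h2 : ∃ i, eval v0 (Hs d P 0 i) ≠ 0 := by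
        by_contra hc
        push Not at hc
        exact hv0 ⟨h1, hc⟩
      obtain ⟨i, hi⟩ := h2
      filter_upwards [hg, (hcont i).continuousAt.eventually_ne (x := ((0:ℂ), v0)) hi] with q hq hqi hqS
      rw [hq.2.2.1] at hqS
      exact hqi (hqS.2 i)
    · have hc : Continuous fun q : ℂ × (HV n → ℂ) => eval q.2 l := (MvPolynomial.continuous_eval l).comp continuous_snd
      filter_upwards [hg, hc.continuousAt.eventually_ne (x := ((0:ℂ), v0)) h1] with q hq hql hqS
      rw [hq.2.2.1] at hqS
      exact hql hqS.1) (Sum.inr ())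
    (fun v : HV n → ℂ => R * ‖v (Sum.inr ())‖ < ‖fun i => v (Sum.inl i)‖) (by
      intro v0 hv0 h0
      rw [hG0.2.2.1] at hv0
      have hx : (fun i => v0 (Sum.inl i)) ≠ 0 := by
        intro hx
        obtain ⟨_, hve⟩ := Hs_inf P 0 v0 hv0.2 h0
        have hv00 : v0 = (0:ℂ) • v0 := by
          rw [zero_smul, hve, hx]
          funext j
          rcases j with i | b <;> rfl
        have h1 := hv0.1
        rw [hv00, hom_eval_smul hl, pow_one, zero_mul] at h1
        exact zero_ne_one h1
      have hlt : R * ‖v0 (Sum.inr ())‖ < ‖fun i => v0 (Sum.inl i)‖ := by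
        rw [h0, norm_zero, mul_zero]; exact norm_pos_iff.mpr hx
      have c1 : Continuous fun v : HV n → ℂ => R * ‖v (Sum.inr ())‖ := by fun_prop
      have c2 : Continuous fun v : HV n → ℂ => ‖fun i => v (Sum.inl i)‖ := by fun_prop
      exact c1.continuousAt.eventually_lt c2.continuousAt hlt) (by
      intro v0 hv0 h0
      rw [hG0.2.2.1] at hv0
      obtain ⟨hC, -⟩ := Hs_fin P 0 hdeg0 v0 hv0.2 h0
      have h1 := hBR _ hC
      have hp : 0 < ‖v0 (Sum.inr ())‖ := norm_pos_iff.mpr h0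
      rw [norm_smul, norm_inv, ← div_eq_inv_mul, div_lt_iff₀ hp] at h1
      have c1 : Continuous fun v : HV n → ℂ => R * ‖v (Sum.inr ())‖ := by fun_prop
      have c2 : Continuous fun v : HV n → ℂ => ‖fun i => v (Sum.inl i)‖ := by fun_prop
      exact (c2.continuousAt.eventually_lt c1.continuousAt h1).mono fun v hv => not_lt.mpr hv.le)
  obtain ⟨ε3, hε3, h3⟩ := Metric.eventually_nhds_iff.mp (hcnt.and hev)
  refine ⟨min ε1 (min ε2 ε3), by positivity, fun s hs0 hs => ?_⟩
  have hs1 : ‖s‖ < ε1 := hs.trans_le (min_le_left _ _)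
  have hs2 : ‖s‖ < ε2 := hs.trans_le ((min_le_right _ _).trans (min_le_left _ _))
  have hs3 : ‖s‖ < ε3 := hs.trans_le ((min_le_right _ _).trans (min_le_right _ _))
  obtain ⟨hc, hg⟩ := h3 (y := s) (by simpa using hs3)
  rw [lhs_count P l hl M s (S s) hg (hdeg s hs1) (hGI s hs0 hs2) R, rhs_eq hd P hfisi,
    rhs_count P l hl M (S 0) hG0 hfisi.2.2]
  exact hc

end FinalAsm2
end

/-- For a general-at-infinity deformation of a FISI polynomial `f₀`:
for every sufficiently large `R` there is `ε > 0` such that for all `0 < |s| < ε`, the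
total Milnor number of the critical points of `f_s` outside the ball of radius `R` is
`μ_{II}(s) + μ_{III}(s) = λ(0) + Σ_{p ∈ W₀} (μ_{p,gen}(0) + μ_p^∞(0))`. -/
theorem stmt14 {n d : ℕ} (hn : 2 ≤ n) (hd : 2 ≤ d) (P : MvPolynomial (XS n) ℂ)
    (hdeg : ∃ ε > (0:ℝ), ∀ s : ℂ, ‖s‖ < ε → DegXAt d P s)
    (hfisi : FISIat d P 0)
    (hGI : ∃ ε > (0:ℝ), ∀ s : ℂ, 0 < ‖s‖ → ‖s‖ < ε →
      ∀ x : Fin n → ℂ, WCond d P x s → x = 0) :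
    ∃ R₀ : ℝ, 0 < R₀ ∧ ∀ R ≥ R₀, ∃ ε > (0:ℝ), ∀ s : ℂ, 0 < ‖s‖ → ‖s‖ < ε →
      (∑ᶠ a ∈ {a : Fin n → ℂ | CritPt P a s ∧ R < ‖a‖}, muAt P s a) =
        lamTot d P 0 + ∑ᶠ p ∈ Wset d P 0, (muGen d P p 0 + muInf d P p 0) := by
  exact main_thm hd P hdeg hfisi hGI
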